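/- For every integer m ≥ 1 there exists a real number V_∞ with 0 < V_∞ < ∞ such that the variance of the number of real roots of the m×m KSS system satisfies lim_{d→∞} Var(N_{P_d}) / d^{m/2} = V_∞. -/

import Mathlib

open MeasureTheory ProbabilityTheory Real Filter Nat

/-- Index set for the coefficients of the `m × m` KSS system of degree `d`:
a pair of an equation index `ℓ ∈ {1,…,m}` and a multi-index `j ∈ ℕ^m` with `|j| ≤ d`
(encoded with entries in `Fin (d+1)`). -/
abbrev kssIndex (m d : ℕ) :=
  Fin m × {j : Fin m → Fin (d + 1) // (∑ k, (j k : ℕ)) ≤ d}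

/-- Variance `d! / (j_1! ⋯ j_m! (d - |j|)!)` of the coefficient `a^{(ℓ)}_j`. -/
noncomputable def kssVar (m d : ℕ) (i : kssIndex m d) : NNReal :=
  (d ! : NNReal) / ((∏ k, ((i.2.1 k : ℕ))! : ℕ) * ((d - ∑ k, (i.2.1 k : ℕ))! : ℕ))

/-- The law of the coefficients: product of independent centered Gaussian measures. -/
noncomputable def kssMeasure (m d : ℕ) : Measure (kssIndex m d → ℝ) :=
  Measure.pi fun i => gaussianReal 0 (kssVar m d i)

/-- The polynomial `P_ℓ(t) = ∑_{|j| ≤ d} a^{(ℓ)}_j t^j`. -/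
noncomputable def kssPoly (m d : ℕ) (ω : kssIndex m d → ℝ) (ℓ : Fin m)
    (t : Fin m → ℝ) : ℝ :=
  ∑ j : {j : Fin m → Fin (d + 1) // (∑ k, (j k : ℕ)) ≤ d},
    ω (ℓ, j) * ∏ k, t k ^ (j.1 k : ℕ)

/-- The number of roots of the system `P_d = 0` in `ℝ^m`. -/
noncomputable def kssCount (m d : ℕ) (ω : kssIndex m d → ℝ) : ℕ :=
  Set.ncard {t : Fin m → ℝ | ∀ ℓ, kssPoly m d ω ℓ t = 0}
/-- The number of elements of a set, as an extended nonnegative real. -/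
noncomputable def setCount {α : Type*} (A : Set α) : ENNReal :=
  ∑' x, A.indicator (fun _ => (1 : ENNReal)) x

lemma setCount_eq_encard {α : Type*} (A : Set α) : setCount A = (A.encard : ENNReal) := by
  rw [setCount, ← ENNReal.tsum_set_one, tsum_subtype A (fun _ => (1 : ENNReal))]

lemma setCount_iUnion {α ι : Type*} (A : ι → Set α) (hA : Pairwise (Function.onFun Disjoint A)) :
    setCount (⋃ i, A i) = ∑' i, setCount (A i) := by
  unfold setCount
  rw [ENNReal.tsum_comm]
  congr 1; ext x
  by_cases hx : ∃ i, x ∈ A i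
  · obtain ⟨i, hi⟩ := hx
    rw [tsum_eq_single i, Set.indicator_of_mem hi, Set.indicator_of_mem (Set.mem_iUnion.2 ⟨i, hi⟩)]
    intro j hj
    exact Set.indicator_of_notMem (fun h => (Set.disjoint_left.1 (hA hj) h hi)) _
  · rw [Set.indicator_of_notMem (by simpa using hx)]
    symm
    rw [ENNReal.tsum_eq_zero]
    intro j
    exact Set.indicator_of_notMem (fun h => hx ⟨j, h⟩) _

lemma setCount_inter_preimage {α β : Type*} {f : α → β} {s : Set α} (hf : Set.InjOn f s) (y : β) :
    setCount {x ∈ s | f x = y} = (f '' s).indicator (fun _ => (1 : ENNReal)) y := by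
  rw [setCount_eq_encard]
  by_cases hy : y ∈ f '' s
  · obtain ⟨x, hx, rfl⟩ := hy
    rw [Set.indicator_of_mem (Set.mem_image_of_mem f hx)]
    have : {x' ∈ s | f x' = f x} = {x} := by
      ext z; constructor
      · rintro ⟨hz, h⟩; exact hf hz hx h
      · rintro rfl; exact ⟨hx, rfl⟩
    rw [this]; simp
  · rw [Set.indicator_of_notMem hy]
    have : {x' ∈ s | f x' = y} = ∅ := by
      ext z; constructor
      · rintro ⟨hz, h⟩; exact (hy ⟨z, hz, h⟩).elim
      · simp
    rw [this]; simp

section Area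

variable {E : Type*} [NormedAddCommGroup E] [NormedSpace ℝ E] [FiniteDimensional ℝ E]
  [MeasurableSpace E] [BorelSpace E]

lemma exists_injOn_partition {s : Set E} (hs : MeasurableSet s)
    {f : E → E} {f' : E → E →L[ℝ] E} (hf' : ∀ x ∈ s, HasFDerivWithinAt f (f' x) s x)
    (hdet : ∀ x ∈ s, (f' x).det ≠ 0) :
    ∃ t : ℕ → Set E, Pairwise (Function.onFun Disjoint t) ∧ (∀ n, MeasurableSet (t n)) ∧
      (s = ⋃ n, t n) ∧ ∀ n, Set.InjOn f (t n) := by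
  have key : ∀ A : E →L[ℝ] E, ∃ c : NNReal, c ≠ 0 ∧ (A.det ≠ 0 → ∀ u : Set E,
      ApproximatesLinearOn f A u c → Set.InjOn f u) := by
    intro A
    by_cases hA : A.det ≠ 0
    · set e := A.toContinuousLinearEquivOfDetNeZero hA with he
      have hAe : (e : E →L[ℝ] E) = A := A.coe_toContinuousLinearEquivOfDetNeZero hA
      rcases subsingleton_or_nontrivial E with hE | hE
      · exact ⟨1, one_ne_zero, fun _ u hu => Set.injOn_of_injective (fun a b _ => hE.elim a b)⟩
      · have h0 : 0 < ‖(e.symm : E →L[ℝ] E)‖₊ := by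
          have := e.nnnorm_symm_pos
          exact this
        refine ⟨‖(e.symm : E →L[ℝ] E)‖₊⁻¹ / 2, by positivity, fun _ u hu => ?_⟩
        rw [← hAe] at hu
        exact hu.injOn (Or.inr (NNReal.half_lt_self (by positivity)))
    · exact ⟨1, one_ne_zero, fun h => (hA h).elim⟩
  choose r hr0 hr using key
  rcases s.eq_empty_or_nonempty with rfl | hne
  · exact ⟨fun _ => ∅, fun i j _ => by simp [Function.onFun], by simp, by simp, by simp⟩
  obtain ⟨t, A, h1, h2, h3, h4, h5⟩ :=
    exists_partition_approximatesLinearOn_of_hasFDerivWithinAt f s f' hf' r hr0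
  refine ⟨fun n => s ∩ t n, ?_, fun n => hs.inter (h2 n), ?_, fun n => ?_⟩
  · intro i j hij
    exact (h1 hij).mono Set.inter_subset_right Set.inter_subset_right
  · rw [← Set.inter_iUnion]; exact (Set.inter_eq_left.2 h3).symm
  · obtain ⟨y, hy, hAy⟩ := h5 hne n
    exact hr (A n) (hAy ▸ hdet y hy) _ (h4 n)

lemma lintegral_setCount_fiber_mul_of_det_ne_zero {s : Set E} (hs : MeasurableSet s)
    {f : E → E} {f' : E → E →L[ℝ] E} (hf' : ∀ x ∈ s, HasFDerivWithinAt f (f' x) s x)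
    (hdet : ∀ x ∈ s, (f' x).det ≠ 0) (μ : Measure E) [μ.IsAddHaarMeasure]
    {g : E → ENNReal} (hg : Measurable g) :
    ∫⁻ y, setCount {x ∈ s | f x = y} * g y ∂μ
      = ∫⁻ x in s, ENNReal.ofReal |(f' x).det| * g (f x) ∂μ := by
  obtain ⟨t, h1, h2, h3, h4⟩ := exists_injOn_partition hs hf' hdet
  have hts : ∀ n, t n ⊆ s := fun n => h3 ▸ Set.subset_iUnion t n
  have hd : ∀ n, ∀ x ∈ t n, HasFDerivWithinAt f (f' x) (t n) x :=
    fun n x hx => (hf' x (hts n hx)).mono (hts n)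
  have himg : ∀ n, MeasurableSet (f '' t n) := fun n =>
    measurable_image_of_fderivWithin (h2 n) (hd n) (h4 n)
  have e1 : ∀ y, setCount {x ∈ s | f x = y} * g y
      = ∑' n, (f '' t n).indicator g y := by
    intro y
    have : {x ∈ s | f x = y} = ⋃ n, {x ∈ t n | f x = y} := by
      ext x
      rw [h3]; simp
    rw [this, setCount_iUnion, ← ENNReal.tsum_mul_right]
    · congr 1; ext n
      rw [setCount_inter_preimage (h4 n)]
      by_cases hy : y ∈ f '' t n <;> simp [hy]
    · intro i j hij
      exact (h1 hij).mono (fun x hx => hx.1) (fun x hx => hx.1)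
  simp_rw [e1]
  rw [lintegral_tsum (fun n => (hg.indicator (himg n)).aemeasurable), h3,
    lintegral_iUnion h2 h1]
  congr 1; ext n
  rw [lintegral_indicator (himg n),
    lintegral_image_eq_lintegral_abs_det_fderiv_mul μ (h2 n) (hd n) (h4 n)]

/-- The area formula with multiplicities. -/
lemma lintegral_setCount_fiber_mul {s : Set E} (hs : MeasurableSet s)
    {f : E → E} {f' : E → E →L[ℝ] E} (hf' : ∀ x ∈ s, HasFDerivWithinAt f (f' x) s x)
    (hdet : Measurable fun x => (f' x).det) (μ : Measure E) [μ.IsAddHaarMeasure]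
    {g : E → ENNReal} (hg : Measurable g) :
    ∫⁻ y, setCount {x ∈ s | f x = y} * g y ∂μ
      = ∫⁻ x in s, ENNReal.ofReal |(f' x).det| * g (f x) ∂μ := by
  set Z : Set E := {x | (f' x).det = 0}
  have hZ : MeasurableSet Z := hdet (measurableSet_singleton 0)
  have hnull : μ (f '' (s ∩ Z)) = 0 :=
    addHaar_image_eq_zero_of_det_fderivWithin_eq_zero μ (f' := f')
      (fun x hx => (hf' x hx.1).mono Set.inter_subset_left) (fun x hx => hx.2)
  have hae : ∀ᵐ y ∂μ, setCount {x ∈ s | f x = y} * g y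
      = setCount {x ∈ s \ Z | f x = y} * g y := by
    filter_upwards [measure_eq_zero_iff_ae_notMem.1 hnull] with y hy
    congr 2
    ext x
    constructor
    · rintro ⟨h1, h2⟩
      exact ⟨⟨h1, fun h => hy ⟨x, ⟨h1, h⟩, h2⟩⟩, h2⟩
    · rintro ⟨h1, h2⟩
      exact ⟨h1.1, h2⟩
  rw [lintegral_congr_ae hae, lintegral_setCount_fiber_mul_of_det_ne_zero (hs.diff hZ)
    (fun x hx => (hf' x hx.1).mono Set.sdiff_subset) (fun x hx => hx.2) μ hg,
    ← lintegral_inter_add_sdiff _ s hZ]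
  rw [setLIntegral_congr_fun (g := fun _ => 0) (hs.inter hZ)]
  · simp
  · intro x hx
    have : (f' x).det = 0 := hx.2
    simp [this]

end Area

section CountMeasurability

variable {X E F : Type*} [TopologicalSpace X] [MeasurableSpace X] [OpensMeasurableSpace X]
  [MetricSpace E] [TopologicalSpace F] [T1Space F] [Zero F]

lemma measurableSet_exists_zero {Φ : X → E → F} (hΦ : Continuous (Function.uncurry Φ))
    {K : Set E} (hK : IsCompact K) : MeasurableSet {x | ∃ t ∈ K, Φ x t = 0} := by
  have : CompactSpace K := isCompact_iff_compactSpace.1 hK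
  have h : {x | ∃ t ∈ K, Φ x t = 0}
      = Prod.fst '' {p : X × K | Function.uncurry Φ (p.1, (p.2 : E)) = 0} := by
    ext x; simp
  rw [h]
  refine (isClosedMap_fst_of_compactSpace _ ?_).measurableSet
  exact (isClosed_singleton (x := (0 : F))).preimage (hΦ.comp (by fun_prop))

variable [SecondCountableTopology E]

lemma exists_countable_compact_basis {T : Set E} (hT : IsSigmaCompact T) :
    ∃ B : ℕ × ℕ × ℕ → Set E, (∀ i, IsCompact (B i)) ∧ (∀ i, B i ⊆ T) ∧
      ∀ p ∈ T, ∀ U, IsOpen U → p ∈ U → ∃ i, p ∈ B i ∧ B i ⊆ U := by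
  obtain ⟨K, hK, rfl⟩ := hT
  rcases isEmpty_or_nonempty E with hE | hE
  · exact ⟨fun _ => ∅, by simp, by simp, fun p => (hE.false p).elim⟩
  refine ⟨fun i => K i.1 ∩ Metric.closedBall (TopologicalSpace.denseSeq E i.2.1)
    (1 / ((i.2.2 : ℝ) + 1)), fun i => (hK _).inter_right Metric.isClosed_closedBall,
    fun i => Set.inter_subset_left.trans (Set.subset_iUnion K _), ?_⟩
  intro p hp U hU hpU
  obtain ⟨n, hn⟩ := Set.mem_iUnion.1 hp
  obtain ⟨ε, hε, hεU⟩ := Metric.isOpen_iff.1 hU p hpU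
  obtain ⟨k, hk⟩ := exists_nat_one_div_lt (half_pos hε)
  obtain ⟨j, hj⟩ := (TopologicalSpace.denseRange_denseSeq E).exists_dist_lt p
    (show (0 : ℝ) < 1 / ((k : ℝ) + 1) by positivity)
  refine ⟨(n, j, k), ⟨hn, Metric.mem_closedBall.2 hj.le⟩, fun q hq => hεU ?_⟩
  have h1 : dist q (TopologicalSpace.denseSeq E j) ≤ 1 / ((k : ℝ) + 1) := hq.2
  rw [Metric.mem_ball]
  have := dist_triangle q (TopologicalSpace.denseSeq E j) p
  rw [dist_comm (TopologicalSpace.denseSeq E j) p] at this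
  linarith

omit [SecondCountableTopology E] in
lemma setCount_eq_iSup {Z T : Set E} (hZ : Z ⊆ T) {B : ℕ × ℕ × ℕ → Set E}
    (hB : ∀ p ∈ T, ∀ U, IsOpen U → p ∈ U → ∃ i, p ∈ B i ∧ B i ⊆ U) :
    setCount Z = ⨆ S : {S : Finset (ℕ × ℕ × ℕ) // (S : Set (ℕ × ℕ × ℕ)).PairwiseDisjoint B},
      ∑ i ∈ S.1, {i | ∃ t ∈ B i, t ∈ Z}.indicator (fun _ => (1 : ENNReal)) i := by
  classical
  apply le_antisymm
  · rw [setCount, ENNReal.tsum_eq_iSup_sum]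
    refine iSup_le fun s => ?_
    obtain ⟨U, hU, hd⟩ := (s.filter (· ∈ Z)).finite_toSet.t2_separation
    have hsel : ∀ p ∈ s.filter (· ∈ Z), ∃ i, p ∈ B i ∧ B i ⊆ U p := fun p hp =>
      hB p (hZ (Finset.mem_filter.1 hp).2) (U p) (hU p).2 (hU p).1
    choose! ι hι using hsel
    have hinj : Set.InjOn ι (s.filter (· ∈ Z) : Finset E) := by
      intro p hp q hq hpq
      by_contra hne
      have h1 := (hι p hp).1
      have h2 := (hι q hq)
      exact Set.disjoint_left.1 (hd hp hq hne) ((hι p hp).2 h1) (h2.2 (hpq ▸ h1))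
    refine le_trans ?_ (le_iSup _ ⟨(s.filter (· ∈ Z)).image ι, ?_⟩)
    · rw [Finset.sum_image hinj, Finset.sum_indicator_eq_sum_filter]
      refine Finset.sum_le_sum fun p hp => ?_
      rw [Set.indicator_of_mem]
      exact ⟨p, (hι p hp).1, (Finset.mem_filter.1 hp).2⟩
    · intro a ha b hb hab
      simp only [Finset.coe_image, Set.mem_image] at ha hb
      obtain ⟨p, hp, rfl⟩ := ha
      obtain ⟨q, hq, rfl⟩ := hb
      exact (hd hp hq (fun h => hab (h ▸ rfl))).mono (hι p hp).2 (hι q hq).2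
  · refine iSup_le fun S => ?_
    calc ∑ i ∈ S.1, {i | ∃ t ∈ B i, t ∈ Z}.indicator (fun _ => (1 : ENNReal)) i
        ≤ ∑ i ∈ S.1, ∑' x, (Z ∩ B i).indicator (fun _ => (1 : ENNReal)) x := by
          refine Finset.sum_le_sum fun i _ => ?_
          by_cases hi : ∃ t ∈ B i, t ∈ Z
          · obtain ⟨t, ht, htZ⟩ := hi
            rw [Set.indicator_of_mem (show i ∈ {i | ∃ t ∈ B i, t ∈ Z} from ⟨t, ht, htZ⟩)]
            refine le_trans ?_ (ENNReal.le_tsum t)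
            rw [Set.indicator_of_mem (show t ∈ Z ∩ B i from ⟨htZ, ht⟩)]
          · rw [Set.indicator_of_notMem (show i ∉ {i | ∃ t ∈ B i, t ∈ Z} from hi)]
            exact zero_le
      _ = ∑' x, ∑ i ∈ S.1, (Z ∩ B i).indicator (fun _ => (1 : ENNReal)) x :=
          (Summable.tsum_finsetSum (fun i _ => ENNReal.summable)).symm
      _ ≤ setCount Z := by
          refine ENNReal.tsum_le_tsum fun x => ?_
          by_cases hx : x ∈ Z
          · rw [Set.indicator_of_mem hx]
            by_cases h : ∃ i ∈ S.1, x ∈ B i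
            · obtain ⟨i, hi, hxi⟩ := h
              rw [Finset.sum_eq_single_of_mem i hi,
                Set.indicator_of_mem (show x ∈ Z ∩ B i from ⟨hx, hxi⟩)]
              intro j hj hji
              exact Set.indicator_of_notMem
                (fun h => Set.disjoint_left.1 (S.2 hj hi hji) h.2 hxi) _
            · rw [Finset.sum_eq_zero]
              · exact zero_le
              · intro i hi
                exact Set.indicator_of_notMem (fun h' => h ⟨i, hi, h'.2⟩) _
          · rw [Finset.sum_eq_zero]
            · exact zero_le
            · intro i hi
              exact Set.indicator_of_notMem (fun h' => hx h'.1) _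

lemma measurable_setCount_zeros {T : Set E} (hT : IsSigmaCompact T) {Φ : X → E → F}
    (hΦ : Continuous (Function.uncurry Φ)) :
    Measurable fun x => setCount {t ∈ T | Φ x t = 0} := by
  obtain ⟨B, hBc, hBT, hB⟩ := exists_countable_compact_basis hT
  have : (fun x => setCount {t ∈ T | Φ x t = 0}) = fun x =>
      ⨆ S : {S : Finset (ℕ × ℕ × ℕ) // (S : Set (ℕ × ℕ × ℕ)).PairwiseDisjoint B},
      ∑ i ∈ S.1, {x | ∃ t ∈ B i, Φ x t = 0}.indicator (fun _ => (1 : ENNReal)) x := by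
    ext x
    rw [setCount_eq_iSup (Set.sep_subset _ _) hB]
    refine iSup_congr fun S => Finset.sum_congr rfl fun i _ => ?_
    simp only [Set.indicator, Set.mem_ofPred_eq]
    congr 1
    apply propext
    exact ⟨fun ⟨t, h1, h2, h3⟩ => ⟨t, h1, h3⟩, fun ⟨t, h1, h3⟩ => ⟨t, h1, hBT i h1, h3⟩⟩
  rw [this]
  refine Measurable.iSup fun S => Finset.measurable_sum _ fun i _ => ?_
  exact measurable_const.indicator (measurableSet_exists_zero hΦ (hBc i))

end CountMeasurability

section Gaussian

variable {H : Type*} [NormedAddCommGroup H] [InnerProductSpace ℝ H] [FiniteDimensional ℝ H]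
  [MeasurableSpace H] [BorelSpace H]

/-- The density of the standard Gaussian measure with respect to Lebesgue measure. -/
noncomputable def stdGaussianDensity (x : H) : ENNReal :=
  ENNReal.ofReal ((√(2 * π))⁻¹ ^ Module.finrank ℝ H * Real.exp (-‖x‖ ^ 2 / 2))

omit [FiniteDimensional ℝ H] in
lemma measurable_stdGaussianDensity : Measurable (stdGaussianDensity (H := H)) := by
  unfold stdGaussianDensity; fun_prop

omit [FiniteDimensional ℝ H] [MeasurableSpace H] [BorelSpace H] in
lemma ofReal_exp_density_aux (x : H) :
    0 ≤ (√(2 * π))⁻¹ ^ Module.finrank ℝ H * Real.exp (-‖x‖ ^ 2 / 2) := by positivity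

lemma integral_exp_density :
    ∀ t : H, ∫ x, ((√(2 * π))⁻¹ ^ Module.finrank ℝ H * Real.exp (-‖x‖ ^ 2 / 2) : ℝ) •
      Complex.exp (inner ℝ x t * Complex.I) = Complex.exp (-‖t‖ ^ 2 / 2) := by
  intro t
  have h := GaussianFourier.integral_cexp_neg_mul_sq_norm_add (V := H) (b := (1 / 2 : ℂ))
    (by norm_num) Complex.I t
  have e : ∀ x : H, ((√(2 * π))⁻¹ ^ Module.finrank ℝ H * Real.exp (-‖x‖ ^ 2 / 2) : ℝ) •
      Complex.exp (inner ℝ x t * Complex.I)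
      = ((√(2 * π))⁻¹ ^ Module.finrank ℝ H : ℝ) *
        Complex.exp (-(1 / 2) * ‖x‖ ^ 2 + Complex.I * inner ℝ t x) := by
    intro x
    rw [Complex.exp_add, Complex.real_smul, real_inner_comm]
    push_cast
    rw [mul_assoc]
    congr 3
    · ring_nf
    · ring_nf
  simp_rw [e]
  rw [integral_const_mul, h, ← mul_assoc]
  have hp : ((√(2 * π))⁻¹ ^ Module.finrank ℝ H : ℝ) *
      ((π : ℂ) / (1 / 2)) ^ (Module.finrank ℝ H / 2 : ℂ) = 1 := by
    have h1 : ((π : ℂ) / (1 / 2)) ^ (Module.finrank ℝ H / 2 : ℂ)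
        = (((2 * π) ^ ((Module.finrank ℝ H : ℝ) / 2) : ℝ) : ℂ) := by
      rw [Complex.ofReal_cpow (by positivity)]
      push_cast
      congr 1; ring
    rw [h1, ← Complex.ofReal_mul, Real.sqrt_eq_rpow, ← Real.rpow_neg (by positivity),
      ← Real.rpow_natCast, ← Real.rpow_mul (by positivity), ← Real.rpow_add (by positivity)]
    simp only [Complex.ofReal_eq_one]
    convert Real.rpow_zero _ using 2
    ring
  rw [hp, one_mul]
  congr 1
  rw [Complex.I_sq]; ring

lemma integrable_exp_density :
    Integrable fun x : H => (√(2 * π))⁻¹ ^ Module.finrank ℝ H * Real.exp (-‖x‖ ^ 2 / 2) := by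
  apply Integrable.of_integral_ne_zero
  have h := integral_exp_density (0 : H)
  simp only [inner_zero_right, Complex.ofReal_zero, zero_mul, Complex.exp_zero] at h
  have h2 : ∫ x : H, ((√(2 * π))⁻¹ ^ Module.finrank ℝ H * Real.exp (-‖x‖ ^ 2 / 2) : ℝ) = 1 := by
    have : ∀ x : ℝ, x • (1 : ℂ) = (x : ℂ) := by intro x; simp
    simp_rw [this] at h
    rw [integral_complex_ofReal] at h
    simpa using h
  rw [h2]; exact one_ne_zero

lemma stdGaussian_eq_withDensity :
    stdGaussian H = volume.withDensity (stdGaussianDensity (H := H)) := by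
  have hfin : IsFiniteMeasure (volume.withDensity (stdGaussianDensity (H := H))) :=
    isFiniteMeasure_withDensity_ofReal integrable_exp_density.2
  apply Measure.ext_of_charFun
  ext t
  rw [charFun_stdGaussian, charFun_apply, ← integral_exp_density t,
    integral_withDensity_eq_integral_toReal_smul measurable_stdGaussianDensity
      (ae_of_all _ fun x => ENNReal.ofReal_lt_top)]
  congr 1; ext x
  rw [stdGaussianDensity, ENNReal.toReal_ofReal (ofReal_exp_density_aux x)]

lemma lintegral_pi_prod {n : ℕ} {α : Type*} [MeasurableSpace α] (μ : Measure α) [SigmaFinite μ]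
    (f : Fin n → α → ENNReal) (hf : ∀ i, Measurable (f i)) :
    ∫⁻ x : Fin n → α, ∏ i, f i (x i) ∂(Measure.pi fun _ => μ) = ∏ i, ∫⁻ x, f i x ∂μ := by
  induction n with
  | zero => simp
  | succ n ih =>
    have hfm : Measurable fun x : Fin (n + 1) → α => ∏ i, f i (x i) :=
      Finset.measurable_prod _ fun i _ => (hf i).comp (measurable_pi_apply i)
    rw [← ((measurePreserving_piFinSuccAbove (fun _ : Fin (n + 1) => μ) 0).symm).lintegral_comp
      hfm]
    simp_rw [MeasurableEquiv.piFinSuccAbove_symm_apply, Fin.insertNthEquiv,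
      Fin.prod_univ_succ, Fin.insertNth_zero, Equiv.coe_fn_mk, Fin.cons_succ,
      Fin.cons_zero]
    rw [← ih _ (fun i => hf i.succ), ← lintegral_prod_mul]
    · rfl
    · exact (hf 0).aemeasurable
    · exact (Finset.measurable_prod _ fun i _ =>
        (hf i.succ).comp (measurable_pi_apply i)).aemeasurable

lemma pi_withDensity {n : ℕ} {α : Type*} [MeasurableSpace α] (μ : Measure α) [SigmaFinite μ]
    {f : α → ENNReal} (hf : Measurable f) [SigmaFinite (μ.withDensity f)] :
    Measure.pi (fun _ : Fin n => μ.withDensity f)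
      = (Measure.pi fun _ : Fin n => μ).withDensity fun x => ∏ i, f (x i) := by
  refine Measure.pi_eq fun s hs => ?_
  rw [withDensity_apply _ (MeasurableSet.univ_pi hs), ← lintegral_indicator
    (MeasurableSet.univ_pi hs)]
  simp_rw [withDensity_apply _ (hs _), ← lintegral_indicator (hs _)]
  rw [← lintegral_pi_prod μ _ (fun i => hf.indicator (hs i))]
  congr 1; ext x
  by_cases hx : x ∈ Set.univ.pi s
  · rw [Set.indicator_of_mem hx]
    exact Finset.prod_congr rfl fun i _ =>
      (Set.indicator_of_mem (hx i (Set.mem_univ i)) _).symm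
  · rw [Set.indicator_of_notMem hx]
    simp only [Set.mem_pi, Set.mem_univ, true_implies, not_forall] at hx
    obtain ⟨i, hi⟩ := hx
    exact (Finset.prod_eq_zero (Finset.mem_univ i) (Set.indicator_of_notMem hi _)).symm

variable {H' : Type*} [NormedAddCommGroup H'] [InnerProductSpace ℝ H'] [FiniteDimensional ℝ H']
  [MeasurableSpace H'] [BorelSpace H']

lemma charFun_map_inner_stdGaussian {κ : Type*} [Fintype κ] (p : κ → H)
    (t : EuclideanSpace ℝ κ) :
    charFun ((stdGaussian H).map fun ξ => WithLp.toLp 2 fun k => inner ℝ ξ (p k)) t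
      = Complex.exp (-((∑ k, ∑ l, t k * t l * inner ℝ (p k) (p l) : ℝ) : ℂ) / 2) := by
  have hm : Measurable fun ξ : H => WithLp.toLp 2 fun k => inner ℝ ξ (p k) := by fun_prop
  rw [charFun_apply, integral_map hm.aemeasurable (by fun_prop)]
  have e : ∀ ξ : H, inner ℝ (WithLp.toLp 2 fun k => inner ℝ ξ (p k)) t
      = inner ℝ ξ (∑ k, t k • p k) := by
    intro ξ
    rw [PiLp.inner_apply, inner_sum]
    refine Finset.sum_congr rfl fun k _ => ?_
    rw [real_inner_smul_right]
    simp
  simp_rw [e]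
  rw [← charFun_apply, charFun_stdGaussian, ← Complex.ofReal_pow, ← real_inner_self_eq_norm_sq]
  congr 4
  rw [sum_inner]
  refine Finset.sum_congr rfl fun k _ => ?_
  rw [inner_sum]
  refine Finset.sum_congr rfl fun l _ => ?_
  rw [real_inner_smul_left, real_inner_smul_right]; ring

lemma map_inner_stdGaussian_congr {κ : Type*} [Fintype κ] (p : κ → H) (p' : κ → H')
    (h : ∀ k l, inner ℝ (p k) (p l) = (inner ℝ (p' k) (p' l) : ℝ)) :
    (stdGaussian H).map (fun ξ k => (inner ℝ ξ (p k) : ℝ))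
      = (stdGaussian H').map (fun ξ k => (inner ℝ ξ (p' k) : ℝ)) := by
  have key : (stdGaussian H).map (fun ξ => WithLp.toLp 2 fun k => (inner ℝ ξ (p k) : ℝ))
      = (stdGaussian H').map (fun ξ => WithLp.toLp 2 fun k => (inner ℝ ξ (p' k) : ℝ)) := by
    have h1 : IsFiniteMeasure ((stdGaussian H).map
        (fun ξ => WithLp.toLp 2 fun k => (inner ℝ ξ (p k) : ℝ))) := by infer_instance
    apply Measure.ext_of_charFun
    ext t
    rw [charFun_map_inner_stdGaussian, charFun_map_inner_stdGaussian]
    simp_rw [h]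
  have h2 := congrArg (Measure.map (WithLp.ofLp (p := 2))) key
  rwa [Measure.map_map (by fun_prop) (by fun_prop), Measure.map_map (by fun_prop) (by fun_prop)]
    at h2

lemma lintegral_pi_inner_congr {m : ℕ} {κ : Type*} [Fintype κ] (p : κ → H) (p' : κ → H')
    (h : ∀ k l, inner ℝ (p k) (p l) = (inner ℝ (p' k) (p' l) : ℝ))
    {G : (Fin m → κ → ℝ) → ENNReal} (hG : Measurable G) :
    ∫⁻ Ξ, G (fun ℓ k => inner ℝ (Ξ ℓ) (p k)) ∂(Measure.pi fun _ : Fin m => stdGaussian H)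
      = ∫⁻ Ξ, G (fun ℓ k => inner ℝ (Ξ ℓ) (p' k)) ∂(Measure.pi fun _ : Fin m => stdGaussian H')
      := by
  have h0 := map_inner_stdGaussian_congr p p' h
  have m1 : Measurable fun (ξ : H) k => (inner ℝ ξ (p k) : ℝ) := by fun_prop
  have m2 : Measurable fun (ξ : H') k => (inner ℝ ξ (p' k) : ℝ) := by fun_prop
  have i1 := Measure.pi_map_pi (μ := fun _ : Fin m => stdGaussian H)
    (f := fun _ ξ k => (inner ℝ ξ (p k) : ℝ)) (fun _ => m1.aemeasurable)
  have i2 := Measure.pi_map_pi (μ := fun _ : Fin m => stdGaussian H')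
    (f := fun _ ξ k => (inner ℝ ξ (p' k) : ℝ)) (fun _ => m2.aemeasurable)
  rw [h0, ← i2] at i1
  rw [← lintegral_map (μ := Measure.pi fun _ : Fin m => stdGaussian H)
    (g := fun Ξ ℓ k => (inner ℝ (Ξ ℓ) (p k) : ℝ)) hG (by fun_prop), ← lintegral_map
    (μ := Measure.pi fun _ : Fin m => stdGaussian H')
    (g := fun Ξ ℓ k => (inner ℝ (Ξ ℓ) (p' k) : ℝ)) hG (by fun_prop), i1]

end Gaussian

section KacRice

variable {m : ℕ} {H : Type*} [NormedAddCommGroup H] [InnerProductSpace ℝ H]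

/-- The values `⟪Ξ ℓ, x⟫` of a system of linear forms at `x`. -/
noncomputable def evalSystem (Ξ : Fin m → H) (x : H) : Fin m → ℝ := fun ℓ => inner ℝ (Ξ ℓ) x

/-- The determinant of the `m × m` matrix `⟪Ξ ℓ, y j⟫`. -/
noncomputable def detSystem (Ξ : Fin m → H) (y : Fin m → H) : ℝ :=
  Matrix.det (Matrix.of fun ℓ j => (inner ℝ (Ξ ℓ) (y j) : ℝ))

/-- Orthogonal projection of each row onto the complement of `x`. -/
noncomputable def projSystem (x : H) (Ξ : Fin m → H) : Fin m → H :=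
  fun ℓ => Ξ ℓ - (inner ℝ (Ξ ℓ) x / ‖x‖ ^ 2) • x

/-- Oblique projection of each row along `u` onto the complement of `x`. -/
noncomputable def obliqueSystem (u x : H) (Ξ : Fin m → H) : Fin m → H :=
  fun ℓ => Ξ ℓ - (inner ℝ (Ξ ℓ) x / inner ℝ u x) • u

/-- The standard Gaussian density on `Fin m → ℝ`. -/
noncomputable def gaussWeight (a : Fin m → ℝ) : ENNReal := ∏ ℓ, gaussianPDF 0 1 (a ℓ)

lemma measurable_gaussWeight : Measurable (gaussWeight (m := m)) :=
  Finset.measurable_prod _ fun i _ => (measurable_gaussianPDF 0 1).comp (measurable_pi_apply i)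

lemma lintegral_gaussWeight : ∫⁻ a, gaussWeight (m := m) a = 1 := by
  have := lintegral_pi_prod (n := m) (volume : Measure ℝ) (fun _ => gaussianPDF 0 1)
    (fun _ => measurable_gaussianPDF 0 1)
  rw [volume_pi]
  simp only [gaussWeight]
  rw [this]
  simp [lintegral_gaussianPDF_eq_one]

lemma lintegral_comp_add_smul (κ : (Fin m → ℝ) → ENNReal) (hκ : Measurable κ) (b : Fin m → ℝ)
    {c : ℝ} (hc : c ≠ 0) :
    ∫⁻ a : Fin m → ℝ, κ (fun ℓ => b ℓ - a ℓ * c) = ENNReal.ofReal (|c| ^ m)⁻¹ * ∫⁻ a, κ a := by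
  have h1 : ∫⁻ a, κ a = ∫⁻ a, κ (b + a) := (lintegral_add_left_eq_self κ b).symm
  have h2 := Measure.map_addHaar_smul (volume : Measure (Fin m → ℝ)) (neg_ne_zero.2 hc)
  have h3 : ∫⁻ a, κ (b + a) ∂(Measure.map ((-c) • ·) (volume : Measure (Fin m → ℝ)))
      = ∫⁻ a : Fin m → ℝ, κ (fun ℓ => b ℓ - a ℓ * c) := by
    rw [lintegral_map (by fun_prop) (by fun_prop)]
    congr 1; ext a; congr 1; ext ℓ
    simp; ring
  rw [← h3, h2, h1, lintegral_smul_measure, Module.finrank_fin_fun, abs_inv, abs_pow, abs_neg,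
    smul_eq_mul]

variable [FiniteDimensional ℝ H] [MeasurableSpace H] [BorelSpace H]

lemma lintegral_translate {u w : H} (huw : (inner ℝ u w : ℝ) ≠ 0) {κ : (Fin m → ℝ) → ENNReal}
    (hκ : Measurable κ) {Ψ : (Fin m → H) → ENNReal} (hΨ : Measurable Ψ) :
    ∫⁻ Ξ : Fin m → H, κ (evalSystem Ξ w) * ∫⁻ a : Fin m → ℝ, Ψ (fun ℓ => Ξ ℓ + a ℓ • u)
      = ENNReal.ofReal (|(inner ℝ u w : ℝ)| ^ m)⁻¹ * (∫⁻ a, κ a) * ∫⁻ Ξ, Ψ Ξ := by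
  have mev : Measurable fun Ξ : Fin m → H => evalSystem Ξ w := by unfold evalSystem; fun_prop
  have madd : Measurable fun p : (Fin m → H) × (Fin m → ℝ) => fun ℓ => p.1 ℓ + p.2 ℓ • u := by
    fun_prop
  have msub : Measurable fun p : (Fin m → H) × (Fin m → ℝ) => fun ℓ => p.1 ℓ - p.2 ℓ • u := by
    fun_prop
  calc ∫⁻ Ξ : Fin m → H, κ (evalSystem Ξ w) * ∫⁻ a : Fin m → ℝ, Ψ (fun ℓ => Ξ ℓ + a ℓ • u)
      = ∫⁻ Ξ : Fin m → H, ∫⁻ a : Fin m → ℝ,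
          κ (evalSystem Ξ w) * Ψ (fun ℓ => Ξ ℓ + a ℓ • u) := by
        refine lintegral_congr fun Ξ => ?_
        rw [lintegral_const_mul]
        exact hΨ.comp (by fun_prop)
    _ = ∫⁻ a : Fin m → ℝ, ∫⁻ Ξ : Fin m → H,
          κ (evalSystem Ξ w) * Ψ (fun ℓ => Ξ ℓ + a ℓ • u) := by
        refine lintegral_lintegral_swap ?_
        exact ((hκ.comp (mev.comp measurable_fst)).mul (hΨ.comp madd)).aemeasurable
    _ = ∫⁻ a : Fin m → ℝ, ∫⁻ Ξ : Fin m → H,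
          κ (fun ℓ => evalSystem Ξ w ℓ - a ℓ * inner ℝ u w) * Ψ Ξ := by
        refine lintegral_congr fun a => ?_
        rw [← lintegral_add_right_eq_self (μ := (volume : Measure (Fin m → H)))
          (fun Ξ => κ (fun ℓ => evalSystem Ξ w ℓ - a ℓ * inner ℝ u w) * Ψ Ξ)
          (fun ℓ => a ℓ • u)]
        refine lintegral_congr fun Ξ => ?_
        refine congrArg₂ _ ?_ rfl
        congr 1
        ext ℓ
        simp [evalSystem, inner_add_left, real_inner_smul_left]
    _ = ∫⁻ Ξ : Fin m → H, ∫⁻ a : Fin m → ℝ,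
          κ (fun ℓ => evalSystem Ξ w ℓ - a ℓ * inner ℝ u w) * Ψ Ξ := by
        refine lintegral_lintegral_swap ?_
        refine ((hκ.comp ?_).mul (hΨ.comp measurable_snd)).aemeasurable
        unfold evalSystem
        fun_prop
    _ = ∫⁻ Ξ : Fin m → H, ENNReal.ofReal (|(inner ℝ u w : ℝ)| ^ m)⁻¹ * (∫⁻ a, κ a) * Ψ Ξ := by
        refine lintegral_congr fun Ξ => ?_
        have hm : Measurable fun a : Fin m → ℝ =>
            κ (fun ℓ => evalSystem Ξ w ℓ - a ℓ * inner ℝ u w) := hκ.comp (by fun_prop)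
        rw [lintegral_mul_const _ hm, lintegral_comp_add_smul κ hκ _ huw]
    _ = _ := lintegral_const_mul _ hΨ

lemma measurePreserving_shear {x w : H} (h : (inner ℝ x w : ℝ) = 0) :
    MeasurePreserving (fun Ξ : Fin m → H => fun ℓ => Ξ ℓ + (inner ℝ (Ξ ℓ) x : ℝ) • w) := by
  refine measurePreserving_pi (fun _ => (volume : Measure H)) (fun _ => (volume : Measure H))
    (f := fun _ η => η + (inner ℝ η x : ℝ) • w) fun _ => ?_
  refine ⟨by fun_prop, ?_⟩
  have e : (fun η : H => η + (inner ℝ η x : ℝ) • w)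
      = LinearMap.transvection (innerSL ℝ x : H →ₗ[ℝ] ℝ) w := by
    ext η
    simp [LinearMap.transvection.apply, real_inner_comm]
  have hd : LinearMap.det (LinearMap.transvection (innerSL ℝ x : H →ₗ[ℝ] ℝ) w) = 1 := by
    rw [LinearMap.transvection.det]; simp [h]
  rw [e, Measure.map_linearMap_addHaar_eq_smul_addHaar _ (by rw [hd]; exact one_ne_zero), hd]
  simp

lemma lintegral_oblique {u x : H} (hu : ‖u‖ = 1) (hx : ‖x‖ = 1) (hux : (inner ℝ u x : ℝ) ≠ 0)
    {K : (Fin m → H) → ENNReal} (hK : Measurable K) :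
    ∫⁻ Ξ : Fin m → H, gaussWeight (evalSystem Ξ u) * K (obliqueSystem u x Ξ)
      = ENNReal.ofReal (|(inner ℝ u x : ℝ)| ^ m) *
        ∫⁻ Ξ : Fin m → H, gaussWeight (evalSystem Ξ x) * K (projSystem x Ξ) := by
  have muu : (inner ℝ u u : ℝ) = 1 := by rw [real_inner_self_eq_norm_sq, hu]; norm_num
  have mxx : (inner ℝ x x : ℝ) = 1 := by rw [real_inner_self_eq_norm_sq, hx]; norm_num
  have mo : Measurable fun Ξ : Fin m → H => obliqueSystem u x Ξ := by
    unfold obliqueSystem; fun_prop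
  have mev : ∀ w : H, Measurable fun Ξ : Fin m → H => evalSystem Ξ w := by
    intro w; unfold evalSystem; fun_prop
  have mu : Measurable fun Ξ : Fin m → H =>
      gaussWeight (evalSystem Ξ u) * K (obliqueSystem u x Ξ) :=
    (measurable_gaussWeight.comp (mev u)).mul (hK.comp mo)
  have mx : Measurable fun Ξ : Fin m → H =>
      gaussWeight (evalSystem Ξ x) * K (obliqueSystem u x Ξ) :=
    (measurable_gaussWeight.comp (mev x)).mul (hK.comp mo)
  have s1 : ∫⁻ Ξ : Fin m → H, gaussWeight (evalSystem Ξ x) * K (obliqueSystem u x Ξ)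
      = ENNReal.ofReal (|(inner ℝ u x : ℝ)| ^ m)⁻¹ *
        ∫⁻ Ξ : Fin m → H, gaussWeight (evalSystem Ξ u) * K (obliqueSystem u x Ξ) := by
    have := lintegral_translate (u := u) (w := u) (by rw [muu]; exact one_ne_zero)
      (measurable_gaussWeight (m := m))
      (Ψ := fun Ξ => gaussWeight (evalSystem Ξ x) * K (obliqueSystem u x Ξ))
      mx
    rw [muu, lintegral_gaussWeight] at this
    simp only [abs_one, one_pow, inv_one, ENNReal.ofReal_one, one_mul] at this
    rw [← this, ← lintegral_const_mul _ mu]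
    refine lintegral_congr fun Ξ => ?_
    have e1 : ∀ a : Fin m → ℝ, obliqueSystem u x (fun ℓ => Ξ ℓ + a ℓ • u)
        = obliqueSystem u x Ξ := by
      intro a; ext1 ℓ
      simp only [obliqueSystem, inner_add_left, real_inner_smul_left]
      rw [add_div, mul_div_cancel_right₀ _ hux, add_smul]
      abel
    simp_rw [e1]
    have hm : Measurable fun a : Fin m → ℝ =>
        gaussWeight (evalSystem (fun ℓ => Ξ ℓ + a ℓ • u) x) :=
      measurable_gaussWeight.comp (by unfold evalSystem; fun_prop)
    rw [lintegral_mul_const _ hm]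
    have e2 : ∫⁻ a : Fin m → ℝ, gaussWeight (evalSystem (fun ℓ => Ξ ℓ + a ℓ • u) x)
        = ENNReal.ofReal (|(inner ℝ u x : ℝ)| ^ m)⁻¹ := by
      have := lintegral_comp_add_smul (m := m) _ measurable_gaussWeight (evalSystem Ξ x)
        (neg_ne_zero.2 hux)
      rw [lintegral_gaussWeight, abs_neg, mul_one] at this
      rw [← this]
      congr 1; ext a; congr 1; ext ℓ
      simp [evalSystem, inner_add_left, real_inner_smul_left]
    rw [e2]; ring
  have s2 : ∫⁻ Ξ : Fin m → H, gaussWeight (evalSystem Ξ x) * K (obliqueSystem u x Ξ)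
      = ∫⁻ Ξ : Fin m → H, gaussWeight (evalSystem Ξ x) * K (projSystem x Ξ) := by
    set w : H := (inner ℝ u x : ℝ)⁻¹ • u - x with hw
    have hxw : (inner ℝ x w : ℝ) = 0 := by
      rw [hw, inner_sub_right, real_inner_smul_right, mxx, real_inner_comm x u]
      rw [real_inner_comm] at hux
      field_simp; ring
    rw [← (measurePreserving_shear (m := m) hxw).lintegral_comp mx]
    refine lintegral_congr fun Ξ => ?_
    have hwx : (inner ℝ w x : ℝ) = 0 := by rw [real_inner_comm]; exact hxw
    refine congrArg₂ _ (congrArg _ ?_) (congrArg _ ?_)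
    · ext ℓ
      simp [evalSystem, inner_add_left, real_inner_smul_left, hwx]
    · ext1 ℓ
      simp only [obliqueSystem, projSystem, inner_add_left, real_inner_smul_left, hwx, hx]
      rw [hw]
      rw [smul_sub, smul_smul]
      simp only [mul_zero, add_zero, one_pow, div_one]
      rw [div_eq_mul_inv]; abel
  rw [← s2, s1, ← mul_assoc, ← ENNReal.ofReal_mul (by positivity), mul_inv_cancel₀ (by positivity),
    ENNReal.ofReal_one, one_mul]

omit [FiniteDimensional ℝ H] [MeasurableSpace H] [BorelSpace H] in
lemma gaussWeight_mul_density {x : H} (hx : ‖x‖ = 1) (Ξ : Fin m → H) :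
    gaussWeight (evalSystem Ξ x) * ∏ ℓ, stdGaussianDensity (projSystem x Ξ ℓ)
      = ENNReal.ofReal ((√(2 * π))⁻¹ ^ m) * ∏ ℓ, stdGaussianDensity (Ξ ℓ) := by
  rw [gaussWeight, ← Finset.prod_mul_distrib, ENNReal.ofReal_pow (by positivity)]
  have : (ENNReal.ofReal (√(2 * π))⁻¹) ^ m = ∏ _ℓ : Fin m, ENNReal.ofReal (√(2 * π))⁻¹ := by simp
  rw [this, ← Finset.prod_mul_distrib]
  refine Finset.prod_congr rfl fun ℓ _ => ?_
  rw [gaussianPDF, stdGaussianDensity, stdGaussianDensity, ← ENNReal.ofReal_mul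
    (gaussianPDFReal_nonneg _ _ _), ← ENNReal.ofReal_mul (by positivity)]
  congr 1
  have hn : ‖projSystem x Ξ ℓ‖ ^ 2 = ‖Ξ ℓ‖ ^ 2 - (inner ℝ (Ξ ℓ) x) ^ 2 := by
    simp only [projSystem, hx, one_pow, div_one]
    rw [norm_sub_sq_real, norm_smul, real_inner_smul_right, hx]
    simp only [mul_one, Real.norm_eq_abs, sq_abs]; ring
  rw [hn, gaussianPDFReal]
  simp only [evalSystem, sub_zero, NNReal.coe_one, mul_one]
  rw [mul_mul_mul_comm, mul_assoc (√(2 * π))⁻¹, mul_comm (Real.exp _), mul_comm _ (Real.exp _)]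
  have : Real.exp (-‖Ξ ℓ‖ ^ 2 / 2) = Real.exp (-(inner ℝ (Ξ ℓ) x) ^ 2 / 2) *
    Real.exp (-(‖Ξ ℓ‖ ^ 2 - (inner ℝ (Ξ ℓ) x) ^ 2) / 2) := by
    rw [← Real.exp_add]; congr 1; ring
  rw [this]

end KacRice

section KacRice

variable {m : ℕ} {H : Type*} [NormedAddCommGroup H] [InnerProductSpace ℝ H]

lemma projSystem_smul {x : H} {c : ℝ} (hc : c ≠ 0) (Ξ : Fin m → H) :
    projSystem (c • x) Ξ = projSystem x Ξ := by
  ext1 ℓ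
  simp only [projSystem, real_inner_smul_right, norm_smul, smul_smul, mul_pow, Real.norm_eq_abs,
    sq_abs]
  congr 2
  field_simp

lemma obliqueSystem_smul (u : H) {x : H} {c : ℝ} (hc : c ≠ 0) (Ξ : Fin m → H) :
    obliqueSystem u (c • x) Ξ = obliqueSystem u x Ξ := by
  ext1 ℓ
  simp only [obliqueSystem, real_inner_smul_right]
  congr 2
  field_simp

section Fiber

variable {v : (Fin m → ℝ) → H} {v' : (Fin m → ℝ) → (Fin m → ℝ) →L[ℝ] H}

/-- The derivative of `t ↦ -⟪Ξ ℓ, v t⟫ / ⟪u, v t⟫`. -/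
noncomputable def fiberDeriv (u : H) (Ξ : Fin m → H) (v : (Fin m → ℝ) → H)
    (v' : (Fin m → ℝ) → (Fin m → ℝ) →L[ℝ] H) (t : Fin m → ℝ) :
    (Fin m → ℝ) →L[ℝ] (Fin m → ℝ) :=
  ContinuousLinearMap.pi fun ℓ =>
    (-(inner ℝ u (v t) : ℝ)⁻¹) • (innerSL ℝ (obliqueSystem u (v t) Ξ ℓ)).comp (v' t)

lemma fiberDeriv_det (u : H) (Ξ : Fin m → H) (t : Fin m → ℝ) :
    (fiberDeriv u Ξ v v' t).det = (-(inner ℝ u (v t) : ℝ)⁻¹) ^ m *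
      detSystem (obliqueSystem u (v t) Ξ) (fun j => v' t (Pi.single j 1)) := by
  rw [ContinuousLinearMap.det, ← LinearMap.det_toMatrix', detSystem]
  have : LinearMap.toMatrix' (fiberDeriv u Ξ v v' t : (Fin m → ℝ) →ₗ[ℝ] Fin m → ℝ)
      = (-(inner ℝ u (v t) : ℝ)⁻¹) • Matrix.of fun ℓ j =>
        (inner ℝ (obliqueSystem u (v t) Ξ ℓ) (v' t (Pi.single j 1)) : ℝ) := by
    ext ℓ j
    rw [LinearMap.toMatrix'_apply]
    simp [fiberDeriv]
  rw [this, Matrix.det_smul, Fintype.card_fin]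

lemma hasFDerivAt_fiber {u : H} (Ξ : Fin m → H) {t : Fin m → ℝ} (hv : HasFDerivAt v (v' t) t)
    (hu : (inner ℝ u (v t) : ℝ) ≠ 0) :
    HasFDerivAt (fun s ℓ => -(inner ℝ (Ξ ℓ) (v s) : ℝ) / inner ℝ u (v s))
      (fiberDeriv u Ξ v v' t) t := by
  rw [hasFDerivAt_pi']
  intro ℓ
  have h1 : ∀ w : H, HasFDerivAt (fun s => (inner ℝ w (v s) : ℝ)) ((innerSL ℝ w).comp (v' t)) t :=
    fun w => (innerSL ℝ w).hasFDerivAt.comp t hv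
  have h2 := (h1 (Ξ ℓ)).neg.mul ((hasDerivAt_inv hu).comp_hasFDerivAt t (h1 u))
  refine HasFDerivAt.congr_fderiv (f := fun s => -(inner ℝ (Ξ ℓ) (v s) : ℝ) / inner ℝ u (v s)) h2 ?_
  ext h
  simp [fiberDeriv, obliqueSystem]
  field_simp
  ring

end Fiber

variable [FiniteDimensional ℝ H] [MeasurableSpace H] [BorelSpace H]

lemma measurable_detSystem {X : Type*} [MeasurableSpace X] {f : X → Fin m → H}
    {g : X → Fin m → H} (hf : Measurable f) (hg : Measurable g) :
    Measurable fun x => detSystem (f x) (g x) := by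
  unfold detSystem
  simp only [Matrix.det_apply, Matrix.of_apply]
  have hf' : ∀ i, Measurable fun x => f x i := fun i => (measurable_pi_apply i).comp hf
  have hg' : ∀ i, Measurable fun x => g x i := fun i => (measurable_pi_apply i).comp hg
  refine Finset.measurable_sum _ fun σ _ => Measurable.const_smul
    (Finset.measurable_prod _ fun i _ => (hf' _).inner (hg' _)) _

variable {v : (Fin m → ℝ) → H} {v' : (Fin m → ℝ) → (Fin m → ℝ) →L[ℝ] H}

lemma kacRice_piece (hv : ∀ t, HasFDerivAt v (v' t) t) (hv' : Continuous v')
    {T : Set (Fin m → ℝ)} (hT : IsSigmaCompact T) (hTm : MeasurableSet T)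
    {u : H} (hu : ‖u‖ = 1) (hTu : ∀ t ∈ T, (inner ℝ u (v t) : ℝ) ≠ 0)
    {F : (Fin m → H) → ENNReal} (hF : Measurable F) :
    ∫⁻ Ξ, setCount {t ∈ T | evalSystem Ξ (v t) = 0} * F Ξ
        ∂(Measure.pi fun _ : Fin m => stdGaussian H)
      = ∫⁻ t in T, ENNReal.ofReal ((√(2 * π) * ‖v t‖)⁻¹ ^ m) *
        ∫⁻ Ξ, ENNReal.ofReal |detSystem (projSystem (v t) Ξ) (fun j => v' t (Pi.single j 1))| *
          F (projSystem (v t) Ξ) ∂(Measure.pi fun _ : Fin m => stdGaussian H) := by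
  have hvc : Continuous v := continuous_iff_continuousAt.2 fun t => (hv t).continuousAt
  have hvm : Measurable v := hvc.measurable
  have hsf : SigmaFinite ((volume : Measure H).withDensity (stdGaussianDensity (H := H))) := by
    rw [← stdGaussian_eq_withDensity]; infer_instance
  set dens : (Fin m → H) → ENNReal := fun Ξ => ∏ ℓ, stdGaussianDensity (Ξ ℓ) with hdens
  have hdm : Measurable dens := Finset.measurable_prod _ fun i _ =>
    measurable_stdGaussianDensity.comp (measurable_pi_apply i)
  have hγ : (Measure.pi fun _ : Fin m => stdGaussian H)
      = (volume : Measure (Fin m → H)).withDensity dens := by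
    simp_rw [stdGaussian_eq_withDensity]
    rw [pi_withDensity _ measurable_stdGaussianDensity]; rfl
  have hN : Measurable fun Ξ : Fin m → H => setCount {t ∈ T | evalSystem Ξ (v t) = 0} := by
    refine measurable_setCount_zeros hT (Φ := fun (Ξ : Fin m → H) t => evalSystem Ξ (v t)) ?_
    unfold evalSystem Function.uncurry
    fun_prop
  have hframe : Measurable fun t => fun j : Fin m => v' t (Pi.single j 1) := by
    have : Continuous fun t => fun j : Fin m => v' t (Pi.single j 1) := by fun_prop
    exact this.measurable
  have muu : (inner ℝ u u : ℝ) = 1 := by rw [real_inner_self_eq_norm_sq, hu]; norm_num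
  set FD : (Fin m → H) → ENNReal := fun Ξ => F Ξ * dens Ξ with hFD
  have hFDm : Measurable FD := hF.mul hdm
  have hNF : Measurable fun Ξ : Fin m → H =>
      setCount {t ∈ T | evalSystem Ξ (v t) = 0} * F Ξ := hN.mul hF
  rw [hγ, lintegral_withDensity_eq_lintegral_mul _ hdm hNF]
  have hΨ : Measurable fun Ξ : Fin m → H =>
      setCount {t ∈ T | evalSystem Ξ (v t) = 0} * FD Ξ := hN.mul hFDm
  have st1 := lintegral_translate (u := u) (w := u) (by rw [muu]; exact one_ne_zero)
    (measurable_gaussWeight (m := m)) hΨ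
  rw [muu, lintegral_gaussWeight] at st1
  simp only [abs_one, one_pow, inv_one, ENNReal.ofReal_one, one_mul] at st1
  have st0' : ∀ Ξ, (dens * fun Ξ => setCount {t ∈ T | evalSystem Ξ (v t) = 0} * F Ξ) Ξ
      = setCount {t ∈ T | evalSystem Ξ (v t) = 0} * FD Ξ := by
    intro Ξ
    simp only [Pi.mul_apply, hFD]; ring
  -- the inner integral
  have inner_eq : ∀ Ξ : Fin m → H,
      ∫⁻ a : Fin m → ℝ, setCount {t ∈ T | evalSystem (fun ℓ => Ξ ℓ + a ℓ • u) (v t) = 0} *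
        FD (fun ℓ => Ξ ℓ + a ℓ • u)
      = ∫⁻ t in T, ENNReal.ofReal (|(inner ℝ u (v t) : ℝ)|⁻¹ ^ m) *
        (ENNReal.ofReal |detSystem (obliqueSystem u (v t) Ξ) (fun j => v' t (Pi.single j 1))| *
          FD (obliqueSystem u (v t) Ξ)) := by
    intro Ξ
    have hmd : Measurable fun t => (fiberDeriv u Ξ v v' t).det := by
      simp_rw [fiberDeriv_det]
      refine Measurable.mul (by fun_prop) (measurable_detSystem ?_ hframe)
      unfold obliqueSystem; fun_prop
    have := lintegral_setCount_fiber_mul hTm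
      (fun t ht => (hasFDerivAt_fiber Ξ (hv t) (hTu t ht)).hasFDerivWithinAt) hmd
      (volume : Measure (Fin m → ℝ)) (g := fun a => FD (fun ℓ => Ξ ℓ + a ℓ • u))
      (hFDm.comp (by fun_prop))
    refine Eq.trans (lintegral_congr fun a => ?_) (this.trans ?_)
    · congr 2
      ext t
      refine and_congr_right fun ht => ?_
      rw [funext_iff, funext_iff]
      refine forall_congr' fun ℓ => ?_
      have h0 := hTu t ht
      simp only [evalSystem, inner_add_left, real_inner_smul_left, Pi.zero_apply]
      rw [div_eq_iff h0]
      constructor <;> intro h <;> linarith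
    · refine setLIntegral_congr_fun hTm fun t ht => ?_
      simp only
      rw [fiberDeriv_det, abs_mul, abs_pow, abs_neg, abs_inv, ENNReal.ofReal_mul (by positivity),
        mul_assoc]
      congr 3
      ext ℓ
      simp only [obliqueSystem]
      rw [neg_div, neg_smul, sub_eq_add_neg]
  have hobl : Measurable fun p : (Fin m → H) × (Fin m → ℝ) => obliqueSystem u (v p.2) p.1 := by
    unfold obliqueSystem; fun_prop
  have hKm : ∀ t, Measurable fun Ξ : Fin m → H =>
      ENNReal.ofReal |detSystem Ξ (fun j => v' t (Pi.single j 1))| * FD Ξ := fun t =>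
    ((measurable_detSystem measurable_id measurable_const).abs.ennreal_ofReal).mul hFDm
  have hjoint : Measurable fun p : (Fin m → H) × (Fin m → ℝ) =>
      ENNReal.ofReal (|(inner ℝ u (v p.2) : ℝ)|⁻¹ ^ m) *
        (ENNReal.ofReal |detSystem (obliqueSystem u (v p.2) p.1)
          (fun j => v' p.2 (Pi.single j 1))| * FD (obliqueSystem u (v p.2) p.1)) := by
    refine Measurable.mul (by fun_prop) (Measurable.mul ?_ (hFDm.comp hobl))
    exact (measurable_detSystem hobl (hframe.comp measurable_snd)).abs.ennreal_ofReal
  have hgw : Measurable fun Ξ : Fin m → H => gaussWeight (evalSystem Ξ u) :=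
    measurable_gaussWeight.comp (by unfold evalSystem; fun_prop)
  calc ∫⁻ Ξ, (dens * fun Ξ => setCount {t ∈ T | evalSystem Ξ (v t) = 0} * F Ξ) Ξ
      = ∫⁻ Ξ, setCount {t ∈ T | evalSystem Ξ (v t) = 0} * FD Ξ := lintegral_congr st0'
    _ = ∫⁻ Ξ : Fin m → H, ∫⁻ t in T, gaussWeight (evalSystem Ξ u) *
        (ENNReal.ofReal (|(inner ℝ u (v t) : ℝ)|⁻¹ ^ m) *
        (ENNReal.ofReal |detSystem (obliqueSystem u (v t) Ξ) (fun j => v' t (Pi.single j 1))| *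
          FD (obliqueSystem u (v t) Ξ))) := by
        rw [← st1]
        refine lintegral_congr fun Ξ => ?_
        rw [inner_eq Ξ, ← lintegral_const_mul]
        exact hjoint.comp measurable_prodMk_left
    _ = ∫⁻ t in T, ∫⁻ Ξ : Fin m → H, gaussWeight (evalSystem Ξ u) *
        (ENNReal.ofReal (|(inner ℝ u (v t) : ℝ)|⁻¹ ^ m) *
        (ENNReal.ofReal |detSystem (obliqueSystem u (v t) Ξ) (fun j => v' t (Pi.single j 1))| *
          FD (obliqueSystem u (v t) Ξ))) := by
        refine lintegral_lintegral_swap ?_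
        exact ((hgw.comp measurable_fst).mul hjoint).aemeasurable
    _ = ∫⁻ t in T, ENNReal.ofReal ((√(2 * π) * ‖v t‖)⁻¹ ^ m) *
        ∫⁻ Ξ, ENNReal.ofReal |detSystem (projSystem (v t) Ξ) (fun j => v' t (Pi.single j 1))| *
          F (projSystem (v t) Ξ) ∂((volume : Measure (Fin m → H)).withDensity dens) := by
        refine setLIntegral_congr_fun hTm fun t ht => ?_
        have hut := hTu t ht
        have hv0 : v t ≠ 0 := fun h => hut (by rw [h, inner_zero_right])
        have hvn : ‖v t‖ ≠ 0 := norm_ne_zero_iff.2 hv0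
        set x : H := ‖v t‖⁻¹ • v t with hx
        have hx1 : ‖x‖ = 1 := by rw [hx, norm_smul, norm_inv, norm_norm, inv_mul_cancel₀ hvn]
        have hux : (inner ℝ u x : ℝ) = ‖v t‖⁻¹ * inner ℝ u (v t) := by
          rw [hx, real_inner_smul_right]
        have hobx : ∀ Ξ : Fin m → H, obliqueSystem u (v t) Ξ = obliqueSystem u x Ξ := fun Ξ =>
          (obliqueSystem_smul u (inv_ne_zero hvn) Ξ).symm
        have hprx : ∀ Ξ : Fin m → H, projSystem (v t) Ξ = projSystem x Ξ := fun Ξ =>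
          (projSystem_smul (inv_ne_zero hvn) Ξ).symm
        have hprm : Measurable fun Ξ : Fin m → H => projSystem x Ξ := by
          unfold projSystem; fun_prop
        have hobm : Measurable fun Ξ : Fin m → H => obliqueSystem u x Ξ := by
          unfold obliqueSystem; fun_prop
        simp only [hobx, hprx]
        have key := lintegral_oblique hu hx1 (by rw [hux]; positivity) (hKm t)
        have e1 : ∀ Ξ : Fin m → H, gaussWeight (evalSystem Ξ u) *
            (ENNReal.ofReal (|(inner ℝ u (v t) : ℝ)|⁻¹ ^ m) *
            (ENNReal.ofReal |detSystem (obliqueSystem u x Ξ) (fun j => v' t (Pi.single j 1))| *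
            FD (obliqueSystem u x Ξ))) = ENNReal.ofReal (|(inner ℝ u (v t) : ℝ)|⁻¹ ^ m) *
            (gaussWeight (evalSystem Ξ u) *
            (ENNReal.ofReal |detSystem (obliqueSystem u x Ξ) (fun j => v' t (Pi.single j 1))| *
            FD (obliqueSystem u x Ξ))) := fun Ξ => by ring
        have hPm : Measurable fun Ξ : Fin m → H =>
            ENNReal.ofReal |detSystem (projSystem x Ξ) (fun j => v' t (Pi.single j 1))| *
              F (projSystem x Ξ) :=
          ((measurable_detSystem hprm measurable_const).abs.ennreal_ofReal).mul (hF.comp hprm)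
        have e2 : ∀ Ξ : Fin m → H, gaussWeight (evalSystem Ξ x) *
            (ENNReal.ofReal |detSystem (projSystem x Ξ) (fun j => v' t (Pi.single j 1))| *
            FD (projSystem x Ξ)) = ENNReal.ofReal ((√(2 * π))⁻¹ ^ m) *
            (dens Ξ * (ENNReal.ofReal |detSystem (projSystem x Ξ)
              (fun j => v' t (Pi.single j 1))| * F (projSystem x Ξ))) := by
          intro Ξ
          have := gaussWeight_mul_density hx1 Ξ
          calc _ = (gaussWeight (evalSystem Ξ x) * dens (projSystem x Ξ)) *
            (ENNReal.ofReal |detSystem (projSystem x Ξ)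
              (fun j => v' t (Pi.single j 1))| * F (projSystem x Ξ)) := by
                simp only [hFD]; ring
            _ = _ := by rw [hdens]; simp only; rw [this]; ring
        simp_rw [e1]
        rw [lintegral_const_mul' _ _ ENNReal.ofReal_ne_top, key]
        simp_rw [e2]
        rw [lintegral_const_mul' _ _ ENNReal.ofReal_ne_top,
          lintegral_withDensity_eq_lintegral_mul _ hdm hPm, ← mul_assoc, ← mul_assoc,
          ← ENNReal.ofReal_mul (by positivity), ← ENNReal.ofReal_mul (by positivity)]
        congr 2
        rw [hux, abs_mul, abs_inv, abs_norm]
        have : |(inner ℝ u (v t) : ℝ)| ≠ 0 := abs_ne_zero.2 hut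
        rw [← mul_pow, ← mul_pow]
        congr 1
        field_simp

end KacRice

lemma IsSigmaCompact.inter_isClosed {X : Type*} [TopologicalSpace X] {T C : Set X}
    (hT : IsSigmaCompact T) (hC : IsClosed C) : IsSigmaCompact (T ∩ C) := by
  obtain ⟨K, hK, rfl⟩ := hT
  rw [Set.iUnion_inter]
  exact isSigmaCompact_iUnion_of_isCompact _ fun n => (hK n).inter_right hC

lemma IsSigmaCompact.inter_ne_zero {X : Type*} [TopologicalSpace X] {T : Set X}
    (hT : IsSigmaCompact T) {f : X → ℝ} (hf : Continuous f) :
    IsSigmaCompact (T ∩ {x | f x ≠ 0}) := by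
  have : T ∩ {x | f x ≠ 0} = ⋃ n : ℕ, T ∩ {x | 1 / ((n : ℝ) + 1) ≤ |f x|} := by
    rw [← Set.inter_iUnion]
    congr 1
    ext x
    simp only [Set.mem_ofPred_eq, Set.mem_iUnion]
    constructor
    · intro h
      obtain ⟨n, hn⟩ := exists_nat_one_div_lt (abs_pos.2 h)
      exact ⟨n, hn.le⟩
    · rintro ⟨n, hn⟩ h
      rw [h, abs_zero] at hn
      exact absurd hn (not_le.2 Nat.one_div_pos_of_nat)
  rw [this]
  exact isSigmaCompact_iUnion _ fun n =>
    hT.inter_isClosed (isClosed_le continuous_const hf.abs)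

section KacRice

variable {m : ℕ} {H : Type*} [NormedAddCommGroup H] [InnerProductSpace ℝ H]
  [FiniteDimensional ℝ H] [MeasurableSpace H] [BorelSpace H]
  {v : (Fin m → ℝ) → H} {v' : (Fin m → ℝ) → (Fin m → ℝ) →L[ℝ] H}

/-- **Kac–Rice formula** with a weight, for a Gaussian system of linear combinations. -/
theorem kacRice (hv : ∀ t, HasFDerivAt v (v' t) t) (hv' : Continuous v')
    {T : Set (Fin m → ℝ)} (hT : IsSigmaCompact T) (hTm : MeasurableSet T)
    (hT0 : ∀ t ∈ T, v t ≠ 0) {F : (Fin m → H) → ENNReal} (hF : Measurable F) :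
    ∫⁻ Ξ, setCount {t ∈ T | evalSystem Ξ (v t) = 0} * F Ξ
        ∂(Measure.pi fun _ : Fin m => stdGaussian H)
      = ∫⁻ t in T, ENNReal.ofReal ((√(2 * π) * ‖v t‖)⁻¹ ^ m) *
        ∫⁻ Ξ, ENNReal.ofReal |detSystem (projSystem (v t) Ξ) (fun j => v' t (Pi.single j 1))| *
          F (projSystem (v t) Ξ) ∂(Measure.pi fun _ : Fin m => stdGaussian H) := by
  have hvc : Continuous v := continuous_iff_continuousAt.2 fun t => (hv t).continuousAt
  set b := stdOrthonormalBasis ℝ H with hb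
  set P : Fin (Module.finrank ℝ H) → Set (Fin m → ℝ) := fun i =>
    (T ∩ ⋂ k : Fin (Module.finrank ℝ H), ⋂ _ : k < i, {t | (inner ℝ (b k) (v t) : ℝ) = 0}) ∩
      {t | (inner ℝ (b i) (v t) : ℝ) ≠ 0} with hP
  have hcl : ∀ i, IsClosed (⋂ k : Fin (Module.finrank ℝ H), ⋂ _ : k < i,
      {t | (inner ℝ (b k) (v t) : ℝ) = 0}) := fun i =>
    isClosed_iInter fun k => isClosed_iInter fun _ =>
      isClosed_eq (continuous_const.inner hvc) continuous_const
  have hPs : ∀ i, IsSigmaCompact (P i) := fun i =>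
    (hT.inter_isClosed (hcl i)).inter_ne_zero (continuous_const.inner hvc)
  have hPm : ∀ i, MeasurableSet (P i) := fun i =>
    (hTm.inter (hcl i).measurableSet).inter
      (isOpen_ne_fun (continuous_const.inner hvc) continuous_const).measurableSet
  have hPd : Pairwise (Function.onFun Disjoint P) := by
    have key : ∀ i j, i < j → Disjoint (P i) (P j) := by
      intro i j hij
      refine Set.disjoint_left.2 fun t h1 h2 => h1.2 ?_
      have := h2.1.2
      simp only [Set.mem_iInter] at this
      exact this i hij
    intro i j hij
    rcases lt_or_gt_of_ne hij with h | h
    · exact key i j h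
    · exact (key j i h).symm
  have hPU : T = ⋃ i, P i := by
    ext t
    simp only [Set.mem_iUnion]
    constructor
    · intro ht
      have hex : ∃ i, (inner ℝ (b i) (v t) : ℝ) ≠ 0 := by
        by_contra! h
        refine hT0 t ht ?_
        rw [← b.sum_repr (v t)]
        simp [b.repr_apply_apply, h]
      have hfin := Set.toFinite {i | (inner ℝ (b i) (v t) : ℝ) ≠ 0}
      obtain ⟨i, hi, hmin⟩ := Set.exists_min_image _ id hfin hex
      refine ⟨i, ⟨ht, ?_⟩, hi⟩
      simp only [Set.mem_iInter]
      intro k hk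
      by_contra hne
      exact absurd (hmin k hne) (not_le.2 hk)
    · rintro ⟨i, hi⟩
      exact hi.1.1
  have hsplit : ∀ Ξ : Fin m → H, setCount {t ∈ T | evalSystem Ξ (v t) = 0}
      = ∑ i, setCount {t ∈ P i | evalSystem Ξ (v t) = 0} := by
    intro Ξ
    rw [← tsum_fintype (L := SummationFilter.unconditional _), ← setCount_iUnion]
    · congr 1
      ext t
      simp only [Set.mem_iUnion, Set.mem_ofPred_eq]
      rw [hPU]
      simp
    · intro i j hij
      exact (hPd hij).mono (fun t h => h.1) (fun t h => h.1)
  have hN : ∀ i, Measurable fun Ξ : Fin m → H =>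
      setCount {t ∈ P i | evalSystem Ξ (v t) = 0} * F Ξ := by
    intro i
    refine (measurable_setCount_zeros (hPs i)
      (Φ := fun (Ξ : Fin m → H) t => evalSystem Ξ (v t)) ?_).mul hF
    unfold evalSystem Function.uncurry
    fun_prop
  simp_rw [hsplit, Finset.sum_mul]
  rw [lintegral_finsetSum _ fun i _ => hN i]
  conv_rhs => rw [hPU, lintegral_iUnion hPm hPd, tsum_fintype]
  exact Finset.sum_congr rfl fun i _ =>
    kacRice_piece hv hv' (hPs i) (hPm i) (b.orthonormal.1 i) (fun t ht => ht.2) hF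

end KacRice

section PowerKernel

variable {E H : Type*} [NormedAddCommGroup E] [InnerProductSpace ℝ E]
  [NormedAddCommGroup H] [InnerProductSpace ℝ H]

/-- A feature map `e` (with derivative `e'`) of the kernel `⟪x, y⟫ ^ (d + 2)`. -/
structure IsPowerFeature (d : ℕ) (e : E → H) (e' : E → E →L[ℝ] H) : Prop where
  hasFDerivAt : ∀ x, HasFDerivAt e (e' x) x
  continuous_fderiv : Continuous e'
  inner_eq : ∀ x y, (inner ℝ (e x) (e y) : ℝ) = (inner ℝ x y : ℝ) ^ (d + 2)

namespace IsPowerFeature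

variable {d : ℕ} {e : E → H} {e' : E → E →L[ℝ] H} (he : IsPowerFeature d e e')

include he

lemma hasDerivAt_line (x h : E) : HasDerivAt (fun r : ℝ => e (x + r • h)) (e' x h) 0 := by
  have h1 : HasDerivAt (fun r : ℝ => x + r • h) h 0 := by
    simpa using ((hasDerivAt_id (0 : ℝ)).smul_const h).const_add x
  have h2 : HasFDerivAt e (e' x) (x + (0 : ℝ) • h) := by simpa using he.hasFDerivAt x
  exact h2.comp_hasDerivAt (0 : ℝ) h1

lemma inner_fderiv_left (x h y : E) : (inner ℝ (e' x h) (e y) : ℝ)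
    = (d + 2) * (inner ℝ x y : ℝ) ^ (d + 1) * inner ℝ h y := by
  have h1 : HasDerivAt (fun r : ℝ => (inner ℝ (e (x + r • h)) (e y) : ℝ))
      (inner ℝ (e' x h) (e y)) 0 := by
    simpa using (he.hasDerivAt_line x h).inner ℝ (hasDerivAt_const (0 : ℝ) (e y))
  have h2 : HasDerivAt (fun r : ℝ => ((inner ℝ x y : ℝ) + r * inner ℝ h y) ^ (d + 2))
      ((d + 2) * (inner ℝ x y : ℝ) ^ (d + 1) * inner ℝ h y) 0 := by
    have := (((hasDerivAt_id (0 : ℝ)).mul_const (inner ℝ h y : ℝ)).const_add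
      (inner ℝ x y : ℝ)).pow (d + 2)
    refine HasDerivAt.congr_deriv (f := fun r : ℝ => ((inner ℝ x y : ℝ) + r * inner ℝ h y) ^ (d + 2))
      this ?_
    simp
  refine h1.unique (h2.congr_of_eventuallyEq (Eventually.of_forall fun r => ?_))
  simp only
  rw [he.inner_eq, inner_add_left, real_inner_smul_left]

lemma inner_fderiv_right (x h y : E) : (inner ℝ (e y) (e' x h) : ℝ)
    = (d + 2) * (inner ℝ x y : ℝ) ^ (d + 1) * inner ℝ h y := by
  rw [real_inner_comm, he.inner_fderiv_left]

lemma inner_fderiv_fderiv (x h y k : E) : (inner ℝ (e' x h) (e' y k) : ℝ)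
    = (d + 2) * (d + 1) * (inner ℝ x y : ℝ) ^ d * inner ℝ h y * inner ℝ x k +
      (d + 2) * (inner ℝ x y : ℝ) ^ (d + 1) * inner ℝ h k := by
  have h1 : HasDerivAt (fun r : ℝ => (inner ℝ (e' x h) (e (y + r • k)) : ℝ))
      (inner ℝ (e' x h) (e' y k)) 0 := by
    simpa using (hasDerivAt_const (0 : ℝ) (e' x h)).inner ℝ (he.hasDerivAt_line y k)
  have h2 : HasDerivAt (fun r : ℝ => (d + 2) * ((inner ℝ x y : ℝ) + r * inner ℝ x k) ^ (d + 1)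
      * ((inner ℝ h y : ℝ) + r * inner ℝ h k))
      ((d + 2) * (d + 1) * (inner ℝ x y : ℝ) ^ d * inner ℝ h y * inner ℝ x k +
      (d + 2) * (inner ℝ x y : ℝ) ^ (d + 1) * inner ℝ h k) 0 := by
    have a1 := ((((hasDerivAt_id (0 : ℝ)).mul_const (inner ℝ x k : ℝ)).const_add
      (inner ℝ x y : ℝ)).pow (d + 1)).const_mul ((d : ℝ) + 2)
    have a2 := ((hasDerivAt_id (0 : ℝ)).mul_const (inner ℝ h k : ℝ)).const_add
      (inner ℝ h y : ℝ)
    have := a1.mul a2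
    refine this.congr_deriv ?_
    simp
    ring
  refine h1.unique (h2.congr_of_eventuallyEq (Eventually.of_forall fun r => ?_))
  simp only
  rw [he.inner_fderiv_left, inner_add_right, real_inner_smul_right, inner_add_right,
    real_inner_smul_right]

lemma norm_sq (x : E) : ‖e x‖ ^ 2 = (‖x‖ ^ (d + 2)) ^ 2 := by
  rw [← real_inner_self_eq_norm_sq, he.inner_eq, real_inner_self_eq_norm_sq]; ring

lemma norm_eq (x : E) : ‖e x‖ = ‖x‖ ^ (d + 2) :=
  (pow_left_inj₀ (norm_nonneg _) (by positivity) two_ne_zero).1 (he.norm_sq x)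

lemma ne_zero {x : E} (hx : x ≠ 0) : e x ≠ 0 := by
  rw [← norm_ne_zero_iff, he.norm_eq]
  have := norm_ne_zero_iff.2 hx
  positivity

lemma map_smul (r : ℝ) (x : E) : e (r • x) = r ^ (d + 2) • e x := by
  rw [← sub_eq_zero, ← inner_self_eq_zero (𝕜 := ℝ)]
  simp only [inner_sub_left, inner_sub_right, real_inner_smul_left, real_inner_smul_right,
    he.inner_eq]
  ring

lemma fderiv_smul (r : ℝ) (x h : E) : e' (r • x) h = r ^ (d + 1) • e' x h := by
  rw [← sub_eq_zero, ← inner_self_eq_zero (𝕜 := ℝ)]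
  simp only [inner_sub_left, inner_sub_right, real_inner_smul_left, real_inner_smul_right,
    he.inner_fderiv_fderiv]
  ring

lemma fderiv_self (x : E) : e' x x = ((d : ℝ) + 2) • e x := by
  rw [← sub_eq_zero, ← inner_self_eq_zero (𝕜 := ℝ)]
  simp only [inner_sub_left, inner_sub_right, real_inner_smul_left, real_inner_smul_right,
    he.inner_fderiv_fderiv, he.inner_fderiv_left, he.inner_fderiv_right, he.inner_eq]
  ring

lemma continuous : Continuous e :=
  continuous_iff_continuousAt.2 fun x => (he.hasFDerivAt x).continuousAt

end IsPowerFeature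

end PowerKernel

section Frame

variable {m : ℕ}

/-- The affine chart `t ↦ (1, t)`. -/
noncomputable def affineLift (t : Fin m → ℝ) : EuclideanSpace ℝ (Fin (m + 1)) :=
  WithLp.toLp 2 (Fin.cons 1 t)

/-- The linear inclusion `t ↦ (0, t)`. -/
noncomputable def linearLift : (Fin m → ℝ) →L[ℝ] EuclideanSpace ℝ (Fin (m + 1)) :=
  ((EuclideanSpace.equiv (Fin (m + 1)) ℝ).symm : (Fin (m + 1) → ℝ) →L[ℝ] _).comp
    (ContinuousLinearMap.pi (Fin.cons 0 fun j => ContinuousLinearMap.proj j))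

@[simp] lemma affineLift_zero (t : Fin m → ℝ) : affineLift t 0 = 1 := rfl

@[simp] lemma affineLift_succ (t : Fin m → ℝ) (j : Fin m) : affineLift t j.succ = t j := rfl

@[simp] lemma linearLift_zero (t : Fin m → ℝ) : linearLift t 0 = 0 := rfl

@[simp] lemma linearLift_succ (t : Fin m → ℝ) (j : Fin m) : linearLift t j.succ = t j := rfl

lemma affineLift_eq (t : Fin m → ℝ) :
    affineLift t = EuclideanSpace.single 0 1 + linearLift t := by
  ext i
  refine Fin.cases ?_ (fun j => ?_) i <;> simp [Fin.succ_ne_zero]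

lemma hasFDerivAt_affineLift (t : Fin m → ℝ) :
    HasFDerivAt affineLift (linearLift (m := m)) t := by
  have := (linearLift (m := m)).hasFDerivAt (x := t)
  rw [funext (affineLift_eq (m := m))]
  exact this.const_add _

lemma affineLift_ne_zero (t : Fin m → ℝ) : affineLift t ≠ 0 := fun h => by
  have := affineLift_zero t
  rw [h] at this
  simp at this

lemma affineLift_injective : Function.Injective (affineLift (m := m)) := fun s t h => by
  funext j
  rw [← affineLift_succ s, h, affineLift_succ]

lemma norm_affineLift_sq (t : Fin m → ℝ) : ‖affineLift t‖ ^ 2 = 1 + ∑ j, t j ^ 2 := by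
  rw [EuclideanSpace.norm_sq_eq, Fin.sum_univ_succ]
  simp

lemma one_le_norm_affineLift (t : Fin m → ℝ) : 1 ≤ ‖affineLift t‖ := by
  have h := norm_affineLift_sq t
  have : 0 ≤ ∑ j, t j ^ 2 := Finset.sum_nonneg fun j _ => sq_nonneg _
  nlinarith [norm_nonneg (affineLift t)]

lemma linearLift_single (j : Fin m) :
    linearLift (Pi.single j (1 : ℝ)) = EuclideanSpace.single j.succ (1 : ℝ) := by
  ext i
  refine Fin.cases ?_ (fun k => ?_) i
  · simp [(Fin.succ_ne_zero _).symm]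
  · simp [Pi.single_apply]

lemma norm_sq_mul_det_of_map_eq_zero {x : EuclideanSpace ℝ (Fin (m + 1))}
    (L : EuclideanSpace ℝ (Fin (m + 1)) →ₗ[ℝ] (Fin m → ℝ)) (hL : L x = 0)
    (y : Fin (m + 1) → EuclideanSpace ℝ (Fin (m + 1))) (hy : y 0 = x) :
    ‖x‖ ^ 2 * Matrix.det (Matrix.of fun ℓ j => L (y (Fin.succ j)) ℓ)
      = Matrix.det (Matrix.of fun i k => (Fin.cons (x k)
          (L (EuclideanSpace.single k 1)) : Fin (m + 1) → ℝ) i) *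
        Matrix.det (Matrix.of fun r k => y k r) := by
  have hexp : ∀ z : EuclideanSpace ℝ (Fin (m + 1)),
      z = ∑ r, z r • EuclideanSpace.single r (1 : ℝ) := by
    intro z
    ext i
    simp [Finset.sum_apply, Pi.single_apply]
  rw [← Matrix.det_mul]
  have hmul : (Matrix.of fun i k => (Fin.cons (x k)
          (L (EuclideanSpace.single k 1)) : Fin (m + 1) → ℝ) i) * (Matrix.of fun r k => y k r)
      = Matrix.of fun i k => (Fin.cons (inner ℝ x (y k)) (L (y k)) : Fin (m + 1) → ℝ) i := by
    ext i k
    simp only [Matrix.mul_apply, Matrix.of_apply]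
    refine Fin.cases ?_ (fun j => ?_) i
    · simp only [Fin.cons_zero, PiLp.inner_apply]
      exact Finset.sum_congr rfl fun r _ => by simp [mul_comm]
    · simp only [Fin.cons_succ]
      conv_rhs => rw [hexp (y k)]
      simp [map_sum, Finset.sum_apply, mul_comm]
  rw [hmul, Matrix.det_succ_column_zero, Fin.sum_univ_succ]
  simp only [Matrix.of_apply, hy, hL, Fin.cons_succ, Fin.cons_zero, Pi.zero_apply, mul_zero,
    zero_mul, Finset.sum_const_zero, add_zero]
  rw [real_inner_self_eq_norm_sq]
  simp
  left
  congr 1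

lemma abs_det_orthonormal {b : Fin (m + 1) → EuclideanSpace ℝ (Fin (m + 1))}
    (hb : Orthonormal ℝ b) : |Matrix.det (Matrix.of fun r k => b k r)| = 1 := by
  have h : (Matrix.of fun r k => b k r).transpose * (Matrix.of fun r k => b k r) = 1 := by
    ext i j
    rw [Matrix.mul_apply, Matrix.one_apply, ← (orthonormal_iff_ite.1 hb) i j, PiLp.inner_apply]
    exact Finset.sum_congr rfl fun r _ => by simp [mul_comm]
  have h2 := congrArg Matrix.det h
  rw [Matrix.det_mul, Matrix.det_transpose, Matrix.det_one, ← sq] at h2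
  rw [← sq_eq_sq₀ (abs_nonneg _) zero_le_one, sq_abs, h2, one_pow]

lemma abs_det_frame {t : Fin m → ℝ} (L : EuclideanSpace ℝ (Fin (m + 1)) →ₗ[ℝ] (Fin m → ℝ))
    (hL : L (affineLift t) = 0) {b : Fin (m + 1) → EuclideanSpace ℝ (Fin (m + 1))}
    (hb : Orthonormal ℝ b) (hb0 : affineLift t = ‖affineLift t‖ • b 0) :
    |Matrix.det (Matrix.of fun ℓ j => L (linearLift (Pi.single j 1)) ℓ)|
      = ‖affineLift t‖⁻¹ * |Matrix.det (Matrix.of fun ℓ j => L (b (Fin.succ j)) ℓ)| := by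
  set x := affineLift t with hx
  have hx0 : ‖x‖ ≠ 0 := norm_ne_zero_iff.2 (affineLift_ne_zero t)
  have h1 := norm_sq_mul_det_of_map_eq_zero L hL
    (Fin.cons x fun j => EuclideanSpace.single j.succ (1 : ℝ)) rfl
  have h2 := norm_sq_mul_det_of_map_eq_zero L hL (Fin.cons x fun j => b j.succ) rfl
  have d1 : Matrix.det (Matrix.of fun r k => (Fin.cons x (fun j : Fin m =>
      EuclideanSpace.single j.succ (1 : ℝ)) : Fin (m + 1) → EuclideanSpace ℝ (Fin (m + 1))) k r)
      = 1 := by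
    rw [Matrix.det_succ_row_zero, Fin.sum_univ_succ]
    simp [(Fin.succ_ne_zero _).symm, hx]
    convert Matrix.det_one (n := Fin m) (R := ℝ)
    ext i j
    simp [Matrix.one_apply]
  have d2 : |Matrix.det (Matrix.of fun r k => (Fin.cons x (fun j : Fin m =>
      b j.succ) : Fin (m + 1) → EuclideanSpace ℝ (Fin (m + 1))) k r)| = ‖x‖ := by
    have : (Matrix.of fun r k => (Fin.cons x (fun j : Fin m =>
      b j.succ) : Fin (m + 1) → EuclideanSpace ℝ (Fin (m + 1))) k r)
      = (Matrix.of fun r k => b k r).updateCol 0 (‖x‖ • fun r => b 0 r) := by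
      ext r k
      refine Fin.cases ?_ (fun j => ?_) k
      · rw [Matrix.updateCol_self]
        conv_lhs => simp only [Matrix.of_apply, Fin.cons_zero]; rw [hb0]
        rfl
      · rw [Matrix.updateCol_ne (Fin.succ_ne_zero j)]; rfl
    rw [this, Matrix.det_updateCol_smul]
    have e2 : (Matrix.of fun r k => b k r).updateCol 0 (fun r => b 0 r)
        = Matrix.of fun r k => b k r := by
      ext r k
      refine Fin.cases ?_ (fun j => ?_) k
      · rw [Matrix.updateCol_self]; rfl
      · rw [Matrix.updateCol_ne (Fin.succ_ne_zero j)]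
    rw [e2, abs_mul, abs_det_orthonormal hb, abs_norm, mul_one]
  rw [d1, mul_one] at h1
  rw [← h1] at h2
  have h3 := congrArg abs h2
  rw [abs_mul, abs_mul, d2, abs_mul, abs_of_nonneg (sq_nonneg ‖x‖)] at h3
  simp only [Fin.cons_succ] at h3
  simp only [linearLift_single]
  field_simp
  have h4 : 0 < ‖x‖ ^ 2 := by positivity
  nlinarith [mul_left_cancel₀ h4.ne' (h3.trans (mul_assoc _ _ _))]

end Frame

section ProjVec

variable {H : Type*} [NormedAddCommGroup H] [InnerProductSpace ℝ H]

/-- Orthogonal projection onto the complement of `x`. -/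
noncomputable def projVec (x : H) : H →L[ℝ] H :=
  ContinuousLinearMap.id ℝ H - (innerSL ℝ x).smulRight ((‖x‖ ^ 2)⁻¹ • x)

lemma projVec_apply (x w : H) : projVec x w = w - (inner ℝ w x / ‖x‖ ^ 2) • x := by
  simp only [projVec, sub_apply, ContinuousLinearMap.id_apply,
    ContinuousLinearMap.smulRight_apply, innerSL_apply_apply, smul_smul, real_inner_comm w x,
    div_eq_mul_inv]

lemma projSystem_apply {m : ℕ} (x : H) (Ξ : Fin m → H) (ℓ : Fin m) :
    projSystem x Ξ ℓ = projVec x (Ξ ℓ) := (projVec_apply x (Ξ ℓ)).symm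

lemma inner_projVec_left (x a b : H) :
    (inner ℝ (projVec x a) b : ℝ) = inner ℝ a b - inner ℝ a x * inner ℝ b x / ‖x‖ ^ 2 := by
  rw [projVec_apply, inner_sub_left, real_inner_smul_left, real_inner_comm b x]
  ring

lemma inner_projVec_symm (x a b : H) :
    (inner ℝ (projVec x a) b : ℝ) = inner ℝ a (projVec x b) := by
  rw [inner_projVec_left, real_inner_comm (projVec x b) a, inner_projVec_left, real_inner_comm a b]
  ring

lemma projVec_self (x : H) : projVec x x = 0 := by
  by_cases hx : x = 0
  · rw [hx, map_zero]
  · rw [projVec_apply, real_inner_self_eq_norm_sq, div_self, one_smul, sub_self]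
    have := norm_ne_zero_iff.2 hx
    positivity

lemma projVec_smul {x : H} {c : ℝ} (hc : c ≠ 0) (w : H) : projVec (c • x) w = projVec x w := by
  simp only [projVec_apply, real_inner_smul_right, norm_smul, smul_smul, mul_pow,
    Real.norm_eq_abs, sq_abs]
  congr 2
  field_simp

lemma inner_projVec_self (x a : H) : (inner ℝ (projVec x a) x : ℝ) = 0 := by
  rw [inner_projVec_symm, projVec_self, inner_zero_right]

lemma inner_projVec_projVec (x a b : H) : (inner ℝ (projVec x a) (projVec x b) : ℝ)
    = inner ℝ a b - inner ℝ a x * inner ℝ b x / ‖x‖ ^ 2 := by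
  rw [inner_projVec_left, inner_projVec_self, mul_zero, zero_div, sub_zero,
    ← inner_projVec_symm, inner_projVec_left]

lemma detSystem_projSystem {m : ℕ} (x : H) (Ξ : Fin m → H) (y : Fin m → H) :
    detSystem (projSystem x Ξ) y = detSystem Ξ fun j => projVec x (y j) := by
  simp only [detSystem, projSystem_apply, inner_projVec_symm]

lemma evalSystem_projSystem {m : ℕ} (x : H) (Ξ : Fin m → H) (y : H) :
    evalSystem (projSystem x Ξ) y = evalSystem Ξ (projVec x y) := by
  funext ℓ
  simp only [evalSystem, projSystem_apply, inner_projVec_symm]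

lemma detSystem_smul {m : ℕ} (Ξ : Fin m → H) (c : ℝ) (y : Fin m → H) :
    detSystem Ξ (fun j => c • y j) = c ^ m * detSystem Ξ y := by
  simp only [detSystem, real_inner_smul_right]
  have : (Matrix.of fun ℓ j => c * (inner ℝ (Ξ ℓ) (y j) : ℝ))
      = c • Matrix.of fun ℓ j => (inner ℝ (Ξ ℓ) (y j) : ℝ) := by ext; simp
  rw [this, Matrix.det_smul, Fintype.card_fin]

/-- Orthogonal projection onto the complement of `span {x, y}`. -/
noncomputable def projVec₂ (x y : H) : H →L[ℝ] H :=
  (projVec (projVec x y)).comp (projVec x)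

lemma projVec₂_right (x y : H) : projVec₂ x y y = 0 := projVec_self _

lemma projVec₂_left (x y : H) : projVec₂ x y x = 0 := by
  simp [projVec₂, projVec_self]

lemma inner_projVec₂ (x y a b : H) : (inner ℝ (projVec₂ x y a) (projVec₂ x y b) : ℝ)
    = inner ℝ a b - inner ℝ a x * inner ℝ b x / ‖x‖ ^ 2 -
      (inner ℝ a y - inner ℝ a x * inner ℝ y x / ‖x‖ ^ 2) *
      (inner ℝ b y - inner ℝ b x * inner ℝ y x / ‖x‖ ^ 2) /
      (‖y‖ ^ 2 - inner ℝ y x ^ 2 / ‖x‖ ^ 2) := by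
  simp only [projVec₂, ContinuousLinearMap.comp_apply]
  rw [inner_projVec_projVec, inner_projVec_projVec, inner_projVec_projVec, inner_projVec_projVec,
    ← real_inner_self_eq_norm_sq (projVec x y), inner_projVec_projVec,
    real_inner_self_eq_norm_sq y, ← sq]

lemma projVec₂_smul {x y : H} {a b : ℝ} (ha : a ≠ 0) (hb : b ≠ 0) (w : H) :
    projVec₂ (a • x) (b • y) w = projVec₂ x y w := by
  simp only [projVec₂, ContinuousLinearMap.comp_apply, projVec_smul ha, map_smul,
    projVec_smul hb]

end ProjVec

section Frames

variable {n : ℕ}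

lemma exists_orthonormal_extension {x : EuclideanSpace ℝ (Fin (n + 1))} (hx : ‖x‖ = 1) :
    ∃ b : OrthonormalBasis (Fin (n + 1)) ℝ (EuclideanSpace ℝ (Fin (n + 1))), b 0 = x := by
  have h : Orthonormal ℝ (({0} : Set (Fin (n + 1))).domRestrict
      fun _ => x) := by
    rw [orthonormal_iff_ite]
    rintro ⟨i, hi⟩ ⟨j, hj⟩
    rw [Set.mem_singleton_iff] at hi hj
    subst hi; subst hj
    simp [Set.domRestrict_apply, hx]
  obtain ⟨b, hb⟩ := h.exists_orthonormalBasis_extension_of_card_eq (by simp)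
  exact ⟨b, hb 0 rfl⟩

lemma exists_adapted_frames {x y : EuclideanSpace ℝ (Fin (n + 2))} (hx : ‖x‖ = 1) (hy : ‖y‖ = 1)
    {c : ℝ} (hc : inner ℝ x y = c) (hc1 : c ^ 2 < 1) :
    ∃ b b' : Fin (n + 2) → EuclideanSpace ℝ (Fin (n + 2)),
      Orthonormal ℝ b ∧ Orthonormal ℝ b' ∧ b 0 = x ∧ b' 0 = y ∧
      (∀ j : Fin (n + 1), inner ℝ (b j.succ) y = if j = 0 then √(1 - c ^ 2) else 0) ∧
      (∀ j : Fin (n + 1), inner ℝ (b' j.succ) x = if j = 0 then -√(1 - c ^ 2) else 0) ∧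
      (∀ j k : Fin (n + 1), inner ℝ (b j.succ) (b' k.succ) =
        if j = k then (if j = 0 then c else 1) else 0) := by
  set s := √(1 - c ^ 2) with hs
  have hs0 : 0 < s := Real.sqrt_pos.2 (by linarith)
  have hs2 : s ^ 2 = 1 - c ^ 2 := Real.sq_sqrt (by linarith)
  have hxx : inner ℝ x x = (1 : ℝ) := by rw [real_inner_self_eq_norm_sq, hx]; norm_num
  have hyy : inner ℝ y y = (1 : ℝ) := by rw [real_inner_self_eq_norm_sq, hy]; norm_num
  have hyx : inner ℝ y x = c := by rw [real_inner_comm, hc]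
  set w := s⁻¹ • (y - c • x) with hw
  have hww : inner ℝ w w = (1 : ℝ) := by
    simp only [hw, inner_sub_left, inner_sub_right, real_inner_smul_left, real_inner_smul_right,
      hxx, hyy, hyx, hc]
    field_simp
    linarith
  have hxw : inner ℝ x w = (0 : ℝ) := by
    simp only [hw, inner_sub_right, real_inner_smul_right, hxx, hc]
    ring
  have hwx : inner ℝ w x = (0 : ℝ) := by rw [real_inner_comm, hxw]
  have hyw : y = c • x + s • w := by
    rw [hw, smul_smul, mul_inv_cancel₀ hs0.ne', one_smul]; abel
  have h : Orthonormal ℝ (({0, 1} : Set (Fin (n + 2))).domRestrict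
      fun i => if i = 0 then x else w) := by
    rw [orthonormal_iff_ite]
    rintro ⟨i, hi⟩ ⟨j, hj⟩
    simp only [Set.mem_insert_iff, Set.mem_singleton_iff] at hi hj
    rcases hi with rfl | rfl <;> rcases hj with rfl | rfl <;>
      simp only [Set.domRestrict_apply, if_true, one_ne_zero, if_false, hxx, hww, hxw, hwx,
        Subtype.mk.injEq, zero_ne_one]
  obtain ⟨b, hb⟩ := h.exists_orthonormalBasis_extension_of_card_eq (by simp)
  have hb0 : b 0 = x := by simpa using hb 0 (by simp)
  have hb1 : b 1 = w := by simpa using hb 1 (by simp)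
  have hbo : ∀ i j, (inner ℝ (b i) (b j) : ℝ) = if i = j then 1 else 0 :=
    orthonormal_iff_ite.1 b.orthonormal
  set b' : Fin (n + 2) → EuclideanSpace ℝ (Fin (n + 2)) :=
    Fin.cons (c • b 0 + s • b 1) (Fin.cons (-s • b 0 + c • b 1) fun k => b k.succ.succ) with hb'
  have e0 : b' 0 = c • b 0 + s • b 1 := rfl
  have e1 : b' (Fin.succ 0) = -s • b 0 + c • b 1 := rfl
  have e2 : ∀ k : Fin n, b' k.succ.succ = b k.succ.succ := fun k => rfl
  have f1 : ∀ k : Fin n, (1 : Fin (n + 2)) ≠ k.succ.succ := fun k h => by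
    rw [← Fin.succ_zero_eq_one, Fin.succ_inj] at h
    exact Fin.succ_ne_zero _ h.symm
  have f2 : ∀ k : Fin n, k.succ.succ ≠ (1 : Fin (n + 2)) := fun k => (f1 k).symm
  have f3 : ∀ k : Fin n, (0 : Fin (n + 2)) ≠ k.succ.succ := fun k => (Fin.succ_ne_zero _).symm
  have f4 : ∀ k : Fin n, (0 : Fin (n + 1)) ≠ k.succ := fun k => (Fin.succ_ne_zero _).symm
  refine ⟨b, b', b.orthonormal, ?_, hb0, ?_, ?_, ?_, ?_⟩
  · rw [orthonormal_iff_ite]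
    intro i j
    induction i using Fin.cases with
    | zero =>
      induction j using Fin.cases with
      | zero =>
        simp only [e0, inner_add_left, inner_add_right, real_inner_smul_left,
          real_inner_smul_right, hbo]
        simp
        linear_combination hs2
      | succ j =>
        induction j using Fin.cases with
        | zero =>
          simp only [e0, e1]
          simp [inner_add_left, inner_add_right, real_inner_smul_left, real_inner_smul_right, hbo]
          ring
        | succ j =>
          simp only [e0, e2]
          simp [inner_add_left, real_inner_smul_left, hbo, f1, f3]
    | succ i =>
      induction i using Fin.cases with
      | zero =>
        induction j using Fin.cases with
        | zero =>
          simp only [e0, e1]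
          simp [inner_add_left, inner_add_right, real_inner_smul_left, real_inner_smul_right, hbo]
          ring
        | succ j =>
          induction j using Fin.cases with
          | zero =>
            simp only [e1, inner_add_left, inner_add_right, real_inner_smul_left,
              real_inner_smul_right, hbo]
            simp
            linear_combination hs2
          | succ j =>
            simp only [e1, e2]
            simp [inner_add_left, real_inner_smul_left, hbo, f1, f3]
      | succ i =>
        induction j using Fin.cases with
        | zero =>
          simp only [e0, e2]
          simp [inner_add_right, real_inner_smul_right, hbo, f2]
        | succ j =>
          induction j using Fin.cases with
          | zero =>
            simp only [e1, e2]
            simp [inner_add_right, real_inner_smul_right, hbo, f2]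
          | succ j =>
            simp only [e2, hbo]
  · rw [e0, hb0, hb1, ← hyw]
  · intro j
    rw [hyw, ← hb0, ← hb1]
    induction j using Fin.cases with
    | zero => simp [inner_add_right, real_inner_smul_right, hbo]
    | succ j => simp [inner_add_right, real_inner_smul_right, hbo, f2]
  · intro j
    rw [← hb0]
    induction j using Fin.cases with
    | zero =>
      rw [e1]
      simp [inner_add_left, real_inner_smul_left, hbo]
    | succ j => simp [e2, hbo]
  · intro j k
    induction k using Fin.cases with
    | zero =>
      rw [e1]
      induction j using Fin.cases with
      | zero => simp [inner_add_right, real_inner_smul_right, hbo]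
      | succ j => simp [inner_add_right, real_inner_smul_right, hbo, f2]
    | succ k =>
      rw [e2]
      induction j using Fin.cases with
      | zero => simp [hbo, f1, f4]
      | succ j => simp [hbo]

end Frames

/-- The law of `m` independent standard Gaussian vectors in `H`. -/
noncomputable abbrev gaussianSystem (m : ℕ) (H : Type*) [NormedAddCommGroup H]
    [InnerProductSpace ℝ H] [FiniteDimensional ℝ H] [MeasurableSpace H] [BorelSpace H] :
    Measure (Fin m → H) :=
  Measure.pi fun _ : Fin m => stdGaussian H

/-- The expected absolute determinant of an `m × m` standard Gaussian matrix. -/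
noncomputable def gaussDetMoment (m : ℕ) : ENNReal :=
  ∫⁻ Ξ, ENNReal.ofReal |detSystem Ξ fun j => EuclideanSpace.single j (1 : ℝ)|
    ∂gaussianSystem m (EuclideanSpace ℝ (Fin m))

/-- The columns `p j g_j + q j g'_j`, with `g, g'` independent standard Gaussian matrices. -/
noncomputable def pairCol {m : ℕ} (p q : Fin m → ℝ) (j : Fin m) :
    EuclideanSpace ℝ (Fin m ⊕ Fin m) :=
  p j • EuclideanSpace.single (Sum.inl j) (1 : ℝ) + q j • EuclideanSpace.single (Sum.inr j) (1 : ℝ)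

/-- The expectation of `|det (p_j g_j + q_j g'_j)| |det (p_j g_j - q_j g'_j)|`. -/
noncomputable def pairDetMoment (m : ℕ) (p q : Fin m → ℝ) : ENNReal :=
  ∫⁻ Ξ, ENNReal.ofReal |detSystem Ξ (pairCol p q)| * ENNReal.ofReal |detSystem Ξ (pairCol p (-q))|
    ∂gaussianSystem m (EuclideanSpace ℝ (Fin m ⊕ Fin m))

lemma inner_pairCol {m : ℕ} (p q p' q' : Fin m → ℝ) (j k : Fin m) :
    (inner ℝ (pairCol p q j) (pairCol p' q' k) : ℝ)
      = if j = k then p j * p' j + q j * q' j else 0 := by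
  simp only [pairCol, inner_add_left, inner_add_right, real_inner_smul_left,
    real_inner_smul_right, EuclideanSpace.inner_single_left, PiLp.single_apply]
  by_cases h : j = k
  · subst h; simp [mul_comm]
  · simp [h]

section Gram

variable {m : ℕ} {H : Type*} [NormedAddCommGroup H] [InnerProductSpace ℝ H]
  [FiniteDimensional ℝ H] [MeasurableSpace H] [BorelSpace H]
  {H' : Type*} [NormedAddCommGroup H'] [InnerProductSpace ℝ H']
  [FiniteDimensional ℝ H'] [MeasurableSpace H'] [BorelSpace H']

lemma lintegral_detSystem_congr (p : Fin m → H) (p' : Fin m → H')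
    (h : ∀ j k, inner ℝ (p j) (p k) = (inner ℝ (p' j) (p' k) : ℝ)) :
    ∫⁻ Ξ, ENNReal.ofReal |detSystem Ξ p| ∂gaussianSystem m H
      = ∫⁻ Ξ, ENNReal.ofReal |detSystem Ξ p'| ∂gaussianSystem m H' := by
  refine lintegral_pi_inner_congr p p' h
    (G := fun M => ENNReal.ofReal |Matrix.det (Matrix.of fun ℓ j => M ℓ j)|) ?_
  have : Continuous fun M : Fin m → Fin m → ℝ => Matrix.det (Matrix.of fun ℓ j => M ℓ j) :=
    Continuous.matrix_det (by fun_prop)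
  exact this.measurable.abs.ennreal_ofReal

lemma lintegral_detSystem_mul_congr (p₁ p₂ : Fin m → H) (p₁' p₂' : Fin m → H')
    (h₁₁ : ∀ j k, inner ℝ (p₁ j) (p₁ k) = (inner ℝ (p₁' j) (p₁' k) : ℝ))
    (h₁₂ : ∀ j k, inner ℝ (p₁ j) (p₂ k) = (inner ℝ (p₁' j) (p₂' k) : ℝ))
    (h₂₂ : ∀ j k, inner ℝ (p₂ j) (p₂ k) = (inner ℝ (p₂' j) (p₂' k) : ℝ)) :
    ∫⁻ Ξ, ENNReal.ofReal |detSystem Ξ p₁| * ENNReal.ofReal |detSystem Ξ p₂| ∂gaussianSystem m H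
      = ∫⁻ Ξ, ENNReal.ofReal |detSystem Ξ p₁'| * ENNReal.ofReal |detSystem Ξ p₂'|
        ∂gaussianSystem m H' := by
  refine lintegral_pi_inner_congr (Sum.elim p₁ p₂) (Sum.elim p₁' p₂') ?_
    (G := fun M => ENNReal.ofReal |Matrix.det (Matrix.of fun ℓ j => M ℓ (Sum.inl j))| *
      ENNReal.ofReal |Matrix.det (Matrix.of fun ℓ j => M ℓ (Sum.inr j))|) ?_
  · rintro (j | j) (k | k)
    · exact h₁₁ j k
    · exact h₁₂ j k
    · simpa only [Sum.elim_inl, Sum.elim_inr, real_inner_comm] using h₁₂ k j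
    · exact h₂₂ j k
  · have c1 : ∀ f : Fin m → Fin m ⊕ Fin m, Continuous fun M : Fin m → Fin m ⊕ Fin m → ℝ =>
        Matrix.det (Matrix.of fun ℓ j => M ℓ (f j)) := fun f =>
      Continuous.matrix_det (by fun_prop)
    exact ((c1 Sum.inl).measurable.abs.ennreal_ofReal).mul
      ((c1 Sum.inr).measurable.abs.ennreal_ofReal)

omit [FiniteDimensional ℝ H] [MeasurableSpace H] [BorelSpace H] in
lemma abs_detSystem_frame {t : Fin m → ℝ} (A : EuclideanSpace ℝ (Fin (m + 1)) →L[ℝ] H)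
    (hA : A (affineLift t) = 0) {b : Fin (m + 1) → EuclideanSpace ℝ (Fin (m + 1))}
    (hb : Orthonormal ℝ b) (hb0 : affineLift t = ‖affineLift t‖ • b 0) (Ξ : Fin m → H) :
    |detSystem Ξ fun j => A (linearLift (Pi.single j 1))|
      = ‖affineLift t‖⁻¹ * |detSystem Ξ fun j => A (b j.succ)| := by
  have := abs_det_frame (t := t) (LinearMap.pi fun ℓ => ((innerSL ℝ (Ξ ℓ)).comp A).toLinearMap)
    (by ext ℓ; simp [hA]) hb hb0
  simpa [detSystem] using this

end Gram

section OnePoint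

variable {m d : ℕ} {H : Type*} [NormedAddCommGroup H] [InnerProductSpace ℝ H]
  [FiniteDimensional ℝ H] [MeasurableSpace H] [BorelSpace H]
  {e : EuclideanSpace ℝ (Fin (m + 1)) → H}
  {e' : EuclideanSpace ℝ (Fin (m + 1)) → EuclideanSpace ℝ (Fin (m + 1)) →L[ℝ] H}

lemma exists_frame_affineLift (t : Fin m → ℝ) :
    ∃ b : OrthonormalBasis (Fin (m + 1)) ℝ (EuclideanSpace ℝ (Fin (m + 1))),
      affineLift t = ‖affineLift t‖ • b 0 := by
  have h0 := norm_ne_zero_iff.2 (affineLift_ne_zero t)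
  obtain ⟨b, hb⟩ := exists_orthonormal_extension (x := ‖affineLift t‖⁻¹ • affineLift t)
    (by rw [norm_smul, norm_inv, norm_norm, inv_mul_cancel₀ h0])
  exact ⟨b, by rw [hb, smul_smul, mul_inv_cancel₀ h0, one_smul]⟩

omit [FiniteDimensional ℝ H] [MeasurableSpace H] [BorelSpace H] in
lemma IsPowerFeature.projVec_fderiv_self (he : IsPowerFeature d e e')
    (x : EuclideanSpace ℝ (Fin (m + 1))) : projVec (e x) (e' x x) = 0 := by
  rw [he.fderiv_self, _root_.map_smul, projVec_self, smul_zero]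

lemma lintegral_detSystem_one_point (he : IsPowerFeature d e e') (t : Fin m → ℝ) :
    ∫⁻ Ξ, ENNReal.ofReal |detSystem (projSystem (e (affineLift t)) Ξ)
        fun j => e' (affineLift t) (linearLift (Pi.single j 1))| ∂gaussianSystem m H
      = ENNReal.ofReal (‖affineLift t‖⁻¹ * (√(d + 2) * ‖affineLift t‖ ^ (d + 1)) ^ m) *
        gaussDetMoment m := by
  obtain ⟨b, hb⟩ := exists_frame_affineLift t
  set x := affineLift t with hx
  have h1 : ∀ Ξ : Fin m → H, |detSystem (projSystem (e x) Ξ)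
      fun j => e' x (linearLift (Pi.single j 1))|
      = ‖x‖⁻¹ * |detSystem Ξ fun j => projVec (e x) (e' x (b j.succ))| := fun Ξ => by
    rw [detSystem_projSystem]
    exact abs_detSystem_frame ((projVec (e x)).comp (e' x)) (he.projVec_fderiv_self x)
      b.orthonormal hb Ξ
  have hbx : ∀ j : Fin m, (inner ℝ (b j.succ) x : ℝ) = 0 := fun j => by
    rw [hb, real_inner_smul_right, orthonormal_iff_ite.1 b.orthonormal]
    simp
  simp_rw [h1, ENNReal.ofReal_mul (inv_nonneg.2 (norm_nonneg x))]
  rw [lintegral_const_mul' _ _ ENNReal.ofReal_ne_top, mul_assoc]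
  congr 1
  rw [lintegral_detSystem_congr (H' := EuclideanSpace ℝ (Fin m)) _
    (fun j => (√(d + 2) * ‖x‖ ^ (d + 1)) • EuclideanSpace.single j (1 : ℝ))]
  · simp_rw [detSystem_smul, abs_mul]
    rw [abs_of_nonneg (by positivity : 0 ≤ (√(d + 2) * ‖x‖ ^ (d + 1)) ^ m)]
    simp_rw [ENNReal.ofReal_mul (by positivity : 0 ≤ (√(d + 2) * ‖x‖ ^ (d + 1)) ^ m)]
    rw [lintegral_const_mul' _ _ ENNReal.ofReal_ne_top]
    rfl
  · intro j k
    rw [inner_projVec_projVec, he.inner_fderiv_left, he.inner_fderiv_fderiv, hbx, mul_zero,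
      orthonormal_iff_ite.1 b.orthonormal, real_inner_self_eq_norm_sq, real_inner_smul_left,
      real_inner_smul_right, EuclideanSpace.inner_single_left]
    have hs : √((d : ℝ) + 2) ^ 2 = d + 2 := Real.sq_sqrt (by positivity)
    simp only [PiLp.single_apply, Fin.succ_inj]
    split_ifs <;> simp
    linear_combination (-(‖x‖ ^ (d + 1)) ^ 2) * hs

omit [FiniteDimensional ℝ H] [MeasurableSpace H] [BorelSpace H] in
lemma hasFDerivAt_feature_affineLift (he : IsPowerFeature d e e') (t : Fin m → ℝ) :
    HasFDerivAt (fun t => e (affineLift t)) ((e' (affineLift t)).comp linearLift) t :=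
  (he.hasFDerivAt (affineLift t)).comp t (hasFDerivAt_affineLift t)

lemma continuous_affineLift : Continuous (affineLift (m := m)) :=
  continuous_iff_continuousAt.2 fun t => (hasFDerivAt_affineLift t).continuousAt

omit [FiniteDimensional ℝ H] [MeasurableSpace H] [BorelSpace H] in
lemma continuous_fderiv_feature_affineLift (he : IsPowerFeature d e e') :
    Continuous fun t : Fin m → ℝ => (e' (affineLift t)).comp linearLift :=
  (he.continuous_fderiv.comp continuous_affineLift).clm_comp continuous_const

/-- The number of zeros of the system `⟪Ξ ℓ, e (1, t)⟫ = 0`. -/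
noncomputable def zeroCount (e : EuclideanSpace ℝ (Fin (m + 1)) → H) (Ξ : Fin m → H) : ENNReal :=
  setCount {t : Fin m → ℝ | evalSystem Ξ (e (affineLift t)) = 0}

lemma measurable_zeroCount (he : IsPowerFeature d e e') : Measurable (zeroCount (m := m) e) := by
  have hc := he.continuous.comp (continuous_affineLift (m := m))
  have := measurable_setCount_zeros (X := Fin m → H) (isSigmaCompact_univ (X := Fin m → ℝ))
    (Φ := fun (Ξ : Fin m → H) t => evalSystem Ξ (e (affineLift t))) (by
      refine continuous_pi fun ℓ => ?_
      exact ((continuous_apply ℓ).comp continuous_fst).inner (hc.comp continuous_snd))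
  simp only [Set.mem_univ, true_and] at this
  exact this

lemma kacRice_feature (he : IsPowerFeature d e e') {F : (Fin m → H) → ENNReal}
    (hF : Measurable F) :
    ∫⁻ Ξ, zeroCount e Ξ * F Ξ ∂gaussianSystem m H
      = ∫⁻ t : Fin m → ℝ, ENNReal.ofReal ((√(2 * π) * ‖affineLift t‖ ^ (d + 2))⁻¹ ^ m) *
        ∫⁻ Ξ, ENNReal.ofReal |detSystem (projSystem (e (affineLift t)) Ξ)
          fun j => e' (affineLift t) (linearLift (Pi.single j 1))| *
          F (projSystem (e (affineLift t)) Ξ) ∂gaussianSystem m H := by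
  have := kacRice (hasFDerivAt_feature_affineLift he) (continuous_fderiv_feature_affineLift he)
    isSigmaCompact_univ MeasurableSet.univ
    (fun t _ => he.ne_zero (affineLift_ne_zero t)) hF
  simp only [Set.mem_univ, true_and, Measure.restrict_univ, he.norm_eq] at this
  exact this

/-- The constant in the first intensity. -/
noncomputable def intensityConst (m d : ℕ) : ℝ := (√(d + 2) / √(2 * π)) ^ m

lemma intensity_identity {r : ℝ} (hr : 0 < r) : (√(2 * π) * r ^ (d + 2))⁻¹ ^ m *
    (r⁻¹ * (√(d + 2) * r ^ (d + 1)) ^ m) = intensityConst m d * (r ^ (m + 1))⁻¹ := by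
  have h2 : 0 < √(2 * π) := Real.sqrt_pos.2 (by positivity)
  rw [intensityConst, div_pow, inv_pow, mul_pow, mul_pow, ← pow_mul, ← pow_mul]
  have : r ^ ((d + 2) * m) = r ^ ((d + 1) * m) * r ^ m := by rw [← pow_add]; congr 1; ring
  rw [this]
  field_simp
  ring

/-- The total mass of `(1 + |t|²) ^ (-(m + 1) / 2)`. -/
noncomputable def chartMass (m : ℕ) : ENNReal :=
  ∫⁻ t : Fin m → ℝ, ENNReal.ofReal (‖affineLift t‖ ^ (m + 1))⁻¹

theorem lintegral_zeroCount (he : IsPowerFeature d e e') :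
    ∫⁻ Ξ, zeroCount e Ξ ∂gaussianSystem m H
      = ENNReal.ofReal (intensityConst m d) * gaussDetMoment m * chartMass m := by
  have h := kacRice_feature he (F := fun _ => 1) measurable_const
  simp only [mul_one] at h
  simp_rw [h, lintegral_detSystem_one_point he]
  rw [chartMass, ← lintegral_const_mul]
  · refine lintegral_congr fun t => ?_
    have hr : 0 < ‖affineLift t‖ := norm_pos_iff.2 (affineLift_ne_zero t)
    rw [← mul_assoc, ← ENNReal.ofReal_mul (by positivity), intensity_identity hr,
      ENNReal.ofReal_mul (by unfold intensityConst; positivity)]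
    ring
  · have := continuous_affineLift (m := m)
    fun_prop

end OnePoint

/-- Normalized conditional variance of the derivative along the great circle. -/
noncomputable def tangentVar (d : ℕ) (c : ℝ) : ℝ :=
  1 - (d + 2) * c ^ (2 * d + 2) * (1 - c ^ 2) / (1 - c ^ (2 * d + 4))

/-- Normalized conditional covariance of the derivatives along the great circle. -/
noncomputable def tangentCov (d : ℕ) (c : ℝ) : ℝ :=
  c ^ (d + 2) - (d + 1) * c ^ d * (1 - c ^ 2)
    - (d + 2) * c ^ (3 * d + 4) * (1 - c ^ 2) / (1 - c ^ (2 * d + 4))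

/-- Normalized conditional variances of the columns. -/
noncomputable def colVar (n d : ℕ) (c : ℝ) (j : Fin (n + 1)) : ℝ :=
  if j = 0 then tangentVar d c else 1

/-- Normalized conditional covariances of the columns. -/
noncomputable def colCov (n d : ℕ) (c : ℝ) (j : Fin (n + 1)) : ℝ :=
  if j = 0 then tangentCov d c else c ^ (d + 1)

/-- Coefficient of the common part of the columns. -/
noncomputable def colPlus (n d : ℕ) (c : ℝ) (j : Fin (n + 1)) : ℝ :=
  √((colVar n d c j + colCov n d c j) / 2)

/-- Coefficient of the opposite part of the columns. -/
noncomputable def colMinus (n d : ℕ) (c : ℝ) (j : Fin (n + 1)) : ℝ :=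
  √((colVar n d c j - colCov n d c j) / 2)

section Gram

variable {n d : ℕ} {H : Type*} [NormedAddCommGroup H] [InnerProductSpace ℝ H]
  {e : EuclideanSpace ℝ (Fin (n + 2)) → H}
  {e' : EuclideanSpace ℝ (Fin (n + 2)) → EuclideanSpace ℝ (Fin (n + 2)) →L[ℝ] H}

lemma one_sub_pow_pos {c : ℝ} (hc : c ^ 2 < 1) (k : ℕ) : 0 < 1 - c ^ (2 * k + 2) := by
  have : c ^ (2 * k + 2) = (c ^ 2) ^ (k + 1) := by rw [← pow_mul]; ring
  rw [this, sub_pos]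
  exact pow_lt_one₀ (sq_nonneg c) hc (Nat.succ_ne_zero k)

/-- The conditional Gram matrix of the derivatives at two unit vectors. -/
lemma IsPowerFeature.gram_projVec₂ (he : IsPowerFeature d e e')
    {b b' : Fin (n + 2) → EuclideanSpace ℝ (Fin (n + 2))} (hb : Orthonormal ℝ b)
    (hb' : Orthonormal ℝ b') {c : ℝ} (hc : inner ℝ (b 0) (b' 0) = c) (hc1 : c ^ 2 < 1)
    (h1 : ∀ j : Fin (n + 1), inner ℝ (b j.succ) (b' 0) = if j = 0 then √(1 - c ^ 2) else 0)
    (h2 : ∀ j : Fin (n + 1), inner ℝ (b' j.succ) (b 0) = if j = 0 then -√(1 - c ^ 2) else 0)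
    (h3 : ∀ j k : Fin (n + 1), inner ℝ (b j.succ) (b' k.succ) =
        if j = k then (if j = 0 then c else 1) else 0) (j k : Fin (n + 1)) :
    inner ℝ (projVec₂ (e (b 0)) (e (b' 0)) (e' (b 0) (b j.succ)))
        (projVec₂ (e (b 0)) (e (b' 0)) (e' (b 0) (b k.succ)))
      = (if j = k then (d + 2) * colVar n d c j else 0) ∧
    inner ℝ (projVec₂ (e (b 0)) (e (b' 0)) (e' (b 0) (b j.succ)))
        (projVec₂ (e (b 0)) (e (b' 0)) (e' (b' 0) (b' k.succ)))
      = (if j = k then (d + 2) * colCov n d c j else 0) ∧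
    inner ℝ (projVec₂ (e (b 0)) (e (b' 0)) (e' (b' 0) (b' j.succ)))
        (projVec₂ (e (b 0)) (e (b' 0)) (e' (b' 0) (b' k.succ)))
      = (if j = k then (d + 2) * colVar n d c j else 0) := by
  set s := √(1 - c ^ 2) with hs
  have hs2 : s ^ 2 = 1 - c ^ 2 := Real.sq_sqrt (by linarith)
  have hpos := one_sub_pow_pos hc1 (d + 1)
  have hp2 : c ^ (2 * (d + 1) + 2) = c ^ (2 * d + 4) := by congr 1
  rw [hp2] at hpos
  have hc' : inner ℝ (b' 0) (b 0) = c := by rw [real_inner_comm, hc]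
  have bb : ∀ i k, (inner ℝ (b i) (b k) : ℝ) = if i = k then 1 else 0 := orthonormal_iff_ite.1 hb
  have bb' : ∀ i k, (inner ℝ (b' i) (b' k) : ℝ) = if i = k then 1 else 0 :=
    orthonormal_iff_ite.1 hb'
  have h1' : ∀ j : Fin (n + 1), inner ℝ (b' 0) (b j.succ) = if j = 0 then s else 0 := fun j => by
    rw [real_inner_comm, h1]
  have h2' : ∀ j : Fin (n + 1), inner ℝ (b 0) (b' j.succ) = if j = 0 then -s else 0 := fun j => by
    rw [real_inner_comm, h2]
  have n1 : ‖e (b 0)‖ ^ 2 = 1 := by rw [he.norm_eq, hb.1]; simp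
  have n2 : ‖e (b' 0)‖ ^ 2 = 1 := by rw [he.norm_eq, hb'.1]; simp
  have hsn : ∀ j : Fin (n + 1), (0 : Fin (n + 2)) ≠ j.succ := fun j => (Fin.succ_ne_zero j).symm
  have hden : 1 - (c ^ (d + 2)) ^ 2 = 1 - c ^ (2 * d + 4) := by ring
  refine ⟨?_, ?_, ?_⟩ <;>
  · simp only [inner_projVec₂, n1, n2, he.inner_fderiv_left, he.inner_fderiv_fderiv, he.inner_eq,
      bb, bb', h1, h2, h2', h3, hc, hc', Fin.succ_ne_zero, if_false, if_true, Fin.succ_inj,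
      hsn, div_one, hden]
    by_cases hjk : j = k
    · subst hjk
      by_cases hj : j = 0
      · subst hj
        simp only [if_true, colVar, colCov, tangentVar, tangentCov]
        have hs0 := hpos.ne'
        field_simp
        first
          | linear_combination (-(d + 2) * c ^ (2 * d + 2)) * hs2
          | linear_combination
              (-(d + 1) * c ^ d * (1 - c ^ (2 * d + 4)) - (d + 2) * c ^ (3 * d + 4)) * hs2
      · simp [hj, colVar, colCov]
    · by_cases hj : j = 0
      · have hk : k ≠ 0 := fun h => hjk (hj.trans h.symm)
        simp [hjk, hk]
      · simp [hjk, hj]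

end Gram

section TwoPoint

variable {n d : ℕ} {H : Type*} [NormedAddCommGroup H] [InnerProductSpace ℝ H]
  {e : EuclideanSpace ℝ (Fin (n + 2)) → H}
  {e' : EuclideanSpace ℝ (Fin (n + 2)) → EuclideanSpace ℝ (Fin (n + 2)) →L[ℝ] H}

/-- Cosine of the angle between `(1, t)` and `(1, s)`. -/
noncomputable def cosLift {m : ℕ} (t s : Fin m → ℝ) : ℝ :=
  inner ℝ (affineLift t) (affineLift s) / (‖affineLift t‖ * ‖affineLift s‖)

lemma cosLift_sq_lt_one {m : ℕ} {t s : Fin m → ℝ} (h : s ≠ t) : cosLift t s ^ 2 < 1 := by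
  have h0 := abs_real_inner_div_norm_mul_norm_le_one (affineLift t) (affineLift s)
  have h1 : |cosLift t s| ≠ 1 := fun h1 => by
    obtain ⟨-, r, hr, hs⟩ := (abs_real_inner_div_norm_mul_norm_eq_one_iff _ _).1 h1
    have h2 := congrArg (fun v : EuclideanSpace ℝ (Fin (m + 1)) => v 0) hs
    simp at h2
    rw [← h2, one_smul] at hs
    exact h (affineLift_injective hs)
  rw [sq_lt_one_iff_abs_lt_one]
  exact lt_of_le_of_ne h0 h1

lemma exists_adapted_frames_affineLift {t s : Fin (n + 1) → ℝ} (h : s ≠ t) :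
    ∃ b b' : Fin (n + 2) → EuclideanSpace ℝ (Fin (n + 2)),
      Orthonormal ℝ b ∧ Orthonormal ℝ b' ∧ affineLift t = ‖affineLift t‖ • b 0 ∧
      affineLift s = ‖affineLift s‖ • b' 0 ∧ inner ℝ (b 0) (b' 0) = cosLift t s ∧
      (∀ j : Fin (n + 1), inner ℝ (b j.succ) (b' 0) =
        if j = 0 then √(1 - cosLift t s ^ 2) else 0) ∧
      (∀ j : Fin (n + 1), inner ℝ (b' j.succ) (b 0) =
        if j = 0 then -√(1 - cosLift t s ^ 2) else 0) ∧
      (∀ j k : Fin (n + 1), inner ℝ (b j.succ) (b' k.succ) =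
        if j = k then (if j = 0 then cosLift t s else 1) else 0) := by
  have hu : ∀ t : Fin (n + 1) → ℝ, ‖affineLift t‖ ≠ 0 := fun t =>
    norm_ne_zero_iff.2 (affineLift_ne_zero t)
  have h1 : ∀ t : Fin (n + 1) → ℝ, ‖(‖affineLift t‖⁻¹ • affineLift t)‖ = 1 := fun t => by
    rw [norm_smul, norm_inv, norm_norm, inv_mul_cancel₀ (hu t)]
  have hc : inner ℝ (‖affineLift t‖⁻¹ • affineLift t) (‖affineLift s‖⁻¹ • affineLift s)
      = cosLift t s := by
    rw [real_inner_smul_left, real_inner_smul_right, cosLift]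
    field_simp
  obtain ⟨b, b', hb, hb', hb0, hb0', i1, i2, i3⟩ :=
    exists_adapted_frames (h1 t) (h1 s) hc (cosLift_sq_lt_one h)
  refine ⟨b, b', hb, hb', ?_, ?_, ?_, ?_, ?_, i3⟩
  · rw [hb0, smul_smul, mul_inv_cancel₀ (hu t), one_smul]
  · rw [hb0', smul_smul, mul_inv_cancel₀ (hu s), one_smul]
  · rw [hb0, hb0', hc]
  · simpa only [hb0'] using i1
  · simpa only [hb0] using i2

lemma IsPowerFeature.abs_colCov_le (he : IsPowerFeature d e e') {t s : Fin (n + 1) → ℝ}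
    (h : s ≠ t) (j : Fin (n + 1)) :
    |colCov n d (cosLift t s) j| ≤ colVar n d (cosLift t s) j := by
  obtain ⟨b, b', hb, hb', -, -, hc, i1, i2, i3⟩ := exists_adapted_frames_affineLift h
  obtain ⟨g1, g2, g3⟩ := he.gram_projVec₂ hb hb' hc (cosLift_sq_lt_one h) i1 i2 i3 j j
  simp only [if_true] at g1 g2 g3
  have h1 := real_inner_mul_inner_self_le
    (projVec₂ (e (b 0)) (e (b' 0)) (e' (b 0) (b j.succ)))
    (projVec₂ (e (b 0)) (e (b' 0)) (e' (b' 0) (b' j.succ)))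
  have h2 : (0 : ℝ) ≤ (d + 2) * colVar n d (cosLift t s) j := by
    rw [← g1]; exact real_inner_self_nonneg
  rw [g1, g2, g3, ← sq, ← sq] at h1
  have h3 := abs_le_of_sq_le_sq h1 h2
  have hd : (0 : ℝ) < d + 2 := by positivity
  rw [abs_mul, abs_of_pos hd] at h3
  exact le_of_mul_le_mul_left h3 hd

lemma colPlus_sq_add_colMinus_sq {c : ℝ} {j : Fin (n + 1)}
    (h : |colCov n d c j| ≤ colVar n d c j) :
    colPlus n d c j * colPlus n d c j + colMinus n d c j * colMinus n d c j = colVar n d c j ∧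
    colPlus n d c j * colPlus n d c j - colMinus n d c j * colMinus n d c j = colCov n d c j := by
  obtain ⟨h1, h2⟩ := abs_le.1 h
  rw [colPlus, colMinus, Real.mul_self_sqrt (by linarith), Real.mul_self_sqrt (by linarith)]
  constructor <;> ring

variable [FiniteDimensional ℝ H] [MeasurableSpace H] [BorelSpace H]

omit [FiniteDimensional ℝ H] [MeasurableSpace H] [BorelSpace H] in
lemma IsPowerFeature.abs_detSystem_unit_frame {m : ℕ} {e : EuclideanSpace ℝ (Fin (m + 1)) → H}
    {e' : EuclideanSpace ℝ (Fin (m + 1)) → EuclideanSpace ℝ (Fin (m + 1)) →L[ℝ] H}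
    (he : IsPowerFeature d e e') {t : Fin m → ℝ} {P Q : H →L[ℝ] H}
    (hP : P (e (affineLift t)) = 0) (hPQ : ∀ w, P w = Q w)
    {b : Fin (m + 1) → EuclideanSpace ℝ (Fin (m + 1))}
    (hb : Orthonormal ℝ b) (hb0 : affineLift t = ‖affineLift t‖ • b 0) (Ξ : Fin m → H) :
    |detSystem Ξ fun j => P (e' (affineLift t) (linearLift (Pi.single j 1)))|
      = ‖affineLift t‖⁻¹ * (√(d + 2) * ‖affineLift t‖ ^ (d + 1)) ^ m *
        |detSystem Ξ fun j => (√(d + 2))⁻¹ • Q (e' (b 0) (b j.succ))| := by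
  have h1 := abs_detSystem_frame (P.comp (e' (affineLift t)))
    (by simp [he.fderiv_self, hP]) hb hb0 Ξ
  simp only [ContinuousLinearMap.comp_apply] at h1
  rw [h1, detSystem_smul, abs_mul, abs_of_nonneg (a := (√((d : ℝ) + 2))⁻¹ ^ m) (by positivity)]
  have h2 : ∀ w, P (e' (affineLift t) w) = ‖affineLift t‖ ^ (d + 1) • Q (e' (b 0) w) := fun w => by
    rw [← hPQ, ← _root_.map_smul, ← he.fderiv_smul, ← hb0]
  simp only [h2]
  rw [detSystem_smul, abs_mul, abs_of_nonneg (a := (‖affineLift t‖ ^ (d + 1)) ^ m) (by positivity),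
    mul_pow, inv_pow]
  have : √((d : ℝ) + 2) ≠ 0 := (Real.sqrt_pos.2 (by positivity)).ne'
  field_simp

lemma lintegral_detSystem_two_point (he : IsPowerFeature d e e') {t s : Fin (n + 1) → ℝ}
    (h : s ≠ t) :
    ∫⁻ Ξ, ENNReal.ofReal |detSystem Ξ fun j => projVec₂ (e (affineLift t)) (e (affineLift s))
          (e' (affineLift t) (linearLift (Pi.single j 1)))| *
        ENNReal.ofReal |detSystem Ξ fun j => projVec₂ (e (affineLift t)) (e (affineLift s))
          (e' (affineLift s) (linearLift (Pi.single j 1)))| ∂gaussianSystem (n + 1) H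
      = ENNReal.ofReal (‖affineLift t‖⁻¹ * (√(d + 2) * ‖affineLift t‖ ^ (d + 1)) ^ (n + 1) *
          (‖affineLift s‖⁻¹ * (√(d + 2) * ‖affineLift s‖ ^ (d + 1)) ^ (n + 1))) *
        pairDetMoment (n + 1) (colPlus n d (cosLift t s)) (colMinus n d (cosLift t s)) := by
  obtain ⟨b, b', hb, hb', hb0, hb0', hc, i1, i2, i3⟩ := exists_adapted_frames_affineLift h
  have g := he.gram_projVec₂ hb hb' hc (cosLift_sq_lt_one h) i1 i2 i3
  have hle := he.abs_colCov_le h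
  set c := cosLift t s
  set x := affineLift t with hx
  set y := affineLift s with hy
  have hx0 : 0 < ‖x‖ := norm_pos_iff.2 (affineLift_ne_zero t)
  have hy0 : 0 < ‖y‖ := norm_pos_iff.2 (affineLift_ne_zero s)
  have hP : ∀ w, projVec₂ (e x) (e y) w = projVec₂ (e (b 0)) (e (b' 0)) w := fun w => by
    conv_lhs => rw [hb0, hb0', he.map_smul, he.map_smul]
    exact projVec₂_smul (by positivity) (by positivity) w
  have hx0' : projVec₂ (e x) (e y) (e x) = 0 := projVec₂_left _ _
  have hy0' : projVec₂ (e x) (e y) (e y) = 0 := projVec₂_right _ _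
  have d1 := he.abs_detSystem_unit_frame hx0' hP hb hb0
  have d2 := he.abs_detSystem_unit_frame hy0' hP hb' hb0'
  rw [← hx] at d1
  rw [← hy] at d2
  have r1 : 0 ≤ ‖x‖⁻¹ * (√(d + 2) * ‖x‖ ^ (d + 1)) ^ (n + 1) := by positivity
  have r2 : 0 ≤ ‖y‖⁻¹ * (√(d + 2) * ‖y‖ ^ (d + 1)) ^ (n + 1) := by positivity
  have key' : ∀ a b A B : ℝ, 0 ≤ A → 0 ≤ B → ENNReal.ofReal (A * a) * ENNReal.ofReal (B * b)
      = ENNReal.ofReal (A * B) * (ENNReal.ofReal a * ENNReal.ofReal b) := fun a b A B hA hB => by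
    rw [ENNReal.ofReal_mul hA, ENNReal.ofReal_mul hB, ENNReal.ofReal_mul hA]
    ring
  simp_rw [d1, d2, key' _ _ _ _ r1 r2]
  rw [lintegral_const_mul' _ _ ENNReal.ofReal_ne_top]
  congr 1
  have hs : √((d : ℝ) + 2) * √((d : ℝ) + 2) = d + 2 := Real.mul_self_sqrt (by positivity)
  have hs0 : √((d : ℝ) + 2) ≠ 0 := (Real.sqrt_pos.2 (by positivity)).ne'
  have key : ∀ a : ℝ, (√((d : ℝ) + 2))⁻¹ * ((√((d : ℝ) + 2))⁻¹ * ((d + 2) * a)) = a := fun a => by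
    rw [mul_comm ((d : ℝ) + 2) a]
    field_simp
    rw [sq, hs]
  refine lintegral_detSystem_mul_congr _ _ _ _ ?_ ?_ ?_ <;> intro j k <;>
    rw [real_inner_smul_left, real_inner_smul_right, inner_pairCol]
  · rw [(g j k).1]
    split_ifs with hjk
    · subst hjk; rw [key, (colPlus_sq_add_colMinus_sq (hle j)).1]
    · simp
  · rw [(g j k).2.1]
    split_ifs with hjk
    · subst hjk
      rw [key, Pi.neg_apply, mul_neg, ← sub_eq_add_neg, (colPlus_sq_add_colMinus_sq (hle j)).2]
    · simp
  · rw [(g j k).2.2]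
    split_ifs with hjk
    · subst hjk
      rw [key, Pi.neg_apply, neg_mul_neg, (colPlus_sq_add_colMinus_sq (hle j)).1]
    · simp

end TwoPoint

/-- The normalized two-point density of the zeros at angle `arccos c`. -/
noncomputable def pairKernel (n d : ℕ) (c : ℝ) : ENNReal :=
  ENNReal.ofReal ((√(1 - c ^ (2 * d + 4)))⁻¹ ^ (n + 1)) *
    pairDetMoment (n + 1) (colPlus n d c) (colMinus n d c)

/-- The density of the projective measure in the affine chart. -/
noncomputable def chartWeight {m : ℕ} (t : Fin m → ℝ) : ℝ := (‖affineLift t‖ ^ (m + 1))⁻¹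

section SecondMoment

variable {n d : ℕ} {H : Type*} [NormedAddCommGroup H] [InnerProductSpace ℝ H]
  {e : EuclideanSpace ℝ (Fin (n + 2)) → H}
  {e' : EuclideanSpace ℝ (Fin (n + 2)) → EuclideanSpace ℝ (Fin (n + 2)) →L[ℝ] H}

lemma chartWeight_pos {m : ℕ} (t : Fin m → ℝ) : 0 < chartWeight t := by
  have := norm_pos_iff.2 (affineLift_ne_zero t)
  rw [chartWeight]; positivity

lemma IsPowerFeature.norm_projVec (he : IsPowerFeature d e e') {t s : Fin (n + 1) → ℝ} :
    ‖projVec (e (affineLift t)) (e (affineLift s))‖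
      = ‖affineLift s‖ ^ (d + 2) * √(1 - cosLift t s ^ (2 * d + 4)) := by
  have hx := norm_ne_zero_iff.2 (affineLift_ne_zero t)
  have hy := norm_ne_zero_iff.2 (affineLift_ne_zero s)
  have h : ‖projVec (e (affineLift t)) (e (affineLift s))‖ ^ 2
      = (‖affineLift s‖ ^ (d + 2)) ^ 2 * (1 - cosLift t s ^ (2 * d + 4)) := by
    rw [← real_inner_self_eq_norm_sq, inner_projVec_projVec, he.inner_eq, he.inner_eq,
      he.norm_eq, real_inner_self_eq_norm_sq, cosLift, div_pow, mul_pow,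
      real_inner_comm (affineLift s)]
    field_simp
    ring
  rw [← Real.sqrt_sq (norm_nonneg (projVec _ _)), h, Real.sqrt_mul (by positivity),
    Real.sqrt_sq (by positivity)]

variable [FiniteDimensional ℝ H] [MeasurableSpace H] [BorelSpace H]

omit [FiniteDimensional ℝ H] [MeasurableSpace H] [BorelSpace H] in
lemma zeroCount_projSystem (t : Fin (n + 1) → ℝ) (Ξ : Fin (n + 1) → H) :
    zeroCount e (projSystem (e (affineLift t)) Ξ) = 1 + setCount {s ∈ {s | s ≠ t} |
      evalSystem Ξ (projVec (e (affineLift t)) (e (affineLift s))) = 0} := by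
  have h : {s : Fin (n + 1) → ℝ | evalSystem Ξ
      (projVec (e (affineLift t)) (e (affineLift s))) = 0} = insert t {s ∈ {s | s ≠ t} |
      evalSystem Ξ (projVec (e (affineLift t)) (e (affineLift s))) = 0} := by
    ext s
    simp only [Set.mem_insert_iff, Set.mem_ofPred_eq]
    by_cases hs : s = t
    · subst hs
      simp only [true_or, iff_true, projVec_self]
      funext ℓ
      simp [evalSystem]
    · simp [hs]
  simp only [zeroCount, evalSystem_projSystem]
  rw [h, setCount_eq_encard, setCount_eq_encard, Set.encard_insert_of_notMem (by simp)]
  push_cast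
  rw [add_comm]

lemma lintegral_zeroCount_inner (he : IsPowerFeature d e e') (t : Fin (n + 1) → ℝ) :
    ENNReal.ofReal ((√(2 * π) * ‖affineLift t‖ ^ (d + 2))⁻¹ ^ (n + 1)) *
    ∫⁻ Ξ, setCount {s ∈ {s | s ≠ t} |
        evalSystem Ξ (projVec (e (affineLift t)) (e (affineLift s))) = 0} *
      ENNReal.ofReal |detSystem (projSystem (e (affineLift t)) Ξ)
        fun j => e' (affineLift t) (linearLift (Pi.single j 1))| ∂gaussianSystem (n + 1) H
      = ENNReal.ofReal (intensityConst (n + 1) d ^ 2) * (ENNReal.ofReal (chartWeight t) *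
        ∫⁻ s, ENNReal.ofReal (chartWeight s) * pairKernel n d (cosLift t s)) := by
  have hx : 0 < ‖affineLift t‖ := norm_pos_iff.2 (affineLift_ne_zero t)
  have hrt : ∀ s, s ≠ t → 0 < √(1 - cosLift t s ^ (2 * d + 4)) := fun s hs =>
    Real.sqrt_pos.2 (one_sub_pow_pos (cosLift_sq_lt_one hs) (d + 1))
  have hT : IsSigmaCompact {s : Fin (n + 1) → ℝ | s ≠ t} := by
    have := (isSigmaCompact_univ (X := Fin (n + 1) → ℝ)).inter_ne_zero
      (f := fun s => dist s t) (by fun_prop)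
    simpa [dist_eq_zero] using this
  have hTm : MeasurableSet {s : Fin (n + 1) → ℝ | s ≠ t} := (measurableSet_singleton t).compl
  have hF : Measurable fun Ξ : Fin (n + 1) → H =>
      ENNReal.ofReal |detSystem (projSystem (e (affineLift t)) Ξ)
        fun j => e' (affineLift t) (linearLift (Pi.single j 1))| := by
    simp_rw [detSystem_projSystem]
    exact (measurable_detSystem measurable_id measurable_const).abs.ennreal_ofReal
  have hv : ∀ s : Fin (n + 1) → ℝ, HasFDerivAt
      (fun s => projVec (e (affineLift t)) (e (affineLift s)))
      ((projVec (e (affineLift t))).comp ((e' (affineLift s)).comp linearLift)) s := fun s =>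
    (projVec (e (affineLift t))).hasFDerivAt.comp s (hasFDerivAt_feature_affineLift he s)
  have hv' : Continuous fun s : Fin (n + 1) → ℝ =>
      (projVec (e (affineLift t))).comp ((e' (affineLift s)).comp linearLift) :=
    continuous_const.clm_comp (continuous_fderiv_feature_affineLift he)
  rw [kacRice hv hv' hT hTm (fun s hs => norm_ne_zero_iff.1 (by
      have hy : 0 < ‖affineLift s‖ := norm_pos_iff.2 (affineLift_ne_zero s)
      have := hrt s hs
      rw [he.norm_projVec]; positivity)) hF]
  have hall : (volume : Measure (Fin (n + 1) → ℝ)).restrict {s | s ≠ t} = volume :=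
    Measure.restrict_eq_self_of_ae_mem (by
      rw [ae_iff]; simp)
  rw [← lintegral_const_mul' _ _ ENNReal.ofReal_ne_top,
    ← lintegral_const_mul' _ _ ENNReal.ofReal_ne_top,
    ← lintegral_const_mul' _ _ ENNReal.ofReal_ne_top]
  conv_rhs => rw [← hall]
  refine setLIntegral_congr_fun hTm fun s hs => ?_
  have hs : s ≠ t := hs
  have hy : 0 < ‖affineLift s‖ := norm_pos_iff.2 (affineLift_ne_zero s)
  have hr := hrt s hs
  have h2 := lintegral_detSystem_two_point he hs
  simp only [detSystem_projSystem, ContinuousLinearMap.comp_apply]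
  simp only [projVec₂, ContinuousLinearMap.comp_apply] at h2
  rw [lintegral_congr fun Ξ => mul_comm _ _, h2, he.norm_projVec, pairKernel]
  have key : ∀ {a b c k p q r : ℝ} (M : ENNReal), 0 ≤ a → 0 ≤ b → 0 ≤ c → 0 ≤ k → 0 ≤ p →
      0 ≤ q → a * (b * c) = k * (p * (q * r)) →
      ENNReal.ofReal a * (ENNReal.ofReal b * (ENNReal.ofReal c * M)) = ENNReal.ofReal k *
        (ENNReal.ofReal p * (ENNReal.ofReal q * (ENNReal.ofReal r * M))) := by
    intro a b c k p q r M ha hb hc hk hp hq h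
    rw [← mul_assoc (ENNReal.ofReal b), ← ENNReal.ofReal_mul hb, ← mul_assoc,
      ← ENNReal.ofReal_mul ha, h, ENNReal.ofReal_mul hk, ENNReal.ofReal_mul hp,
      ENNReal.ofReal_mul hq]
    ring
  refine key _ (by positivity) (by positivity) (by positivity) (by positivity)
    (chartWeight_pos t).le (chartWeight_pos s).le ?_
  have i1 := intensity_identity (m := n + 1) (d := d) hx
  have i2 := intensity_identity (m := n + 1) (d := d) hy
  rw [chartWeight, chartWeight]
  rw [← mul_assoc √(2 * π), mul_inv (√(2 * π) * ‖affineLift s‖ ^ (d + 2)), mul_pow (_)⁻¹ (_)⁻¹]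
  linear_combination (√(1 - cosLift t s ^ (2 * d + 4)))⁻¹ ^ (n + 1) *
    ((√(2 * π) * ‖affineLift s‖ ^ (d + 2))⁻¹ ^ (n + 1) *
    (‖affineLift s‖⁻¹ * (√(d + 2) * ‖affineLift s‖ ^ (d + 1)) ^ (n + 1))) * i1 +
    (√(1 - cosLift t s ^ (2 * d + 4)))⁻¹ ^ (n + 1) * intensityConst (n + 1) d *
      (‖affineLift t‖ ^ (n + 1 + 1))⁻¹ * i2

theorem lintegral_zeroCount_sq (he : IsPowerFeature d e e') :
    ∫⁻ Ξ, zeroCount e Ξ * zeroCount e Ξ ∂gaussianSystem (n + 1) H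
      = ∫⁻ Ξ, zeroCount e Ξ ∂gaussianSystem (n + 1) H +
        ENNReal.ofReal (intensityConst (n + 1) d ^ 2) *
          ∫⁻ t : Fin (n + 1) → ℝ, ENNReal.ofReal (chartWeight t) *
            ∫⁻ s, ENNReal.ofReal (chartWeight s) * pairKernel n d (cosLift t s) := by
  rw [kacRice_feature he (measurable_zeroCount he)]
  have h1 := kacRice_feature he (F := fun _ => 1) measurable_const
  simp only [mul_one] at h1
  rw [h1, ← lintegral_const_mul' _ _ ENNReal.ofReal_ne_top, ← lintegral_add_left]
  · refine lintegral_congr fun t => ?_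
    rw [← lintegral_zeroCount_inner he t, ← mul_add, ← lintegral_add_left]
    · congr 1
      refine lintegral_congr fun Ξ => ?_
      rw [zeroCount_projSystem]
      ring
    · simp_rw [detSystem_projSystem]
      exact (measurable_detSystem measurable_id measurable_const).abs.ennreal_ofReal
  · simp_rw [lintegral_detSystem_one_point he]
    have := continuous_affineLift (m := n + 1)
    fun_prop

end SecondMoment

section Projective

variable {m : ℕ}

/-- The point `(u, u t)`. -/
lemma smul_affineLift_eq (u : ℝ) (t : Fin m → ℝ) :
    u • affineLift t = WithLp.toLp 2 (Fin.cons u (u • t) : Fin (m + 1) → ℝ) := by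
  ext i
  refine Fin.cases ?_ (fun j => ?_) i <;> simp

lemma lintegral_euclidean_cone {f : EuclideanSpace ℝ (Fin (m + 1)) → ENNReal} (hf : Measurable f) :
    ∫⁻ y, f y = ∫⁻ t : Fin m → ℝ, ∫⁻ u : ℝ, ENNReal.ofReal (|u| ^ m) * f (u • affineLift t) := by
  have hc := continuous_affineLift (m := m)
  have h1 : ∫⁻ y, f y = ∫⁻ u : ℝ, ∫⁻ v : Fin m → ℝ, f (WithLp.toLp 2 (Fin.cons u v)) := by
    have hf' : Measurable fun a : Fin (m + 1) → ℝ => f (WithLp.toLp 2 a) :=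
      hf.comp (WithLp.measurable_toLp 2 _)
    have hf'' : Measurable fun a : ℝ × (Fin m → ℝ) => f (WithLp.toLp 2
        ((MeasurableEquiv.piFinSuccAbove (fun _ => ℝ) (0 : Fin (m + 1))).symm a)) :=
      hf'.comp (MeasurableEquiv.measurable _)
    rw [← (PiLp.volume_preserving_toLp (Fin (m + 1))).lintegral_comp hf,
      ← (volume_preserving_piFinSuccAbove (fun _ => ℝ) (0 : Fin (m + 1))).symm.lintegral_comp
        hf', Measure.volume_eq_prod,
        lintegral_prod _ hf''.aemeasurable]
    simp [MeasurableEquiv.piFinSuccAbove, Fin.insertNthEquiv, Fin.insertNth_zero']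
  rw [h1]
  symm
  rw [lintegral_lintegral_swap (by fun_prop)]
  refine lintegral_congr_ae ?_
  have h0 : ∀ᵐ u : ℝ ∂volume, u ≠ 0 := by simp [ae_iff]
  filter_upwards [h0] with u hu
  have hm : Measurable fun v : Fin m → ℝ => f (WithLp.toLp 2 (Fin.cons u v)) := by
    have : Measurable fun v : Fin m → ℝ => (Fin.cons u v : Fin (m + 1) → ℝ) :=
      measurable_pi_iff.2 fun i => by
        refine Fin.cases (by simp) (fun j => ?_) i
        simp only [Fin.cons_succ]
        fun_prop
    exact hf.comp ((WithLp.measurable_toLp 2 _).comp this)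
  have h2 := Measure.map_addHaar_smul (volume : Measure (Fin m → ℝ)) hu
  have h3 : ∫⁻ t : Fin m → ℝ, f (u • affineLift t)
      = ENNReal.ofReal |(u ^ m)⁻¹| * ∫⁻ v : Fin m → ℝ, f (WithLp.toLp 2 (Fin.cons u v)) := by
    simp_rw [smul_affineLift_eq]
    rw [← lintegral_map (f := fun v : Fin m → ℝ => f (WithLp.toLp 2 (Fin.cons u v)))
      (g := fun t => u • t) hm (by fun_prop), h2, lintegral_smul_measure]
    simp
  rw [lintegral_const_mul' _ _ ENNReal.ofReal_ne_top, h3, ← mul_assoc,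
    ← ENNReal.ofReal_mul (by positivity), abs_inv, abs_pow, mul_inv_cancel₀ (by positivity),
    ENNReal.ofReal_one, one_mul]

/-- The constant relating the Gaussian measure and the chart weight. -/
noncomputable def coneConst (m : ℕ) : ENNReal :=
  ∫⁻ u : ℝ, ENNReal.ofReal (|u| ^ m * ((√(2 * π))⁻¹ ^ (m + 1) * Real.exp (-u ^ 2 / 2)))

lemma lintegral_cone_density {y : EuclideanSpace ℝ (Fin (m + 1))} (hy : y ≠ 0) :
    ∫⁻ u : ℝ, ENNReal.ofReal (|u| ^ m) * stdGaussianDensity (u • y)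
      = ENNReal.ofReal (‖y‖ ^ (m + 1))⁻¹ * coneConst m := by
  have hy0 : 0 < ‖y‖ := norm_pos_iff.2 hy
  set g : ℝ → ENNReal := fun u =>
    ENNReal.ofReal (|u| ^ m * ((√(2 * π))⁻¹ ^ (m + 1) * Real.exp (-u ^ 2 / 2))) with hg
  have hgm : Measurable g := by fun_prop
  have h1 : ∫⁻ u : ℝ, g (‖y‖ * u) = ENNReal.ofReal (‖y‖⁻¹) * coneConst m := by
    have h2 := Real.map_volume_mul_left hy0.ne'
    rw [← lintegral_map (g := fun u => ‖y‖ * u) hgm (by fun_prop), h2, lintegral_smul_measure,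
      abs_of_pos (by positivity)]
    rfl
  have h3 : ∀ u : ℝ, ENNReal.ofReal (|u| ^ m) * stdGaussianDensity (u • y)
      = ENNReal.ofReal (‖y‖ ^ m)⁻¹ * g (‖y‖ * u) := fun u => by
    rw [stdGaussianDensity, hg, ← ENNReal.ofReal_mul (by positivity),
      ← ENNReal.ofReal_mul (by positivity), finrank_euclideanSpace_fin, norm_smul, abs_mul,
      abs_of_pos hy0, Real.norm_eq_abs, mul_pow |u| ‖y‖ 2, mul_pow ‖y‖ u 2, mul_pow ‖y‖ |u| m, sq_abs]
    congr 1
    have : -(u ^ 2 * ‖y‖ ^ 2) = -(‖y‖ ^ 2 * u ^ 2) := by ring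
    rw [this]
    field_simp
  simp_rw [h3]
  rw [lintegral_const_mul' _ _ ENNReal.ofReal_ne_top, h1, ← mul_assoc,
    ← ENNReal.ofReal_mul (by positivity), pow_succ, mul_inv]

theorem lintegral_stdGaussian_eq_chart {G : EuclideanSpace ℝ (Fin (m + 1)) → ENNReal}
    (hG : Measurable G) (hom : ∀ r : ℝ, r ≠ 0 → ∀ y, G (r • y) = G y) :
    ∫⁻ y, G y ∂stdGaussian (EuclideanSpace ℝ (Fin (m + 1)))
      = coneConst m * ∫⁻ t : Fin m → ℝ, ENNReal.ofReal (chartWeight t) * G (affineLift t) := by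
  have hc := continuous_affineLift (m := m)
  rw [stdGaussian_eq_withDensity,
    lintegral_withDensity_eq_lintegral_mul _ measurable_stdGaussianDensity hG,
    lintegral_euclidean_cone (measurable_stdGaussianDensity.mul hG), ← lintegral_const_mul]
  · refine lintegral_congr fun t => ?_
    have h0 : ∀ᵐ u : ℝ ∂volume, u ≠ 0 := by simp [ae_iff]
    have h1 : ∫⁻ u : ℝ, ENNReal.ofReal (|u| ^ m) * (stdGaussianDensity (H := EuclideanSpace ℝ (Fin (m + 1))) * G) (u • affineLift t)
        = ∫⁻ u : ℝ, (ENNReal.ofReal (|u| ^ m) * stdGaussianDensity (u • affineLift t)) *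
          G (affineLift t) := by
      refine lintegral_congr_ae ?_
      filter_upwards [h0] with u hu
      rw [Pi.mul_apply, hom u hu, mul_assoc]
    have hm := measurable_stdGaussianDensity (H := EuclideanSpace ℝ (Fin (m + 1)))
    rw [h1, lintegral_mul_const _ (by fun_prop), lintegral_cone_density (affineLift_ne_zero t),
      chartWeight]
    ring
  · unfold chartWeight
    fun_prop

lemma coneConst_mul_chartMass : coneConst m * chartMass m = 1 := by
  have := lintegral_stdGaussian_eq_chart (m := m) (G := fun _ => 1) measurable_const
    (fun _ _ _ => rfl)
  simp only [mul_one, lintegral_const, measure_univ] at this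
  exact this.symm

lemma chartMass_ne_zero : chartMass m ≠ 0 := fun h => by
  have := coneConst_mul_chartMass (m := m); simp [h] at this

lemma chartMass_ne_top : chartMass m ≠ ⊤ := fun h => by
  have h1 := coneConst_mul_chartMass (m := m)
  rw [h] at h1
  by_cases h0 : coneConst m = 0
  · simp [h0] at h1
  · rw [ENNReal.mul_top h0] at h1; simp at h1

theorem lintegral_chart_eq_stdGaussian {G : EuclideanSpace ℝ (Fin (m + 1)) → ENNReal}
    (hG : Measurable G) (hom : ∀ r : ℝ, r ≠ 0 → ∀ y, G (r • y) = G y) :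
    ∫⁻ t : Fin m → ℝ, ENNReal.ofReal (chartWeight t) * G (affineLift t)
      = chartMass m * ∫⁻ y, G y ∂stdGaussian (EuclideanSpace ℝ (Fin (m + 1))) := by
  rw [lintegral_stdGaussian_eq_chart hG hom, ← mul_assoc, mul_comm (chartMass m),
    coneConst_mul_chartMass, one_mul]

/-- The integral of an even function of the cosine does not depend on the base point. -/
theorem lintegral_cosLift {Ψ : ℝ → ENNReal} (hΨ : Measurable Ψ) (hev : ∀ c, Ψ (-c) = Ψ c)
    (t : Fin m → ℝ) :
    ∫⁻ s : Fin m → ℝ, ENNReal.ofReal (chartWeight s) * Ψ (cosLift t s)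
      = ∫⁻ s : Fin m → ℝ, ENNReal.ofReal (chartWeight s) * Ψ (‖affineLift s‖⁻¹) := by
  set G : EuclideanSpace ℝ (Fin (m + 1)) → EuclideanSpace ℝ (Fin (m + 1)) → ENNReal :=
    fun x y => Ψ (inner ℝ x y / ‖y‖) with hG
  have hGm : ∀ x, Measurable (G x) := fun x => by fun_prop
  have hom : ∀ x, ∀ r : ℝ, r ≠ 0 → ∀ y, G x (r • y) = G x y := by
    intro x r hr y
    simp only [hG, real_inner_smul_right, norm_smul, Real.norm_eq_abs]
    rcases lt_or_gt_of_ne hr with h | h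
    · rw [abs_of_neg h, ← hev]
      congr 1
      rw [neg_mul, div_neg, neg_neg, mul_div_mul_left _ _ hr]
    · rw [abs_of_pos h, mul_div_mul_left _ _ hr]
  obtain ⟨b, hb⟩ := exists_frame_affineLift t
  have hx := norm_ne_zero_iff.2 (affineLift_ne_zero t)
  have h1 : ∀ s, Ψ (cosLift t s) = G (b 0) (affineLift s) := fun s => by
    simp only [hG, cosLift]
    conv_lhs => rw [hb]
    rw [real_inner_smul_left, norm_smul, norm_norm, b.orthonormal.1 0, mul_one,
      mul_div_mul_left _ _ hx]
  have h2 : ∀ s : Fin m → ℝ, Ψ (‖affineLift s‖⁻¹)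
      = G (EuclideanSpace.single 0 1) (affineLift s) := fun s => by
    simp [hG, EuclideanSpace.inner_single_left]
  simp_rw [h1, h2]
  rw [lintegral_chart_eq_stdGaussian (hGm _) (hom _), lintegral_chart_eq_stdGaussian (hGm _) (hom _)]
  congr 1
  conv_rhs => rw [← stdGaussian_map b.repr, lintegral_map (hGm _) (by fun_prop)]
  refine lintegral_congr fun y => ?_
  simp only [hG, LinearIsometryEquiv.norm_map]
  rw [← b.repr_self, LinearIsometryEquiv.inner_map_map]

end Projective

section Symmetry

variable {n d : ℕ}

lemma detSystem_smul_columns {m : ℕ} {H : Type*} [NormedAddCommGroup H] [InnerProductSpace ℝ H]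
    (Ξ : Fin m → H) (c : Fin m → ℝ) (y : Fin m → H) :
    detSystem Ξ (fun j => c j • y j) = (∏ j, c j) * detSystem Ξ y := by
  simp only [detSystem, real_inner_smul_right]
  exact Matrix.det_mul_row c (Matrix.of fun ℓ j => (inner ℝ (Ξ ℓ) (y j) : ℝ))

/-- Exchanging the two coefficients in some columns does not change the moment. -/
lemma pairDetMoment_congr {m : ℕ} {p q p' q' : Fin m → ℝ}
    (h : ∀ j, (p' j = p j ∧ q' j = q j) ∨ (p' j = q j ∧ q' j = p j)) :
    pairDetMoment m p q = pairDetMoment m p' q' := by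
  classical
  set σ : Fin m → ℝ := fun j => if p' j = p j ∧ q' j = q j then 1 else -1 with hσ
  have habs : |∏ j, σ j| = 1 := by
    rw [Finset.abs_prod]
    refine Finset.prod_eq_one fun j _ => ?_
    simp only [hσ]
    split_ifs <;> simp
  have h1 : ∀ Ξ : Fin m → EuclideanSpace ℝ (Fin m ⊕ Fin m), |detSystem Ξ (pairCol p' (-q'))|
      = |detSystem Ξ fun j => σ j • pairCol p' (-q') j| := fun Ξ => by
    rw [detSystem_smul_columns, abs_mul, habs, one_mul]
  simp only [pairDetMoment, h1]
  refine lintegral_detSystem_mul_congr _ _ _ _ ?_ ?_ ?_ <;> intro j k <;>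
    simp only [real_inner_smul_left, real_inner_smul_right, inner_pairCol, Pi.neg_apply] <;>
    by_cases hjk : j = k <;> simp only [hjk, if_true, if_false, mul_zero] <;>
    rcases h k with ⟨h1, h2⟩ | ⟨h1, h2⟩ <;> simp only [h1, h2, hσ] <;> try ring
  · simp
  · split_ifs with h3
    · rw [h3.2]; ring
    · ring
  · simp
  · split_ifs with h3
    · rw [h3.2]; ring
    · ring

lemma pairKernel_neg (c : ℝ) : pairKernel n d (-c) = pairKernel n d c := by
  have e1 : ∀ k, (-c) ^ (2 * k) = c ^ (2 * k) := fun k => (even_two_mul k).neg_pow c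
  have hV : ∀ j, colVar n d (-c) j = colVar n d c j := fun j => by
    have h1 := e1 (d + 1); have h2 := e1 (d + 2)
    rw [mul_add] at h1 h2
    simp only [colVar, tangentVar, h1, h2, neg_sq]
  have hC : ∀ j, colCov n d (-c) j = colCov n d c j ∨ colCov n d (-c) j = -colCov n d c j := by
    intro j
    have h2 := e1 (d + 2)
    rw [mul_add] at h2
    rcases neg_one_pow_eq_or ℝ d with hd | hd
    · by_cases hj : j = 0
      · left
        simp only [colCov, hj, if_true, tangentCov, h2, neg_sq]
        have h3 : (-c) ^ (3 * d + 4) = c ^ (3 * d + 4) := by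
          rw [neg_pow, pow_add, mul_comm 3 d, pow_mul, hd]; ring
        have h4 : (-c) ^ (d + 2) = c ^ (d + 2) := by rw [neg_pow, pow_add, hd]; ring
        have h5 : (-c) ^ d = c ^ d := by rw [neg_pow, hd]; ring
        rw [h3, h4, h5]
      · right
        simp only [colCov, hj, if_false]
        rw [neg_pow, pow_add, hd]; ring
    · by_cases hj : j = 0
      · right
        simp only [colCov, hj, if_true, tangentCov, h2, neg_sq]
        have h3 : (-c) ^ (3 * d + 4) = -c ^ (3 * d + 4) := by
          rw [neg_pow, pow_add, mul_comm 3 d, pow_mul, hd]; ring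
        have h4 : (-c) ^ (d + 2) = -c ^ (d + 2) := by rw [neg_pow, pow_add, hd]; ring
        have h5 : (-c) ^ d = -c ^ d := by rw [neg_pow, hd]; ring
        rw [h3, h4, h5]; ring
      · left
        simp only [colCov, hj, if_false]
        rw [neg_pow, pow_add, hd]; ring
  have h2 := e1 (d + 2)
  rw [mul_add] at h2
  rw [pairKernel, pairKernel, h2]
  congr 1
  refine (pairDetMoment_congr fun j => ?_).symm
  simp only [colPlus, colMinus, hV]
  rcases hC j with h | h
  · left; rw [h]; exact ⟨rfl, rfl⟩
  · right; rw [h, sub_neg_eq_add, ← sub_eq_add_neg]; exact ⟨rfl, rfl⟩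

lemma measurable_pairDetMoment {m : ℕ} : Measurable fun x : (Fin m → ℝ) × (Fin m → ℝ) =>
    pairDetMoment m x.1 x.2 := by
  have hp : Measurable fun x : ((Fin m → ℝ) × (Fin m → ℝ)) ×
      (Fin m → EuclideanSpace ℝ (Fin m ⊕ Fin m)) => pairCol x.1.1 x.1.2 := by
    unfold pairCol; fun_prop
  have hq : Measurable fun x : ((Fin m → ℝ) × (Fin m → ℝ)) ×
      (Fin m → EuclideanSpace ℝ (Fin m ⊕ Fin m)) => pairCol x.1.1 (-x.1.2) := by
    unfold pairCol; fun_prop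
  exact Measurable.lintegral_prod_right'
    (f := fun x : ((Fin m → ℝ) × (Fin m → ℝ)) × (Fin m → EuclideanSpace ℝ (Fin m ⊕ Fin m)) =>
      ENNReal.ofReal |detSystem x.2 (pairCol x.1.1 x.1.2)| *
      ENNReal.ofReal |detSystem x.2 (pairCol x.1.1 (-x.1.2))|)
    ((measurable_detSystem measurable_snd hp).abs.ennreal_ofReal.mul
      (measurable_detSystem measurable_snd hq).abs.ennreal_ofReal)

lemma measurable_pairKernel : Measurable (pairKernel n d) := by
  have hV : ∀ j, Measurable fun c => colVar n d c j := fun j => by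
    
    by_cases hj : j = 0
    · simp only [colVar, hj, if_true, tangentVar]; fun_prop
    · simp only [colVar, hj, if_false]; fun_prop
  have hC : ∀ j, Measurable fun c => colCov n d c j := fun j => by
    
    by_cases hj : j = 0
    · simp only [colCov, hj, if_true, tangentCov]; fun_prop
    · simp only [colCov, hj, if_false]; fun_prop
  have hp : Measurable fun c => colPlus n d c := measurable_pi_lambda _ fun j => by
    unfold colPlus
    have := hV j
    have := hC j
    fun_prop
  have hq : Measurable fun c => colMinus n d c := measurable_pi_lambda _ fun j => by
    unfold colMinus
    have := hV j
    have := hC j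
    fun_prop
  have h1 : Measurable fun c : ℝ =>
      ENNReal.ofReal ((√(1 - c ^ (2 * d + 4)))⁻¹ ^ (n + 1)) := by fun_prop
  have h2 : Measurable fun c : ℝ =>
      pairDetMoment (n + 1) (colPlus n d c) (colMinus n d c) := by
    have h3 : Measurable fun c : ℝ => (colPlus n d c, colMinus n d c) := hp.prodMk hq
    have h4 := (measurable_pairDetMoment (m := n + 1)).comp h3
    simp only [Function.comp_def] at h4
    exact h4
  have h3 : pairKernel n d = fun c => ENNReal.ofReal ((√(1 - c ^ (2 * d + 4)))⁻¹ ^ (n + 1)) *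
      pairDetMoment (n + 1) (colPlus n d c) (colMinus n d c) := funext fun c => by
    rw [pairKernel]
  rw [h3]
  exact h1.mul h2

variable {H : Type*} [NormedAddCommGroup H] [InnerProductSpace ℝ H]
  [FiniteDimensional ℝ H] [MeasurableSpace H] [BorelSpace H]
  {e : EuclideanSpace ℝ (Fin (n + 2)) → H}
  {e' : EuclideanSpace ℝ (Fin (n + 2)) → EuclideanSpace ℝ (Fin (n + 2)) →L[ℝ] H}

theorem lintegral_zeroCount_sq_radial (he : IsPowerFeature d e e') :
    ∫⁻ Ξ, zeroCount e Ξ * zeroCount e Ξ ∂gaussianSystem (n + 1) H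
      = ∫⁻ Ξ, zeroCount e Ξ ∂gaussianSystem (n + 1) H +
        ENNReal.ofReal (intensityConst (n + 1) d ^ 2) * (chartMass (n + 1) *
          ∫⁻ s : Fin (n + 1) → ℝ,
            ENNReal.ofReal (chartWeight s) * pairKernel n d (‖affineLift s‖⁻¹)) := by
  rw [lintegral_zeroCount_sq he]
  simp_rw [lintegral_cosLift measurable_pairKernel pairKernel_neg]
  congr 2
  rw [lintegral_mul_const _ (by
    have := continuous_affineLift (m := n + 1)
    unfold chartWeight; fun_prop)]
  rfl

end Symmetry

section DetBounds

variable {m : ℕ} {H : Type*} [NormedAddCommGroup H] [InnerProductSpace ℝ H]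

lemma abs_detSystem_le (Ξ : Fin m → H) (y : Fin m → H) :
    |detSystem Ξ y| ≤ (m ! * ‖Ξ‖ ^ m) * ∏ j, ‖y j‖ := by
  rw [detSystem, Matrix.det_apply]
  calc _ ≤ ∑ σ : Equiv.Perm (Fin m), |Equiv.Perm.sign σ •
          ∏ i, Matrix.of (fun ℓ j => (inner ℝ (Ξ ℓ) (y j) : ℝ)) (σ i) i| :=
        Finset.abs_sum_le_sum_abs _ _
    _ ≤ ∑ _σ : Equiv.Perm (Fin m), ‖Ξ‖ ^ m * ∏ j, ‖y j‖ := by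
        refine Finset.sum_le_sum fun σ _ => ?_
        have h1 : |Equiv.Perm.sign σ •
            ∏ i, Matrix.of (fun ℓ j => (inner ℝ (Ξ ℓ) (y j) : ℝ)) (σ i) i|
            = ∏ i, |(inner ℝ (Ξ (σ i)) (y i) : ℝ)| := by
          rcases Int.units_eq_one_or (Equiv.Perm.sign σ) with h | h <;>
            simp [h, Finset.abs_prod, Units.smul_def]
        rw [h1]
        calc ∏ i, |(inner ℝ (Ξ (σ i)) (y i) : ℝ)| ≤ ∏ i, ‖Ξ‖ * ‖y i‖ := by
              refine Finset.prod_le_prod (fun _ _ => abs_nonneg _) fun i _ => ?_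
              exact (abs_real_inner_le_norm _ _).trans
                (mul_le_mul_of_nonneg_right (norm_le_pi_norm Ξ _) (norm_nonneg _))
          _ = ‖Ξ‖ ^ m * ∏ j, ‖y j‖ := by simp [Finset.prod_mul_distrib]
    _ = _ := by simp [Fintype.card_perm, mul_assoc]

/-- The determinant as a multilinear function of the columns. -/
noncomputable def detSystemMultilinear (Ξ : Fin m → H) :
    MultilinearMap ℝ (fun _ : Fin m => H) ℝ :=
  (Matrix.detRowAlternating (R := ℝ) (n := Fin m)).toMultilinearMap.compLinearMap
    fun _ => LinearMap.pi fun ℓ => (innerSL ℝ (Ξ ℓ)).toLinearMap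

lemma detSystemMultilinear_apply (Ξ y : Fin m → H) :
    detSystemMultilinear Ξ y = detSystem Ξ y := by
  rw [detSystem, ← Matrix.det_transpose]
  rfl

lemma abs_detSystem_sub_le (Ξ y y' : Fin m → H) (hy : ∀ j, ‖y j‖ ≤ 1) (hy' : ∀ j, ‖y' j‖ ≤ 1) :
    |detSystem Ξ y - detSystem Ξ y'| ≤ m ! * ‖Ξ‖ ^ m * m * ∑ j, ‖y j - y' j‖ := by
  have h := (detSystemMultilinear Ξ).norm_image_sub_le_of_bound' (C := m ! * ‖Ξ‖ ^ m)
    (by positivity) (fun y => by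
      rw [detSystemMultilinear_apply]; exact abs_detSystem_le Ξ y) y y'
  rw [detSystemMultilinear_apply, detSystemMultilinear_apply, Real.norm_eq_abs] at h
  refine h.trans ?_
  rw [mul_assoc (_ * _)]
  refine mul_le_mul_of_nonneg_left ?_ (by positivity)
  calc _ ≤ ∑ i, ‖y i - y' i‖ := by
        refine Finset.sum_le_sum fun i _ => ?_
        rw [← Finset.mul_prod_erase _ _ (Finset.mem_univ i), if_pos rfl]
        refine mul_le_of_le_one_right (norm_nonneg _) (Finset.prod_le_one ?_ ?_)
        · intro j _; split_ifs <;> positivity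
        · intro j hj
          rw [if_neg (Finset.ne_of_mem_erase hj)]
          exact max_le (hy j) (hy' j)
    _ ≤ _ := by
        rcases Nat.eq_zero_or_pos m with rfl | hm
        · simp
        · refine le_mul_of_one_le_left (Finset.sum_nonneg fun _ _ => norm_nonneg _) ?_
          exact_mod_cast hm

lemma abs_mul_abs_sub_le {a b a' b' M δ : ℝ} (ha : |a| ≤ M) (hb' : |b'| ≤ M)
    (h : |a - a'| ≤ δ) (h' : |b - b'| ≤ δ) :
    |(|a| * |b| - |a'| * |b'|)| ≤ 2 * M * δ := by
  have h1 : |a| * |b| - |a'| * |b'| = |a| * (|b| - |b'|) + (|a| - |a'|) * |b'| := by ring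
  have hM : 0 ≤ M := (abs_nonneg a).trans ha
  rw [h1]
  calc _ ≤ |(|a| * (|b| - |b'|))| + |((|a| - |a'|) * |b'|)| := abs_add_le _ _
    _ ≤ M * δ + δ * M := by
        rw [abs_mul, abs_mul, abs_abs, abs_abs]
        have hδ : 0 ≤ δ := (abs_nonneg _).trans h
        exact add_le_add
          (mul_le_mul ha ((abs_abs_sub_abs_le_abs_sub _ _).trans h') (abs_nonneg _) hM)
          (mul_le_mul ((abs_abs_sub_abs_le_abs_sub _ _).trans h) hb' (abs_nonneg _) hδ)
    _ = _ := by ring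

end DetBounds

section Moments

variable {m : ℕ} {H : Type*} [NormedAddCommGroup H] [InnerProductSpace ℝ H]
  [FiniteDimensional ℝ H] [MeasurableSpace H] [BorelSpace H]

lemma integrable_norm_pow_stdGaussian (k : ℕ) :
    Integrable (fun x : H => ‖x‖ ^ k) (stdGaussian H) := by
  have := isGaussian_stdGaussian (E := H)
  have h := (IsGaussian.memLp_id (stdGaussian H) k (by simp)).integrable_norm_pow'
  simpa using h

lemma integrable_norm_pow_gaussianSystem (k : ℕ) :
    Integrable (fun Ξ : Fin m → H => ‖Ξ‖ ^ k) (gaussianSystem m H) := by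
  have h1 : Integrable (fun Ξ : Fin m → H => 1 + ∑ ℓ, ‖Ξ ℓ‖ ^ k) (gaussianSystem m H) := by
    refine (integrable_const 1).add (integrable_finsetSum _ fun ℓ _ => ?_)
    have := measurePreserving_eval (fun _ : Fin m => stdGaussian H) ℓ
    exact this.integrable_comp_of_integrable (g := fun x : H => ‖x‖ ^ k)
      (integrable_norm_pow_stdGaussian k)
  refine h1.mono' (by fun_prop) (Filter.Eventually.of_forall fun Ξ => ?_)
  rw [norm_pow, norm_norm]
  have h0 : 0 ≤ ∑ ℓ, ‖Ξ ℓ‖ ^ k := Finset.sum_nonneg fun _ _ => by positivity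
  rcases isEmpty_or_nonempty (Fin m) with he | he
  · rw [Subsingleton.elim Ξ 0, norm_zero]
    exact (zero_pow_le_one k).trans (le_add_of_nonneg_right (by simp))
  · obtain ⟨ℓ, -, hℓ⟩ := Finset.exists_mem_eq_sup Finset.univ Finset.univ_nonempty
      fun ℓ => ‖Ξ ℓ‖₊
    have hn : ‖Ξ‖ = ‖Ξ ℓ‖ := by rw [Pi.norm_def, hℓ]; rfl
    rw [hn]
    have := Finset.single_le_sum (f := fun ℓ => ‖Ξ ℓ‖ ^ k) (fun _ _ => by positivity)
      (Finset.mem_univ ℓ)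
    linarith

lemma integrable_abs_detSystem_mul (y y' : Fin m → H) :
    Integrable (fun Ξ => |detSystem Ξ y| * |detSystem Ξ y'|) (gaussianSystem m H) := by
  have h1 := ((integrable_norm_pow_gaussianSystem (m := m) (H := H) (2 * m)).const_mul
    ((m ! : ℝ) ^ 2 * ((∏ j, ‖y j‖) * ∏ j, ‖y' j‖)))
  have ms : ∀ y : Fin m → H, Measurable fun Ξ : Fin m → H => detSystem Ξ y := fun y =>
    measurable_detSystem measurable_id measurable_const
  refine h1.mono' ((ms y).abs.mul (ms y').abs).aestronglyMeasurable
    (Filter.Eventually.of_forall fun Ξ => ?_)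
  rw [norm_mul, Real.norm_eq_abs, Real.norm_eq_abs, abs_abs, abs_abs]
  calc _ ≤ ((m ! * ‖Ξ‖ ^ m) * ∏ j, ‖y j‖) * ((m ! * ‖Ξ‖ ^ m) * ∏ j, ‖y' j‖) :=
        mul_le_mul (abs_detSystem_le Ξ y) (abs_detSystem_le Ξ y') (abs_nonneg _) (by positivity)
    _ = _ := by ring

end Moments

section PairMoment

variable {m : ℕ}

lemma pairDetMoment_eq_ofReal (p q : Fin m → ℝ) :
    pairDetMoment m p q = ENNReal.ofReal
      (∫ Ξ, |detSystem Ξ (pairCol p q)| * |detSystem Ξ (pairCol p (-q))|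
        ∂gaussianSystem m (EuclideanSpace ℝ (Fin m ⊕ Fin m))) := by
  rw [ofReal_integral_eq_lintegral_ofReal (integrable_abs_detSystem_mul _ _)
    (Filter.Eventually.of_forall fun _ => by positivity)]
  simp_rw [ENNReal.ofReal_mul (abs_nonneg _)]
  rfl

lemma pairDetMoment_ne_top (p q : Fin m → ℝ) : pairDetMoment m p q ≠ ⊤ := by
  rw [pairDetMoment_eq_ofReal]; exact ENNReal.ofReal_ne_top

lemma toReal_pairDetMoment (p q : Fin m → ℝ) :
    (pairDetMoment m p q).toReal = ∫ Ξ, |detSystem Ξ (pairCol p q)| *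
      |detSystem Ξ (pairCol p (-q))| ∂gaussianSystem m (EuclideanSpace ℝ (Fin m ⊕ Fin m)) := by
  rw [pairDetMoment_eq_ofReal, ENNReal.toReal_ofReal (integral_nonneg fun _ => by positivity)]

lemma norm_pairCol (p q : Fin m → ℝ) (j : Fin m) : ‖pairCol p q j‖ = √(p j ^ 2 + q j ^ 2) := by
  rw [@norm_eq_sqrt_real_inner, inner_pairCol, if_pos rfl, sq, sq]

lemma norm_pairCol_neg (p q : Fin m → ℝ) (j : Fin m) :
    ‖pairCol p (-q) j‖ = √(p j ^ 2 + q j ^ 2) := by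
  rw [norm_pairCol]; simp

lemma norm_pairCol_sub (p q p' q' : Fin m → ℝ) (j : Fin m) :
    ‖pairCol p q j - pairCol p' q' j‖ ≤ |p j - p' j| + |q j - q' j| := by
  have : pairCol p q j - pairCol p' q' j
      = (p j - p' j) • EuclideanSpace.single (Sum.inl j) (1 : ℝ)
        + (q j - q' j) • EuclideanSpace.single (Sum.inr j) (1 : ℝ) := by
    simp only [pairCol, sub_smul]; abel
  rw [this]
  refine (norm_add_le _ _).trans_eq ?_
  simp [norm_smul]

/-- The moment constant entering the determinant bounds. -/
noncomputable def pairMomentConst (m : ℕ) : ℝ :=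
  ∫ Ξ, ‖Ξ‖ ^ (2 * m) ∂gaussianSystem m (EuclideanSpace ℝ (Fin m ⊕ Fin m))

lemma pairMomentConst_nonneg : 0 ≤ pairMomentConst m := integral_nonneg fun _ => by positivity

lemma toReal_pairDetMoment_le (p q : Fin m → ℝ) :
    (pairDetMoment m p q).toReal ≤
      (m ! : ℝ) ^ 2 * pairMomentConst m * ∏ j, (p j ^ 2 + q j ^ 2) := by
  rw [toReal_pairDetMoment]
  have h1 := ((integrable_norm_pow_gaussianSystem (m := m)
    (H := EuclideanSpace ℝ (Fin m ⊕ Fin m)) (2 * m)).const_mul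
    ((m ! : ℝ) ^ 2 * ∏ j, (p j ^ 2 + q j ^ 2)))
  calc _ ≤ ∫ Ξ, ((m ! : ℝ) ^ 2 * ∏ j, (p j ^ 2 + q j ^ 2)) * ‖Ξ‖ ^ (2 * m)
          ∂gaussianSystem m (EuclideanSpace ℝ (Fin m ⊕ Fin m)) := by
        refine integral_mono (integrable_abs_detSystem_mul _ _) h1 fun Ξ => ?_
        simp only
        calc _ ≤ ((m ! * ‖Ξ‖ ^ m) * ∏ j, ‖pairCol p q j‖) *
              ((m ! * ‖Ξ‖ ^ m) * ∏ j, ‖pairCol p (-q) j‖) :=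
              mul_le_mul (abs_detSystem_le Ξ _) (abs_detSystem_le Ξ _) (abs_nonneg _)
                (by positivity)
          _ = ((m ! : ℝ) ^ 2 * ∏ j, ‖pairCol p q j‖ * ‖pairCol p (-q) j‖) * ‖Ξ‖ ^ (2 * m) := by
              rw [Finset.prod_mul_distrib]; ring
          _ = _ := by
              congr 3; ext j
              rw [norm_pairCol, norm_pairCol_neg, Real.mul_self_sqrt (by positivity)]
    _ = _ := by rw [integral_const_mul, pairMomentConst]; ring

lemma abs_toReal_pairDetMoment_sub_le (p q p' q' : Fin m → ℝ)
    (h : ∀ j, p j ^ 2 + q j ^ 2 ≤ 1) (h' : ∀ j, p' j ^ 2 + q' j ^ 2 ≤ 1) :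
    |(pairDetMoment m p q).toReal - (pairDetMoment m p' q').toReal| ≤
      2 * m * (m ! : ℝ) ^ 2 * pairMomentConst m * ∑ j, (|p j - p' j| + |q j - q' j|) := by
  rw [toReal_pairDetMoment, toReal_pairDetMoment,
    ← integral_sub (integrable_abs_detSystem_mul _ _) (integrable_abs_detSystem_mul _ _)]
  set δ := ∑ j, (|p j - p' j| + |q j - q' j|) with hδ
  have h1 := ((integrable_norm_pow_gaussianSystem (m := m)
    (H := EuclideanSpace ℝ (Fin m ⊕ Fin m)) (2 * m)).const_mul (2 * m * (m ! : ℝ) ^ 2 * δ))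
  have n1 : ∀ p q : Fin m → ℝ, (∀ j, p j ^ 2 + q j ^ 2 ≤ 1) → ∀ j, ‖pairCol p q j‖ ≤ 1 :=
    fun p q h j => by rw [norm_pairCol]; exact Real.sqrt_le_one.2 (h j)
  have n2 : ∀ p q : Fin m → ℝ, (∀ j, p j ^ 2 + q j ^ 2 ≤ 1) → ∀ j, ‖pairCol p (-q) j‖ ≤ 1 :=
    fun p q h j => by rw [norm_pairCol_neg]; exact Real.sqrt_le_one.2 (h j)
  have b1 : ∀ (Ξ y : Fin m → EuclideanSpace ℝ (Fin m ⊕ Fin m)), (∀ j, ‖y j‖ ≤ 1) →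
      |detSystem Ξ y| ≤ m ! * ‖Ξ‖ ^ m := fun Ξ y hy =>
    (abs_detSystem_le Ξ y).trans (mul_le_of_le_one_right (by positivity)
      (Finset.prod_le_one (fun _ _ => norm_nonneg _) fun j _ => hy j))
  refine (abs_integral_le_integral_abs).trans ?_
  calc _ ≤ ∫ Ξ, (2 * m * (m ! : ℝ) ^ 2 * δ) * ‖Ξ‖ ^ (2 * m)
          ∂gaussianSystem m (EuclideanSpace ℝ (Fin m ⊕ Fin m)) := by
        refine integral_mono ((integrable_abs_detSystem_mul _ _).sub
          (integrable_abs_detSystem_mul _ _)).abs h1 fun Ξ => ?_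
        have e1 : |detSystem Ξ (pairCol p q) - detSystem Ξ (pairCol p' q')|
            ≤ m ! * ‖Ξ‖ ^ m * m * δ :=
          (abs_detSystem_sub_le Ξ _ _ (n1 p q h) (n1 p' q' h')).trans
            (mul_le_mul_of_nonneg_left
              (Finset.sum_le_sum fun j _ => norm_pairCol_sub p q p' q' j) (by positivity))
        have e2 : |detSystem Ξ (pairCol p (-q)) - detSystem Ξ (pairCol p' (-q'))|
            ≤ m ! * ‖Ξ‖ ^ m * m * δ := by
          refine (abs_detSystem_sub_le Ξ _ _ (n2 p q h) (n2 p' q' h')).trans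
            (mul_le_mul_of_nonneg_left
              (Finset.sum_le_sum fun j _ => (norm_pairCol_sub p (-q) p' (-q') j).trans_eq ?_)
              (by positivity))
          rw [Pi.neg_apply, Pi.neg_apply, neg_sub_neg, abs_sub_comm (q' j)]
        refine (abs_mul_abs_sub_le (b1 Ξ _ (n1 p q h)) (b1 Ξ _ (n2 p' q' h')) e1 e2).trans_eq ?_
        ring
    _ = _ := by rw [integral_const_mul, pairMomentConst]; ring

end PairMoment

section Independent

variable {m : ℕ} {ι ι' : Type*} [Fintype ι] [Fintype ι']

lemma measurePreserving_toLp_pi :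
    MeasurePreserving (fun (M : Fin m → ι → ℝ) ℓ => WithLp.toLp 2 (M ℓ))
      (Measure.pi fun _ : Fin m => Measure.pi fun _ : ι => gaussianReal 0 1)
      (gaussianSystem m (EuclideanSpace ℝ ι)) :=
  measurePreserving_pi _ _ fun _ => ⟨by fun_prop, map_pi_eq_stdGaussian⟩

lemma measurePreserving_sum_split :
    MeasurePreserving
      (fun M : Fin m → ι ⊕ ι' → ℝ => ((fun ℓ i => M ℓ (Sum.inl i)), fun ℓ i => M ℓ (Sum.inr i)))
      (Measure.pi fun _ : Fin m => Measure.pi fun _ : ι ⊕ ι' => gaussianReal 0 1)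
      ((Measure.pi fun _ : Fin m => Measure.pi fun _ : ι => gaussianReal 0 1).prod
        (Measure.pi fun _ : Fin m => Measure.pi fun _ : ι' => gaussianReal 0 1)) := by
  have h1 := measurePreserving_pi
    (fun _ : Fin m => Measure.pi fun _ : ι ⊕ ι' => gaussianReal 0 1)
    (fun _ : Fin m => (Measure.pi fun _ : ι => gaussianReal 0 1).prod
      (Measure.pi fun _ : ι' => gaussianReal 0 1)) fun _ =>
    measurePreserving_sumPiEquivProdPi (X := fun _ : ι ⊕ ι' => ℝ) fun _ => gaussianReal 0 1
  have h2 := measurePreserving_arrowProdEquivProdArrow (ι → ℝ) (ι' → ℝ) (Fin m)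
    (fun _ => Measure.pi fun _ : ι => gaussianReal 0 1)
    (fun _ => Measure.pi fun _ : ι' => gaussianReal 0 1)
  exact h2.comp h1

lemma lintegral_abs_detSystem_mul_independent :
    ∫⁻ Ξ, ENNReal.ofReal |detSystem Ξ fun j => EuclideanSpace.single (Sum.inl j) (1 : ℝ)| *
        ENNReal.ofReal |detSystem Ξ fun j => EuclideanSpace.single (Sum.inr j) (1 : ℝ)|
        ∂gaussianSystem m (EuclideanSpace ℝ (Fin m ⊕ Fin m))
      = gaussDetMoment m * gaussDetMoment m := by
  have c0 : Continuous fun M : Fin m → Fin m → ℝ => Matrix.det (Matrix.of M) :=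
    Continuous.matrix_det (by fun_prop)
  have hd : Measurable fun M : Fin m → Fin m → ℝ => ENNReal.ofReal |Matrix.det (Matrix.of M)| :=
    c0.measurable.abs.ennreal_ofReal
  have hT : gaussDetMoment m = ∫⁻ M : Fin m → Fin m → ℝ,
      ENNReal.ofReal |Matrix.det (Matrix.of M)|
      ∂(Measure.pi fun _ : Fin m => Measure.pi fun _ : Fin m => gaussianReal 0 1) := by
    have hm : Measurable fun Ξ : Fin m → EuclideanSpace ℝ (Fin m) =>
        ENNReal.ofReal |detSystem Ξ fun j => EuclideanSpace.single j (1 : ℝ)| :=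
      (measurable_detSystem measurable_id measurable_const).abs.ennreal_ofReal
    rw [gaussDetMoment, ← measurePreserving_toLp_pi.lintegral_comp hm]
    refine lintegral_congr fun M => ?_
    rw [detSystem]
    congr 3
    ext ℓ j
    simp [EuclideanSpace.inner_single_right]
  have hm : ∀ f : Fin m → Fin m ⊕ Fin m,
      Measurable fun Ξ : Fin m → EuclideanSpace ℝ (Fin m ⊕ Fin m) =>
        ENNReal.ofReal |detSystem Ξ fun j => EuclideanSpace.single (f j) (1 : ℝ)| := fun f =>
      (measurable_detSystem measurable_id measurable_const).abs.ennreal_ofReal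
  have hm2 : Measurable fun Ξ : Fin m → EuclideanSpace ℝ (Fin m ⊕ Fin m) =>
        ENNReal.ofReal |detSystem Ξ fun j => EuclideanSpace.single (Sum.inl j) (1 : ℝ)| *
        ENNReal.ofReal |detSystem Ξ fun j => EuclideanSpace.single (Sum.inr j) (1 : ℝ)| :=
    (hm Sum.inl).mul (hm Sum.inr)
  have hd2 : Measurable fun z : (Fin m → Fin m → ℝ) × (Fin m → Fin m → ℝ) =>
      ENNReal.ofReal |Matrix.det (Matrix.of z.1)| * ENNReal.ofReal |Matrix.det (Matrix.of z.2)| :=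
    (hd.comp measurable_fst).mul (hd.comp measurable_snd)
  rw [← measurePreserving_toLp_pi.lintegral_comp hm2, hT,
    ← lintegral_prod_mul hd.aemeasurable hd.aemeasurable,
    ← measurePreserving_sum_split.lintegral_comp hd2]
  refine lintegral_congr fun M => ?_
  have h : ∀ f : Fin m → Fin m ⊕ Fin m,
      (detSystem (fun ℓ => WithLp.toLp 2 (M ℓ)) fun j => EuclideanSpace.single (f j) (1 : ℝ))
        = Matrix.det (Matrix.of fun ℓ j => M ℓ (f j)) := fun f => by
    rw [detSystem]; congr 1
    ext ℓ j
    simp [EuclideanSpace.inner_single_right]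
  simp only [h]

lemma pairDetMoment_sqrt_half :
    pairDetMoment m (fun _ => √(1 / 2)) (fun _ => √(1 / 2))
      = gaussDetMoment m * gaussDetMoment m := by
  have hs : √(1 / 2 : ℝ) * √(1 / 2) = 1 / 2 := Real.mul_self_sqrt (by norm_num)
  rw [pairDetMoment, ← lintegral_abs_detSystem_mul_independent]
  refine lintegral_detSystem_mul_congr _ _ _ _ ?_ ?_ ?_ <;> intro j k <;>
    simp only [inner_pairCol, EuclideanSpace.inner_single_left, PiLp.single_apply, Sum.inl.injEq,
      Sum.inr.injEq, Pi.neg_apply, mul_neg, neg_mul, neg_neg, hs] <;>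
    by_cases h : j = k <;> simp [h] <;> norm_num

lemma gaussDetMoment_ne_top : gaussDetMoment m ≠ ⊤ := by
  intro h
  have h1 := pairDetMoment_ne_top (m := m) (fun _ => √(1 / 2)) (fun _ => √(1 / 2))
  rw [pairDetMoment_sqrt_half, h] at h1
  exact h1 ENNReal.top_mul_top

lemma gaussDetMoment_ne_zero : gaussDetMoment m ≠ 0 := by
  intro h
  have hm : Measurable fun Ξ : Fin m → EuclideanSpace ℝ (Fin m) =>
      detSystem Ξ fun j => EuclideanSpace.single j (1 : ℝ) :=
    measurable_detSystem measurable_id measurable_const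
  have hc : Continuous fun Ξ : Fin m → EuclideanSpace ℝ (Fin m) =>
      detSystem Ξ fun j => EuclideanSpace.single j (1 : ℝ) :=
    Continuous.matrix_det (by fun_prop)
  have hsf : SigmaFinite (volume.withDensity
      (stdGaussianDensity (H := EuclideanSpace ℝ (Fin m)))) := by
    rw [← stdGaussian_eq_withDensity]; infer_instance
  have hden : Measurable fun Ξ : Fin m → EuclideanSpace ℝ (Fin m) =>
      ∏ i, stdGaussianDensity (Ξ i) :=
    Finset.measurable_prod _ fun i _ =>
      measurable_stdGaussianDensity.comp (measurable_pi_apply i)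
  rw [gaussDetMoment, gaussianSystem, stdGaussian_eq_withDensity,
    pi_withDensity _ measurable_stdGaussianDensity,
    lintegral_withDensity_eq_lintegral_mul _ hden hm.abs.ennreal_ofReal,
    lintegral_eq_zero_iff (hden.mul hm.abs.ennreal_ofReal)] at h
  have h2 : (fun Ξ : Fin m → EuclideanSpace ℝ (Fin m) =>
      detSystem Ξ fun j => EuclideanSpace.single j (1 : ℝ)) =ᵐ[volume] fun _ => 0 := by
    filter_upwards [h] with Ξ hΞ
    rcases mul_eq_zero.1 hΞ with hi | hΞ
    · obtain ⟨i, -, hi⟩ := Finset.prod_eq_zero_iff.1 hi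
      rw [stdGaussianDensity, ENNReal.ofReal_eq_zero] at hi
      exact absurd hi (not_le.2 (by positivity))
    · exact abs_eq_zero.1 (le_antisymm (ENNReal.ofReal_eq_zero.1 hΞ) (abs_nonneg _))
  have h3 := congrFun ((Continuous.ae_eq_iff_eq volume hc continuous_const).1 h2)
    fun ℓ => EuclideanSpace.single ℓ (1 : ℝ)
  have h4 : (Matrix.of fun ℓ j : Fin m => (inner ℝ (EuclideanSpace.single ℓ (1 : ℝ))
      (EuclideanSpace.single j (1 : ℝ)) : ℝ)) = 1 := by
    ext ℓ j
    simp [EuclideanSpace.inner_single_left, PiLp.single_apply, Matrix.one_apply]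
  rw [detSystem, h4, Matrix.det_one] at h3
  exact one_ne_zero h3

end Independent

section Feature

/-- The multi-indices of total degree at most `D`. -/
abbrev multiIndex (m D : ℕ) := {j : Fin m → Fin (D + 1) // (∑ k, (j k : ℕ)) ≤ D}

/-- The multinomial coefficient of the multi-index `(D - |j|, j)`. -/
noncomputable def multiWeight {m D : ℕ} (j : multiIndex m D) : ℝ :=
  (D ! : ℝ) / ((∏ k, ((j.1 k : ℕ))! : ℕ) * ((D - ∑ k, (j.1 k : ℕ))! : ℕ))

/-- The homogeneous monomial of the multi-index `(D - |j|, j)`. -/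
noncomputable def multiMonomial {m D : ℕ} (j : multiIndex m D)
    (x : EuclideanSpace ℝ (Fin (m + 1))) : ℝ :=
  x 0 ^ (D - ∑ k, (j.1 k : ℕ)) * ∏ k : Fin m, x k.succ ^ (j.1 k : ℕ)

/-- The feature map of the kernel `⟪x, y⟫ ^ D`. -/
noncomputable def powerFeature (m D : ℕ) (x : EuclideanSpace ℝ (Fin (m + 1))) :
    EuclideanSpace ℝ (multiIndex m D) :=
  WithLp.toLp 2 fun j => √(multiWeight j) * multiMonomial j x

lemma multiWeight_nonneg {m D : ℕ} (j : multiIndex m D) : 0 ≤ multiWeight j := by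
  rw [multiWeight]; positivity

lemma multiWeight_eq_multinomial {m D : ℕ} (j : multiIndex m D) :
    multiWeight j = Nat.multinomial Finset.univ
      (Fin.cons (D - ∑ k, (j.1 k : ℕ)) (fun k => (j.1 k : ℕ)) : Fin (m + 1) → ℕ) := by
  have h := Nat.multinomial_spec Finset.univ
    (Fin.cons (D - ∑ k, (j.1 k : ℕ)) (fun k => (j.1 k : ℕ)) : Fin (m + 1) → ℕ)
  rw [Fin.sum_univ_succ, Fin.prod_univ_succ] at h
  simp only [Fin.cons_zero, Fin.cons_succ] at h
  rw [Nat.sub_add_cancel j.2] at h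
  rw [multiWeight, div_eq_iff (by positivity), ← h]
  push_cast
  ring

lemma inner_powerFeature {m D : ℕ} (x y : EuclideanSpace ℝ (Fin (m + 1))) :
    (inner ℝ (powerFeature m D x) (powerFeature m D y) : ℝ) = (inner ℝ x y : ℝ) ^ D := by
  have h0 : (inner ℝ x y : ℝ) = ∑ i, x i * y i := by
    rw [PiLp.inner_apply]; simp [mul_comm]
  rw [h0, Finset.sum_pow_eq_sum_piAntidiag, PiLp.inner_apply]
  refine Finset.sum_bij'
    (i := fun (j : multiIndex m D) _ =>
      (Fin.cons (D - ∑ k, (j.1 k : ℕ)) (fun k => (j.1 k : ℕ)) : Fin (m + 1) → ℕ))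
    (j := fun k hk => ⟨fun i => ⟨k i.succ, ?_⟩, ?_⟩) ?_ ?_ ?_ ?_ ?_
  · rw [Finset.mem_piAntidiag, Fin.sum_univ_succ] at hk
    have := Finset.single_le_sum (f := fun i : Fin m => k i.succ) (fun _ _ => Nat.zero_le _)
      (Finset.mem_univ i)
    have h2 : k i.succ ≤ ∑ i : Fin m, k i.succ := this
    omega
  · rw [Finset.mem_piAntidiag, Fin.sum_univ_succ] at hk
    simp only
    omega
  · intro j _
    rw [Finset.mem_piAntidiag, Fin.sum_univ_succ]
    simp only [Fin.cons_zero, Fin.cons_succ]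
    exact ⟨Nat.sub_add_cancel j.2, fun _ _ => Finset.mem_univ _⟩
  · intro _ _; exact Finset.mem_univ _
  · intro j _
    ext i
    simp
  · intro k hk
    rw [Finset.mem_piAntidiag, Fin.sum_univ_succ] at hk
    ext i
    refine Fin.cases ?_ (fun i => ?_) i
    · simp only [Fin.cons_zero]; omega
    · simp
  · intro j _
    simp only [powerFeature]
    rw [← multiWeight_eq_multinomial, Fin.prod_univ_succ]
    simp only [Fin.cons_zero, Fin.cons_succ, RCLike.inner_apply, conj_trivial, multiMonomial]
    have hs := Real.mul_self_sqrt (multiWeight_nonneg j)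
    simp only [mul_pow, Finset.prod_mul_distrib]
    linear_combination (x.ofLp 0 ^ (D - ∑ k, (j.1 k : ℕ)) * (∏ k : Fin m, x.ofLp k.succ ^ (j.1 k : ℕ)) *
      (y.ofLp 0 ^ (D - ∑ k, (j.1 k : ℕ)) * ∏ k : Fin m, y.ofLp k.succ ^ (j.1 k : ℕ))) * hs

lemma contDiff_powerFeature (m D : ℕ) : ContDiff ℝ 1 (powerFeature m D) := by
  refine contDiff_euclidean.2 fun j => ?_
  simp only [powerFeature, multiMonomial]
  have hi : ∀ i, ContDiff ℝ 1 fun x : EuclideanSpace ℝ (Fin (m + 1)) => x.ofLp i := fun i =>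
    contDiff_euclidean.1 contDiff_id i
  exact contDiff_const.mul (((hi 0).pow _).mul (contDiff_prod fun k _ => (hi k.succ).pow _))

lemma isPowerFeature_powerFeature (m d : ℕ) :
    IsPowerFeature d (powerFeature m (d + 2)) (fderiv ℝ (powerFeature m (d + 2))) where
  hasFDerivAt x := ((contDiff_powerFeature m (d + 2)).differentiable (by simp) x).hasFDerivAt
  continuous_fderiv := (contDiff_powerFeature m (d + 2)).continuous_fderiv (by simp)
  inner_eq x y := inner_powerFeature x y

end Feature

section KernelBounds

variable {n d : ℕ} {c u : ℝ}

lemma abs_colCov_le (n d : ℕ) {c : ℝ} (h0 : 0 < c) (h1 : c < 1) (j : Fin (n + 1)) :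
    |colCov n d c j| ≤ colVar n d c j := by
  have hv : 0 < (c ^ 2)⁻¹ - 1 := by
    rw [sub_pos]; exact (one_lt_inv₀ (by positivity)).2 (by nlinarith)
  set s : Fin (n + 1) → ℝ := Pi.single 0 √((c ^ 2)⁻¹ - 1) with hs
  have hne : s ≠ 0 := fun h => by
    have := congrFun h 0
    simp only [hs, Pi.single_eq_same, Pi.zero_apply] at this
    exact absurd this (Real.sqrt_pos.2 hv).ne'
  have hn : ‖affineLift s‖ ^ 2 = (c⁻¹) ^ 2 := by
    rw [norm_affineLift_sq, Fin.sum_univ_succ, hs]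
    simp [Real.sq_sqrt hv.le]
  have hn' : ‖affineLift s‖ = c⁻¹ :=
    (pow_left_inj₀ (norm_nonneg _) (by positivity) two_ne_zero).1 hn
  have hz : ‖affineLift (0 : Fin (n + 1) → ℝ)‖ = 1 := by
    have := norm_affineLift_sq (0 : Fin (n + 1) → ℝ)
    simp only [Pi.zero_apply, ne_eq, OfNat.ofNat_ne_zero, not_false_eq_true, zero_pow,
      Finset.sum_const_zero, add_zero] at this
    exact (pow_eq_one_iff_of_nonneg (norm_nonneg _) two_ne_zero).1 this
  have hc : cosLift 0 s = c := by
    rw [cosLift, hz, hn', one_mul, PiLp.inner_apply, Fin.sum_univ_succ]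
    simp
  have := (isPowerFeature_powerFeature (n + 1) d).abs_colCov_le hne j
  rwa [hc] at this

lemma tangentVar_eq (hc : c ^ 2 * (1 + u / (d + 2)) = 1) :
    tangentVar d c = 1 - u * c ^ (2 * d + 4) / (1 - c ^ (2 * d + 4)) := by
  have hD : (0 : ℝ) < d + 2 := by positivity
  have h1 : (d + 2) * (1 - c ^ 2) = u * c ^ 2 := by
    field_simp at hc
    linear_combination -hc
  rw [tangentVar]
  congr 2
  linear_combination c ^ (2 * d + 2) * h1

lemma tangentCov_eq (hc : c ^ 2 * (1 + u / (d + 2)) = 1) :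
    tangentCov d c = c ^ (d + 2) * (1 - (d + 1) / (d + 2) * u
      - u * c ^ (2 * d + 4) / (1 - c ^ (2 * d + 4))) := by
  have hD : (0 : ℝ) < d + 2 := by positivity
  have h1 : (d + 2) * (1 - c ^ 2) = u * c ^ 2 := by
    field_simp at hc
    linear_combination -hc
  have h2 : (d + 1) * c ^ d * (1 - c ^ 2) = c ^ (d + 2) * ((d + 1) / (d + 2) * u) := by
    have ha : ((d : ℝ) + 1) / (d + 2) * (d + 2) = d + 1 := div_mul_cancel₀ _ hD.ne'
    linear_combination (-(c ^ d * (1 - c ^ 2))) * ha + (d + 1) / (d + 2) * c ^ d * h1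
  have h3 : (d + 2) * c ^ (3 * d + 4) * (1 - c ^ 2)
      = c ^ (d + 2) * (u * c ^ (2 * d + 4)) := by
    linear_combination c ^ (3 * d + 4) * h1
  rw [tangentCov, h2, h3]
  ring

lemma pow_mul_one_add_div (hc : c ^ 2 * (1 + u / (d + 2)) = 1) :
    c ^ (2 * d + 4) * (1 + u / (d + 2)) ^ (d + 2) = 1 := by
  rw [show 2 * d + 4 = 2 * (d + 2) by ring, pow_mul, ← mul_pow, hc, one_pow]

lemma pow_mul_one_add_le (hu : 0 ≤ u) (hc : c ^ 2 * (1 + u / (d + 2)) = 1) :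
    c ^ (2 * d + 4) * (1 + u) ≤ 1 := by
  have hD : (0 : ℝ) < d + 2 := by positivity
  refine le_of_le_of_eq ?_ (pow_mul_one_add_div hc)
  refine mul_le_mul_of_nonneg_left ?_ (Even.pow_nonneg ⟨d + 2, by ring⟩ c)
  have h := one_add_mul_le_pow (a := u / (d + 2)) (by
    have : 0 ≤ u / (d + 2) := by positivity
    linarith) (d + 2)
  refine le_trans (le_of_eq ?_) h
  push_cast; field_simp

lemma one_sub_le_pow (hu : 0 ≤ u) (hc : c ^ 2 * (1 + u / (d + 2)) = 1) :
    1 - u ≤ c ^ (2 * d + 4) := by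
  have hD : (0 : ℝ) < d + 2 := by positivity
  have h1 : (1 + u / (d + 2)) ^ (d + 2) ≤ Real.exp u := by
    calc (1 + u / (d + 2)) ^ (d + 2) ≤ Real.exp (u / (d + 2)) ^ (d + 2) := by
          gcongr
          linarith [Real.add_one_le_exp (u / (d + 2))]
      _ = Real.exp u := by rw [← Real.exp_nat_mul]; congr 1; push_cast; field_simp
  have h2 := pow_mul_one_add_div hc
  have hq : 0 ≤ c ^ (2 * d + 4) := Even.pow_nonneg ⟨d + 2, by ring⟩ c
  have h3 : 1 ≤ c ^ (2 * d + 4) * Real.exp u := by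
    rw [← h2]; exact mul_le_mul_of_nonneg_left h1 hq
  have h4 := Real.add_one_le_exp (-u)
  have h5 : Real.exp (-u) * Real.exp u = 1 := by rw [← Real.exp_add]; simp
  have h6 : Real.exp (-u) ≤ c ^ (2 * d + 4) := by
    have := Real.exp_pos u
    by_contra! h
    nlinarith
  linarith

lemma lt_one_of_mul_eq (hu : 0 < u) (hc : c ^ 2 * (1 + u / (d + 2)) = 1) :
    c < 1 := by
  have hD : (0 : ℝ) < u / (d + 2) := by positivity
  by_contra! h
  have h2 : 1 ≤ c ^ 2 := one_le_pow₀ h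
  nlinarith

lemma colVar_le_one (hu : 0 < u) (h0 : 0 < c) (hc : c ^ 2 * (1 + u / (d + 2)) = 1)
    (j : Fin (n + 1)) : colVar n d c j ≤ 1 := by
  rw [colVar]
  split_ifs
  · rw [tangentVar_eq hc, sub_le_self_iff]
    have h1 := pow_mul_one_add_le hu.le hc
    have hq : 0 < c ^ (2 * d + 4) := by positivity
    have : 0 < 1 - c ^ (2 * d + 4) := by nlinarith
    positivity
  · exact le_rfl

lemma colPlus_sq_add_colMinus_sq' (hu : 0 < u) (h0 : 0 < c)
    (hc : c ^ 2 * (1 + u / (d + 2)) = 1) (j : Fin (n + 1)) :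
    colPlus n d c j ^ 2 + colMinus n d c j ^ 2 = colVar n d c j := by
  rw [sq, sq]
  exact (colPlus_sq_add_colMinus_sq (abs_colCov_le n d h0 (lt_one_of_mul_eq hu hc) j)).1

lemma toReal_pairKernel (n d : ℕ) (c : ℝ) : (pairKernel n d c).toReal
    = (√(1 - c ^ (2 * d + 4)))⁻¹ ^ (n + 1) *
      (pairDetMoment (n + 1) (colPlus n d c) (colMinus n d c)).toReal := by
  rw [pairKernel, ENNReal.toReal_mul, ENNReal.toReal_ofReal (by positivity)]

lemma pairKernel_ne_top (n d : ℕ) (c : ℝ) : pairKernel n d c ≠ ⊤ :=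
  ENNReal.mul_ne_top ENNReal.ofReal_ne_top (pairDetMoment_ne_top _ _)

/-- The constant of the determinant bounds for the kernel. -/
noncomputable def kernelConst (n : ℕ) : ℝ :=
  2 * (n + 1 : ℕ) * ((n + 1)! : ℝ) ^ 2 * pairMomentConst (n + 1)

lemma kernelConst_nonneg (n : ℕ) : 0 ≤ kernelConst n := by
  have := pairMomentConst_nonneg (m := n + 1)
  rw [kernelConst]; positivity

lemma toReal_pairDetMoment_le_kernelConst (p q : Fin (n + 1) → ℝ) :
    (pairDetMoment (n + 1) p q).toReal ≤ kernelConst n * ∏ j, (p j ^ 2 + q j ^ 2) := by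
  refine (toReal_pairDetMoment_le p q).trans ?_
  have h0 : 0 ≤ ∏ j, (p j ^ 2 + q j ^ 2) := Finset.prod_nonneg fun _ _ => by positivity
  refine mul_le_mul_of_nonneg_right ?_ h0
  have := pairMomentConst_nonneg (m := n + 1)
  rw [kernelConst, mul_assoc (2 * _)]
  refine le_mul_of_one_le_left (by positivity) ?_
  push_cast
  have : (0 : ℝ) ≤ n := by positivity
  linarith

lemma toReal_pairKernel_le_near (hu : 0 < u) (hu1 : u ≤ 1) (h0 : 0 < c)
    (hc : c ^ 2 * (1 + u / (d + 2)) = 1) :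
    (pairKernel n d c).toReal ≤ 2 * kernelConst n * √2 ^ (n + 1) * (√u ^ n)⁻¹ := by
  set q := c ^ (2 * d + 4) with hq
  have hq0 : 0 < q := by positivity
  have h1 : q * (1 + u) ≤ 1 := pow_mul_one_add_le hu.le hc
  have h2 : 1 - u ≤ q := one_sub_le_pow hu.le hc
  have h3 : u / 2 ≤ 1 - q := by nlinarith
  have hK := kernelConst_nonneg n
  have hv : tangentVar d c ≤ 2 * u := by
    rw [tangentVar_eq hc, ← hq]
    have h4 : 0 < 1 - q := by linarith
    rw [sub_le_iff_le_add, ← sub_le_iff_le_add', le_div_iff₀ h4]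
    nlinarith
  have hF : (pairDetMoment (n + 1) (colPlus n d c) (colMinus n d c)).toReal
      ≤ kernelConst n * (2 * u) := by
    refine (toReal_pairDetMoment_le_kernelConst _ _).trans (mul_le_mul_of_nonneg_left ?_ hK)
    simp_rw [colPlus_sq_add_colMinus_sq' hu h0 hc]
    rw [Fin.prod_univ_succ]
    simpa [colVar] using hv
  have hs : (√(1 - q))⁻¹ ≤ √2 * (√u)⁻¹ := by
    rw [← Real.sqrt_inv u, ← Real.sqrt_mul zero_le_two, ← Real.sqrt_inv]
    refine Real.sqrt_le_sqrt ?_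
    calc (1 - q)⁻¹ ≤ (u / 2)⁻¹ := by gcongr
      _ = 2 * u⁻¹ := by field_simp
  rw [toReal_pairKernel, ← hq]
  have hsu : 0 < √u := Real.sqrt_pos.2 hu
  calc _ ≤ (√2 * (√u)⁻¹) ^ (n + 1) * (kernelConst n * (2 * u)) := by gcongr
    _ = 2 * kernelConst n * √2 ^ (n + 1) * (√u ^ n)⁻¹ * √u := by
        have hss := Real.mul_self_sqrt hu.le
        have hsi : √u * (√u)⁻¹ = 1 := mul_inv_cancel₀ hsu.ne'
        rw [mul_pow, ← inv_pow, pow_succ (√u)⁻¹]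
        linear_combination (-(2 * kernelConst n * √2 ^ (n + 1) * (√u)⁻¹ ^ n * (√u)⁻¹)) * hss
          + 2 * kernelConst n * √2 ^ (n + 1) * (√u)⁻¹ ^ n * √u * hsi
    _ ≤ _ := mul_le_of_le_one_right (by positivity) (Real.sqrt_le_one.2 hu1)

lemma abs_sqrt_half_sub_le (x : ℝ) (hx : 0 ≤ x) : |√x - √(1 / 2)| ≤ 2 * |x - 1 / 2| := by
  have h1 : (1 : ℝ) / 2 ≤ √(1 / 2) := by
    refine Real.le_sqrt_of_sq_le ?_; norm_num
  have h2 : x - 1 / 2 = (√x - √(1 / 2)) * (√x + √(1 / 2)) := by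
    have a := Real.mul_self_sqrt hx
    have b := Real.mul_self_sqrt (show (0 : ℝ) ≤ 1 / 2 by norm_num)
    linear_combination -a + b
  have h3 := Real.sqrt_nonneg x
  rw [h2, abs_mul, abs_of_nonneg (by linarith : 0 ≤ √x + √(1 / 2))]
  nlinarith [abs_nonneg (√x - √(1 / 2))]

lemma abs_pow_inv_sqrt_sub_one_le {q : ℝ} (h0 : 0 ≤ q) (h1 : q ≤ 1 / 2) (k : ℕ) :
    |(√(1 - q))⁻¹ ^ k - 1| ≤ k * 2 ^ k * (2 * q) := by
  set v := (√(1 - q))⁻¹ with hv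
  have hs0 : 0 < √(1 - q) := Real.sqrt_pos.2 (by linarith)
  have hs1 : √(1 - q) ≤ 1 := Real.sqrt_le_one.2 (by linarith)
  have hss : √(1 - q) * √(1 - q) = 1 - q := Real.mul_self_sqrt (by linarith)
  have hs2 : 1 - q ≤ √(1 - q) := by nlinarith
  have hv1 : 1 ≤ v := (one_le_inv₀ hs0).2 hs1
  have hvq : v ≤ 1 + 2 * q := by
    rw [hv, inv_le_comm₀ hs0 (by linarith)]
    refine le_trans ?_ hs2
    rw [inv_le_iff_one_le_mul₀ (by linarith)]
    nlinarith
  have hv2 : v ≤ 2 := by linarith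
  rw [abs_of_nonneg (by linarith [one_le_pow₀ hv1 (n := k)])]
  have key : ∀ k : ℕ, v ^ k - 1 ≤ k * 2 ^ k * (2 * q) := fun k => by
    induction k with
    | zero => simp
    | succ k ih =>
      have e : v ^ (k + 1) - 1 = v * (v ^ k - 1) + (v - 1) := by ring
      have h2k : (1 : ℝ) ≤ 2 ^ k := one_le_pow₀ one_le_two
      have hk : 0 ≤ v ^ k - 1 := by linarith [one_le_pow₀ hv1 (n := k)]
      have hX : 0 ≤ (k : ℝ) * 2 ^ k * (2 * q) := by positivity
      rw [e]
      calc _ ≤ 2 * (k * 2 ^ k * (2 * q)) + (2 ^ (k + 1)) * (2 * q) := by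
            refine add_le_add (mul_le_mul hv2 ih hk (by norm_num)) ?_
            rw [pow_succ]
            nlinarith
        _ = _ := by push_cast; ring
  exact key k

lemma abs_toReal_pairKernel_sub_le_far (hu : 1 ≤ u) (h0 : 0 < c)
    (hc : c ^ 2 * (1 + u / (d + 2)) = 1) :
    |(pairKernel n d c).toReal - (gaussDetMoment (n + 1) * gaussDetMoment (n + 1)).toReal|
      ≤ (2 * kernelConst n * (n + 1) * 2 ^ (n + 1) + 12 * kernelConst n * (n + 1)) *
        ((1 + u) * c ^ (d + 2)) := by
  have hu0 : 0 < u := by linarith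
  have hc1 := lt_one_of_mul_eq hu0 hc
  set E := c ^ (d + 2) with hE
  set q := c ^ (2 * d + 4) with hq
  have hEq : q = E * E := by rw [hq, hE]; ring
  have hE0 : 0 < E := by positivity
  have hE1 : E ≤ 1 := pow_le_one₀ h0.le hc1.le
  have hq0 : 0 < q := by positivity
  have h1 : q * (1 + u) ≤ 1 := pow_mul_one_add_le hu0.le hc
  have hq2 : q ≤ 1 / 2 := by nlinarith
  have hqE : q ≤ E := by nlinarith
  have hK := kernelConst_nonneg n
  have hw : u * q / (1 - q) ≤ 2 * u * E := by
    rw [div_le_iff₀ (by linarith)]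
    nlinarith [mul_pos hu0 hE0, mul_pos hu0 hq0]
  have hw0 : 0 ≤ u * q / (1 - q) := by
    have : 0 < 1 - q := by linarith
    positivity
  have hw1 : u * q / (1 - q) ≤ 1 := by
    rw [div_le_one (by linarith)]; nlinarith
  have hle := fun j => abs_colCov_le n d h0 hc1 j
  have hvar : ∀ j : Fin (n + 1), |colVar n d c j - 1| ≤ 2 * (1 + u) * E := fun j => by
    rw [colVar]
    split_ifs
    · rw [tangentVar_eq hc, ← hq, sub_sub_cancel_left, abs_neg, abs_of_nonneg hw0]
      nlinarith
    · simp; positivity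
  have hcov : ∀ j : Fin (n + 1), |colCov n d c j| ≤ 3 * (1 + u) * E := fun j => by
    rw [colCov]
    split_ifs
    · rw [tangentCov_eq hc, ← hq, ← hE, abs_mul, abs_of_pos hE0, mul_comm]
      refine mul_le_mul_of_nonneg_right ?_ hE0.le
      have hD : (0 : ℝ) < d + 2 := by positivity
      have a1 : ((d : ℝ) + 1) / (d + 2) ≤ 1 := by rw [div_le_one hD]; linarith
      have a2 : 0 ≤ ((d : ℝ) + 1) / (d + 2) := by positivity
      rw [abs_le]
      constructor <;> nlinarith
    · rw [abs_of_pos (by positivity)]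
      have hD : (0 : ℝ) < d + 2 := by positivity
      have a1 : u / (d + 2) ≤ u := div_le_self hu0.le (by linarith)
      have a2 : c ^ (d + 1) = E * (c * (1 + u / (d + 2))) := by
        rw [hE]; linear_combination (- c ^ (d + 1)) * hc
      have a3 : c * (1 + u / (d + 2)) ≤ 1 + u := by
        have : 0 < u / (d + 2) := by positivity
        nlinarith
      rw [a2]
      nlinarith [mul_le_mul_of_nonneg_left a3 hE0.le, mul_pos hE0 (by linarith : 0 < 1 + u)]
  have hsq : ∀ j : Fin (n + 1), colPlus n d c j ^ 2 + colMinus n d c j ^ 2 ≤ 1 := fun j => by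
    rw [colPlus_sq_add_colMinus_sq' hu0 h0 hc]; exact colVar_le_one hu0 h0 hc j
  have hF : |(pairDetMoment (n + 1) (colPlus n d c) (colMinus n d c)).toReal
      - (gaussDetMoment (n + 1) * gaussDetMoment (n + 1)).toReal|
      ≤ 12 * kernelConst n * (n + 1) * ((1 + u) * E) := by
    rw [← pairDetMoment_sqrt_half]
    refine (abs_toReal_pairDetMoment_sub_le _ _ _ _ hsq fun j => ?_).trans ?_
    · rw [Real.sq_sqrt (by norm_num)]; norm_num
    · have hj : ∀ j : Fin (n + 1), |colPlus n d c j - √(1 / 2)| + |colMinus n d c j - √(1 / 2)|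
          ≤ 12 * ((1 + u) * E) := fun j => by
        obtain ⟨b1, b2⟩ := abs_le.1 (hle j)
        obtain ⟨b3, b4⟩ := abs_le.1 (hvar j)
        obtain ⟨b5, b6⟩ := abs_le.1 (hcov j)
        have e1 := abs_sqrt_half_sub_le ((colVar n d c j + colCov n d c j) / 2) (by linarith)
        have e2 := abs_sqrt_half_sub_le ((colVar n d c j - colCov n d c j) / 2) (by linarith)
        have e3 : |(colVar n d c j + colCov n d c j) / 2 - 1 / 2| ≤ 5 / 2 * ((1 + u) * E) := by
          rw [abs_le]; constructor <;> linarith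
        have e4 : |(colVar n d c j - colCov n d c j) / 2 - 1 / 2| ≤ 5 / 2 * ((1 + u) * E) := by
          rw [abs_le]; constructor <;> linarith
        have e5 : 0 ≤ (1 + u) * E := by positivity
        rw [colPlus, colMinus]
        linarith
      calc _ ≤ kernelConst n * ∑ _j : Fin (n + 1), 12 * ((1 + u) * E) := by
            rw [kernelConst]
            refine mul_le_mul_of_nonneg_left (Finset.sum_le_sum fun j _ => hj j) ?_
            rw [← kernelConst]; exact hK
        _ = _ := by simp; ring
  have hFle : (pairDetMoment (n + 1) (colPlus n d c) (colMinus n d c)).toReal ≤ kernelConst n := by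
    refine (toReal_pairDetMoment_le_kernelConst _ _).trans (mul_le_of_le_one_right hK ?_)
    exact Finset.prod_le_one (fun _ _ => by positivity) fun j _ => hsq j
  have hF0 : 0 ≤ (pairDetMoment (n + 1) (colPlus n d c) (colMinus n d c)).toReal :=
    ENNReal.toReal_nonneg
  have hpre := abs_pow_inv_sqrt_sub_one_le hq0.le hq2 (n + 1)
  rw [toReal_pairKernel, ← hq]
  set F := (pairDetMoment (n + 1) (colPlus n d c) (colMinus n d c)).toReal
  set T := (gaussDetMoment (n + 1) * gaussDetMoment (n + 1)).toReal
  set A := (√(1 - q))⁻¹ ^ (n + 1)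
  have e : A * F - T = (A - 1) * F + (F - T) := by ring
  rw [e]
  refine (abs_add_le _ _).trans ?_
  rw [add_mul, abs_mul, abs_of_nonneg hF0]
  refine add_le_add ?_ hF
  have hqu : q ≤ (1 + u) * E := by nlinarith
  calc |A - 1| * F ≤ ((n + 1 : ℕ) * 2 ^ (n + 1) * (2 * q)) * kernelConst n :=
        mul_le_mul hpre hFle hF0 (by positivity)
    _ ≤ ((n + 1 : ℕ) * 2 ^ (n + 1) * (2 * ((1 + u) * E))) * kernelConst n := by gcongr
    _ = _ := by push_cast; ring

end KernelBounds

section PointwiseLimit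

variable {u : ℝ}

/-- Cosine of the angle at rescaled squared distance `u`. -/
noncomputable def scaledCos (d : ℕ) (u : ℝ) : ℝ := (√(1 + u / (d + 2)))⁻¹

lemma scaledCos_pos (hu : 0 ≤ u) (d : ℕ) : 0 < scaledCos d u := by
  rw [scaledCos]; positivity

lemma scaledCos_sq_mul (hu : 0 ≤ u) (d : ℕ) : scaledCos d u ^ 2 * (1 + u / (d + 2)) = 1 := by
  have h : 0 < 1 + u / (d + 2 : ℝ) := by positivity
  rw [scaledCos, inv_pow, Real.sq_sqrt h.le, inv_mul_cancel₀ h.ne']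

lemma tendsto_one_add_div_pow_add_two (u : ℝ) :
    Tendsto (fun d : ℕ => (1 + u / ((d : ℝ) + 2)) ^ (d + 2)) atTop (nhds (Real.exp u)) := by
  have h := (tendsto_add_atTop_iff_nat 2).2 (Real.tendsto_one_add_div_pow_exp u)
  refine h.congr fun d => ?_
  push_cast; rfl

lemma tendsto_div_add_two (u : ℝ) :
    Tendsto (fun d : ℕ => u / ((d : ℝ) + 2)) atTop (nhds 0) :=
  tendsto_const_nhds.div_atTop
    (tendsto_atTop_add_const_right _ _ tendsto_natCast_atTop_atTop)

lemma tendsto_scaledCos (u : ℝ) : Tendsto (fun d => scaledCos d u) atTop (nhds 1) := by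
  have h := ((tendsto_div_add_two u).const_add 1).sqrt.inv₀ (by simp)
  simpa [scaledCos] using h

lemma tendsto_scaledCos_pow_two_mul (hu : 0 ≤ u) :
    Tendsto (fun d => scaledCos d u ^ (2 * d + 4)) atTop (nhds (Real.exp u)⁻¹) := by
  refine ((tendsto_one_add_div_pow_add_two u).inv₀ (Real.exp_pos u).ne').congr fun d => ?_
  exact (eq_inv_of_mul_eq_one_left (pow_mul_one_add_div (scaledCos_sq_mul hu d))).symm

lemma tendsto_scaledCos_pow (hu : 0 ≤ u) :
    Tendsto (fun d => scaledCos d u ^ (d + 2)) atTop (nhds √(Real.exp u)⁻¹) := by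
  refine (tendsto_scaledCos_pow_two_mul hu).sqrt.congr fun d => ?_
  rw [show 2 * d + 4 = (d + 2) * 2 by ring, pow_mul, Real.sqrt_sq]
  exact pow_nonneg (scaledCos_pos hu d).le _

lemma tendsto_scaledCos_pow' (hu : 0 ≤ u) :
    Tendsto (fun d => scaledCos d u ^ (d + 1)) atTop (nhds √(Real.exp u)⁻¹) := by
  have h := (tendsto_scaledCos_pow hu).mul ((tendsto_scaledCos u).inv₀ one_ne_zero)
  rw [inv_one, mul_one] at h
  refine h.congr fun d => ?_
  have := (scaledCos_pos hu d).ne'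
  rw [pow_succ, mul_assoc, mul_inv_cancel₀ this, mul_one]

lemma exp_inv_lt_one (hu : 0 < u) : (Real.exp u)⁻¹ < 1 := by
  rw [← Real.exp_neg, Real.exp_lt_one_iff]; linarith

lemma tendsto_tangent_correction (hu : 0 < u) :
    Tendsto (fun d => u * scaledCos d u ^ (2 * d + 4) / (1 - scaledCos d u ^ (2 * d + 4))) atTop
      (nhds (u * (Real.exp u)⁻¹ / (1 - (Real.exp u)⁻¹))) :=
  ((tendsto_scaledCos_pow_two_mul hu.le).const_mul u).div
    ((tendsto_scaledCos_pow_two_mul hu.le).const_sub 1) (sub_pos.2 (exp_inv_lt_one hu)).ne'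

lemma exists_tendsto_colVar (n : ℕ) (hu : 0 < u) (j : Fin (n + 1)) :
    ∃ v, Tendsto (fun d => colVar n d (scaledCos d u) j) atTop (nhds v) := by
  simp only [colVar]
  split_ifs
  · simp_rw [fun d => tangentVar_eq (scaledCos_sq_mul hu.le d)]
    exact ⟨_, (tendsto_tangent_correction hu).const_sub 1⟩
  · exact ⟨1, tendsto_const_nhds⟩

lemma exists_tendsto_colCov (n : ℕ) (hu : 0 < u) (j : Fin (n + 1)) :
    ∃ v, Tendsto (fun d => colCov n d (scaledCos d u) j) atTop (nhds v) := by
  simp only [colCov]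
  split_ifs
  · simp_rw [fun d => tangentCov_eq (scaledCos_sq_mul hu.le d)]
    have h : Tendsto (fun d : ℕ => ((d : ℝ) + 1) / (d + 2)) atTop (nhds 1) := by
      have := (tendsto_div_add_two 1).const_sub 1
      rw [sub_zero] at this
      refine this.congr fun d => ?_
      have : (d : ℝ) + 2 ≠ 0 := by positivity
      field_simp; ring
    exact ⟨_, (tendsto_scaledCos_pow hu.le).mul
      (((h.mul_const u).const_sub 1).sub (tendsto_tangent_correction hu))⟩
  · exact ⟨_, tendsto_scaledCos_pow' hu.le⟩

lemma tendsto_toReal_pairDetMoment {m : ℕ} {p q : ℕ → Fin m → ℝ} {P Q : Fin m → ℝ}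
    (hp : ∀ j, Tendsto (fun d => p d j) atTop (nhds (P j)))
    (hq : ∀ j, Tendsto (fun d => q d j) atTop (nhds (Q j)))
    (h : ∀ d j, p d j ^ 2 + q d j ^ 2 ≤ 1) :
    Tendsto (fun d => (pairDetMoment m (p d) (q d)).toReal) atTop
      (nhds (pairDetMoment m P Q).toReal) := by
  have h' : ∀ j, P j ^ 2 + Q j ^ 2 ≤ 1 := fun j =>
    le_of_tendsto' (((hp j).pow 2).add ((hq j).pow 2)) fun d => h d j
  rw [tendsto_iff_dist_tendsto_zero]
  have hS : Tendsto (fun d => 2 * (m : ℝ) * (m ! : ℝ) ^ 2 * pairMomentConst m *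
      ∑ j, (|p d j - P j| + |q d j - Q j|)) atTop (nhds 0) := by
    have hS' : Tendsto (fun d => ∑ j, (|p d j - P j| + |q d j - Q j|)) atTop
        (nhds (∑ _j : Fin m, 0)) := by
      refine tendsto_finsetSum _ fun j _ => ?_
      have a := ((hp j).sub_const (P j)).abs
      have b := ((hq j).sub_const (Q j)).abs
      simpa using a.add b
    simpa using hS'.const_mul (2 * (m : ℝ) * (m ! : ℝ) ^ 2 * pairMomentConst m)
  exact squeeze_zero (fun _ => dist_nonneg)
    (fun d => abs_toReal_pairDetMoment_sub_le _ _ _ _ (h d) h') hS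

lemma exists_tendsto_pairKernel (n : ℕ) (hu : 0 < u) :
    ∃ L, Tendsto (fun d => (pairKernel n d (scaledCos d u)).toReal) atTop (nhds L) := by
  choose v hv using exists_tendsto_colVar n hu
  choose w hw using exists_tendsto_colCov n hu
  have hq := ((tendsto_scaledCos_pow_two_mul hu.le).const_sub 1).sqrt.inv₀
    (Real.sqrt_pos.2 (sub_pos.2 (exp_inv_lt_one hu))).ne'
  simp_rw [toReal_pairKernel]
  refine ⟨_, (hq.pow (n + 1)).mul (tendsto_toReal_pairDetMoment
    (P := fun j => √((v j + w j) / 2)) (Q := fun j => √((v j - w j) / 2)) (fun j => ?_)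
    (fun j => ?_) fun d j => ?_)⟩
  · exact (((hv j).add (hw j)).div_const 2).sqrt
  · exact (((hv j).sub (hw j)).div_const 2).sqrt
  · rw [colPlus_sq_add_colMinus_sq' hu (scaledCos_pos hu.le d) (scaledCos_sq_mul hu.le d)]
    exact colVar_le_one hu (scaledCos_pos hu.le d) (scaledCos_sq_mul hu.le d) j

end PointwiseLimit

section Decay

variable {u : ℝ}

lemma one_add_div_pow_le {k D : ℕ} (hk : 1 ≤ k) (hkD : k ≤ D) (hu : 0 ≤ u) :
    (1 + u / k) ^ k ≤ (1 + u / D) ^ D := by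
  have hk0 : (0 : ℝ) < k := by exact_mod_cast hk
  have hD0 : (0 : ℝ) < D := by exact_mod_cast hk.trans hkD
  have h1 : (1 : ℝ) ≤ (D : ℝ) / k := (one_le_div hk0).2 (by exact_mod_cast hkD)
  have h := one_add_mul_self_le_rpow_one_add (s := u / D)
    (by have : 0 ≤ u / D := by positivity
        linarith) h1
  have e : (D : ℝ) / k * (u / D) = u / k := by field_simp
  rw [e] at h
  have h2 := pow_le_pow_left₀ (by positivity) h k
  rwa [← Real.rpow_mul_natCast (by positivity), div_mul_cancel₀ _ hk0.ne', Real.rpow_natCast] at h2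

lemma scaledCos_pow_le {l d : ℕ} (hl : 1 ≤ l) (hd : 2 * l ≤ d + 2) (hu : 0 ≤ u) :
    scaledCos d u ^ (d + 2) * (1 + u) ^ l ≤ (2 * l) ^ l := by
  have hl0 : (1 : ℝ) ≤ l := by exact_mod_cast hl
  have h1 := one_add_div_pow_le (u := u) (k := 2 * l) (D := d + 2) (by omega) hd hu
  push_cast at h1
  have h2 : (1 + u) ≤ (2 * l) * (1 + u / (2 * l)) := by
    have e : 2 * (l : ℝ) * (1 + u / (2 * l)) = 2 * l + u := by field_simp
    rw [e]; linarith
  have h3 := pow_mul_one_add_div (scaledCos_sq_mul hu d)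
  have hc := scaledCos_pos hu d
  refine le_of_sq_le_sq ?_ (by positivity)
  calc (scaledCos d u ^ (d + 2) * (1 + u) ^ l) ^ 2
      = scaledCos d u ^ (2 * d + 4) * (1 + u) ^ (2 * l) := by
        rw [mul_pow, ← pow_mul, ← pow_mul]; congr 2 <;> ring
    _ ≤ scaledCos d u ^ (2 * d + 4) * ((2 * l) * (1 + u / (2 * l))) ^ (2 * l) := by
        gcongr
    _ = scaledCos d u ^ (2 * d + 4) * (1 + u / (2 * l)) ^ (2 * l) * (2 * l) ^ (2 * l) := by
        rw [mul_pow]; ring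
    _ ≤ scaledCos d u ^ (2 * d + 4) * (1 + u / (d + 2)) ^ (d + 2) * (2 * l) ^ (2 * l) := by
        gcongr
    _ = ((2 * l) ^ l) ^ 2 := by rw [h3, one_mul, ← pow_mul]; congr 1; ring

lemma norm_sq_le_sum_sq {m : ℕ} (z : Fin m → ℝ) : ‖z‖ ^ 2 ≤ ∑ j, z j ^ 2 := by
  have h : ‖z‖ ≤ √(∑ j, z j ^ 2) := by
    refine (pi_norm_le_iff_of_nonneg (Real.sqrt_nonneg _)).2 fun j => ?_
    rw [Real.norm_eq_abs]
    exact Real.abs_le_sqrt (Finset.single_le_sum (f := fun j => z j ^ 2)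
      (fun _ _ => sq_nonneg _) (Finset.mem_univ j))
  calc ‖z‖ ^ 2 ≤ √(∑ j, z j ^ 2) ^ 2 := by gcongr
    _ = _ := Real.sq_sqrt (Finset.sum_nonneg fun _ _ => sq_nonneg _)

end Decay

/-- The centred kernel at the scale of the correlation length. -/
noncomputable def scaledKernel (n d : ℕ) (z : Fin (n + 1) → ℝ) : ℝ :=
  chartWeight ((√(d + 2))⁻¹ • z) *
    ((pairKernel n d ‖affineLift ((√(d + 2))⁻¹ • z)‖⁻¹).toReal
      - (gaussDetMoment (n + 1) * gaussDetMoment (n + 1)).toReal)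

lemma norm_affineLift_scaled {m : ℕ} (d : ℕ) (z : Fin m → ℝ) :
    ‖affineLift ((√(d + 2))⁻¹ • z)‖⁻¹ = scaledCos d (∑ j, z j ^ 2) := by
  rw [scaledCos, ← Real.sqrt_sq (norm_nonneg (affineLift _)), norm_affineLift_sq]
  congr 3
  rw [Finset.sum_div]
  refine Finset.sum_congr rfl fun j _ => ?_
  rw [Pi.smul_apply, smul_eq_mul, mul_pow, inv_pow, Real.sq_sqrt (by positivity)]
  ring

lemma chartWeight_le_one {m : ℕ} (t : Fin m → ℝ) : chartWeight t ≤ 1 :=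
  inv_le_one_of_one_le₀ (one_le_pow₀ (one_le_norm_affineLift t))

lemma measurable_chartWeight {m : ℕ} : Measurable (chartWeight (m := m)) := by
  have h : Continuous fun t : Fin m → ℝ => affineLift t := continuous_affineLift
  exact (h.norm.pow _).measurable.inv

lemma measurable_centred_kernel (n d : ℕ) : Measurable fun s : Fin (n + 1) → ℝ =>
    chartWeight s * ((pairKernel n d ‖affineLift s‖⁻¹).toReal
      - (gaussDetMoment (n + 1) * gaussDetMoment (n + 1)).toReal) := by
  have h : Measurable fun t : Fin (n + 1) → ℝ => ‖affineLift t‖⁻¹ :=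
    continuous_affineLift.norm.measurable.inv
  have h2 : Measurable fun t : Fin (n + 1) → ℝ => pairKernel n d ‖affineLift t‖⁻¹ :=
    measurable_pairKernel.comp h
  exact measurable_chartWeight.mul (h2.ennreal_toReal.sub_const _)

lemma measurable_scaledKernel (n d : ℕ) : Measurable (scaledKernel n d) := by
  have h : Measurable fun z : Fin (n + 1) → ℝ => (√(d + 2 : ℝ))⁻¹ • z := by fun_prop
  exact (measurable_centred_kernel n d).comp h

lemma sum_sq_pos {m : ℕ} {z : Fin m → ℝ} (hz : z ≠ 0) : 0 < ∑ j, z j ^ 2 :=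
  lt_of_lt_of_le (by have := norm_pos_iff.2 hz; positivity) (norm_sq_le_sum_sq z)

lemma exists_tendsto_scaledKernel (n : ℕ) {z : Fin (n + 1) → ℝ} (hz : z ≠ 0) :
    ∃ L, Tendsto (fun d => scaledKernel n d z) atTop (nhds L) := by
  obtain ⟨L, hL⟩ := exists_tendsto_pairKernel n (sum_sq_pos hz)
  have h1 : Tendsto (fun d : ℕ => chartWeight ((√((d : ℝ) + 2))⁻¹ • z)) atTop (nhds 1) := by
    have := (tendsto_scaledCos (∑ j, z j ^ 2)).pow (n + 1 + 1)
    rw [one_pow] at this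
    refine this.congr fun d => ?_
    rw [chartWeight, ← norm_affineLift_scaled, inv_pow]
  refine ⟨_, h1.mul (?_ : Tendsto _ _ (nhds (L -
    (gaussDetMoment (n + 1) * gaussDetMoment (n + 1)).toReal)))⟩
  simp_rw [norm_affineLift_scaled]
  exact hL.sub_const _

/-- An integrable majorant of the rescaled kernels. -/
noncomputable def kernelBound (n : ℕ) (C₁ C₂ C₃ : ℝ) (z : Fin (n + 1) → ℝ) : ℝ :=
  (if ‖z‖ ≤ 1 then C₁ * (‖z‖ ^ n)⁻¹ + C₂ else 0) + C₃ * (1 + ‖z‖) ^ (-((n : ℝ) + 2))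

lemma integrable_kernelBound (n : ℕ) (C₁ C₂ C₃ : ℝ) : Integrable (kernelBound n C₁ C₂ C₃) := by
  refine Integrable.add ?_ ?_
  · rw [integrable_fun_norm_addHaar (volume : Measure (Fin (n + 1) → ℝ))
      (f := fun y => if y ≤ 1 then C₁ * (y ^ n)⁻¹ + C₂ else 0)]
    rw [Module.finrank_fin_fun, Nat.add_sub_cancel]
    have hI : IntegrableOn (fun y : ℝ => C₁ + C₂ * y ^ n) (Set.Ioc 0 1) :=
      (Continuous.integrableOn_Icc (by fun_prop)).mono_set Set.Ioc_subset_Icc_self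
    have h2 : IntegrableOn (fun y : ℝ => y ^ n • if y ≤ 1 then C₁ * (y ^ n)⁻¹ + C₂ else 0)
        (Set.Ioc 0 1) := by
      refine hI.congr_fun (fun y hy => ?_) measurableSet_Ioc
      have : y ^ n ≠ 0 := pow_ne_zero _ hy.1.ne'
      simp only [hy.2, if_true, smul_eq_mul]
      field_simp
    have h3 : IntegrableOn (fun y : ℝ => y ^ n • if y ≤ 1 then C₁ * (y ^ n)⁻¹ + C₂ else 0)
        (Set.Ioi 1) := by
      refine integrableOn_zero.congr_fun (fun y hy => ?_) measurableSet_Ioi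
      simp [not_le.2 (Set.mem_Ioi.1 hy)]
    rw [← Set.Ioc_union_Ioi_eq_Ioi (zero_le_one' ℝ)]
    exact h2.union h3
  · refine Integrable.const_mul ?_ _
    refine integrable_one_add_norm ?_
    rw [Module.finrank_fin_fun]; push_cast; linarith

lemma exists_norm_scaledKernel_le (n : ℕ) : ∃ C₁ C₂ C₃ : ℝ, ∀ᶠ d : ℕ in atTop, ∀ z ≠ 0,
    ‖scaledKernel n d z‖ ≤ kernelBound n C₁ C₂ C₃ z := by
  set Θ := (gaussDetMoment (n + 1) * gaussDetMoment (n + 1)).toReal with hΘ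
  have hΘ0 : 0 ≤ Θ := ENNReal.toReal_nonneg
  have hκ := kernelConst_nonneg n
  set A := 2 * kernelConst n * √2 ^ (n + 1) with hA
  set B := 2 * kernelConst n * (n + 1) * 2 ^ (n + 1) + 12 * kernelConst n * (n + 1) with hB
  set l := n + 3 with hl
  set C := B * ((2 * l) ^ l * 2 ^ (n + 2)) with hC
  have hA0 : 0 ≤ A := by positivity
  have hB0 : 0 ≤ B := by positivity
  have hC0 : 0 ≤ C := by positivity
  refine ⟨A, Θ, C, (eventually_ge_atTop (2 * l)).mono fun d hd z hz => ?_⟩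
  set u := ∑ j, z j ^ 2 with hu
  have hu0 : 0 < u := sum_sq_pos hz
  have hzu : ‖z‖ ^ 2 ≤ u := norm_sq_le_sum_sq z
  have hz0 : 0 < ‖z‖ := norm_pos_iff.2 hz
  rw [scaledKernel, norm_affineLift_scaled, norm_mul, Real.norm_of_nonneg (chartWeight_pos _).le,
    Real.norm_eq_abs, ← hΘ, ← hu]
  refine (mul_le_of_le_one_left (abs_nonneg _) (chartWeight_le_one _)).trans ?_
  have hc := scaledCos_sq_mul hu0.le d
  have hc0 := scaledCos_pos hu0.le d
  have hp : 0 ≤ C * (1 + ‖z‖) ^ (-((n : ℝ) + 2)) := by positivity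
  rw [kernelBound]
  rcases le_or_gt u 1 with h | h
  · have hz1 : ‖z‖ ≤ 1 := by nlinarith
    rw [if_pos hz1]
    have h1 := toReal_pairKernel_le_near (n := n) hu0 h hc0 hc
    have h2 : (√u ^ n)⁻¹ ≤ (‖z‖ ^ n)⁻¹ := by
      have : ‖z‖ ≤ √u := Real.le_sqrt_of_sq_le hzu
      gcongr
    have h3 : A * (√u ^ n)⁻¹ ≤ A * (‖z‖ ^ n)⁻¹ := by gcongr
    have h4 : 0 ≤ (pairKernel n d (scaledCos d u)).toReal := ENNReal.toReal_nonneg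
    have h5 : 0 ≤ A * (‖z‖ ^ n)⁻¹ := by positivity
    rw [abs_le]; constructor <;> linarith
  · have h1 := abs_toReal_pairKernel_sub_le_far (n := n) h.le hc0 hc
    refine h1.trans (le_trans ?_ (le_add_of_nonneg_left (by split_ifs <;> positivity)))
    have h2 := scaledCos_pow_le (l := l) (d := d) (by omega) (by omega) hu0.le
    have h3 : (1 + ‖z‖) ≤ 2 * (1 + u) := by nlinarith [sq_nonneg (‖z‖ - 1)]
    have h4 : (1 + ‖z‖) ^ (-((n : ℝ) + 2)) = ((1 + ‖z‖) ^ (n + 2))⁻¹ := by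
      rw [Real.rpow_neg (by positivity)]
      congr 1
      exact_mod_cast Real.rpow_natCast (1 + ‖z‖) (n + 2)
    rw [h4, hC, mul_assoc B]
    refine mul_le_mul_of_nonneg_left ?_ hB0
    rw [← div_eq_mul_inv, le_div_iff₀ (by positivity)]
    calc (1 + u) * scaledCos d u ^ (d + 2) * (1 + ‖z‖) ^ (n + 2)
        ≤ (1 + u) * scaledCos d u ^ (d + 2) * (2 * (1 + u)) ^ (n + 2) := by gcongr
      _ = (scaledCos d u ^ (d + 2) * (1 + u) ^ l) * 2 ^ (n + 2) := by
          rw [mul_pow, hl]; ring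
      _ ≤ _ := by gcongr

theorem exists_tendsto_integral_scaledKernel (n : ℕ) :
    (∀ᶠ d in atTop, Integrable (scaledKernel n d)) ∧
    ∃ L, Tendsto (fun d => ∫ z, scaledKernel n d z) atTop (nhds L) := by
  obtain ⟨C₁, C₂, C₃, hb⟩ := exists_norm_scaledKernel_le n
  have hne : ∀ᵐ z : Fin (n + 1) → ℝ, z ≠ 0 := by
    rw [ae_iff]; simp
  have hI := integrable_kernelBound n C₁ C₂ C₃
  refine ⟨hb.mono fun d hd => hI.mono' (measurable_scaledKernel n d).aestronglyMeasurable
    (hne.mono hd), ?_⟩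
  have hL : ∀ z : Fin (n + 1) → ℝ, ∃ L, z ≠ 0 →
      Tendsto (fun d => scaledKernel n d z) atTop (nhds L) := fun z => by
    by_cases hz : z = 0
    · exact ⟨0, fun h => absurd hz h⟩
    · exact (exists_tendsto_scaledKernel n hz).imp fun _ h _ => h
  choose L hL using hL
  exact ⟨_, tendsto_integral_filter_of_dominated_convergence _
    (Eventually.of_forall fun d => (measurable_scaledKernel n d).aestronglyMeasurable)
    (hb.mono fun d hd => hne.mono hd) hI (hne.mono hL)⟩

section Variance

lemma integrable_chartWeight (m : ℕ) : Integrable (chartWeight (m := m)) := by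
  refine ⟨measurable_chartWeight.aestronglyMeasurable, ?_⟩
  rw [hasFiniteIntegral_iff_ofReal (Eventually.of_forall fun t => (chartWeight_pos t).le)]
  exact lt_top_iff_ne_top.2 chartMass_ne_top

lemma toReal_chartMass (m : ℕ) : (chartMass m).toReal = ∫ t : Fin m → ℝ, chartWeight t := by
  rw [integral_eq_lintegral_of_nonneg_ae (Eventually.of_forall fun t => (chartWeight_pos t).le)
    measurable_chartWeight.aestronglyMeasurable]
  rfl

variable {n d : ℕ} {H : Type*} [NormedAddCommGroup H] [InnerProductSpace ℝ H]
  [FiniteDimensional ℝ H] [MeasurableSpace H] [BorelSpace H]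

lemma intensityConst_nonneg (m d : ℕ) : 0 ≤ intensityConst m d := by
  rw [intensityConst]; positivity

section FirstMoment

variable {m : ℕ} {e : EuclideanSpace ℝ (Fin (m + 1)) → H}
  {e' : EuclideanSpace ℝ (Fin (m + 1)) → EuclideanSpace ℝ (Fin (m + 1)) →L[ℝ] H}

lemma lintegral_zeroCount_ne_top (he : IsPowerFeature d e e') :
    ∫⁻ Ξ, zeroCount e Ξ ∂gaussianSystem m H ≠ ⊤ := by
  rw [lintegral_zeroCount he]
  exact ENNReal.mul_ne_top (ENNReal.mul_ne_top ENNReal.ofReal_ne_top gaussDetMoment_ne_top)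
    chartMass_ne_top

lemma ae_zeroCount_lt_top (he : IsPowerFeature d e e') :
    ∀ᵐ Ξ ∂gaussianSystem m H, zeroCount e Ξ < ⊤ :=
  ae_lt_top (measurable_zeroCount he) (lintegral_zeroCount_ne_top he)

lemma integral_zeroCount (he : IsPowerFeature d e e') :
    ∫ Ξ, (zeroCount e Ξ).toReal ∂gaussianSystem m H
      = intensityConst m d * (gaussDetMoment m).toReal * (chartMass m).toReal := by
  rw [integral_toReal (measurable_zeroCount he).aemeasurable (ae_zeroCount_lt_top he),
    lintegral_zeroCount he, ENNReal.toReal_mul, ENNReal.toReal_mul,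
    ENNReal.toReal_ofReal (intensityConst_nonneg m d)]

end FirstMoment

variable {e : EuclideanSpace ℝ (Fin (n + 2)) → H}
  {e' : EuclideanSpace ℝ (Fin (n + 2)) → EuclideanSpace ℝ (Fin (n + 2)) →L[ℝ] H}

lemma lintegral_chartWeight_mul_pairKernel
    (hI : Integrable fun s : Fin (n + 1) → ℝ => chartWeight s *
      ((pairKernel n d ‖affineLift s‖⁻¹).toReal
        - (gaussDetMoment (n + 1) * gaussDetMoment (n + 1)).toReal)) :
    ∫⁻ s : Fin (n + 1) → ℝ, ENNReal.ofReal (chartWeight s) * pairKernel n d (‖affineLift s‖⁻¹)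
      = ENNReal.ofReal ((∫ s : Fin (n + 1) → ℝ, chartWeight s *
          ((pairKernel n d ‖affineLift s‖⁻¹).toReal
            - (gaussDetMoment (n + 1) * gaussDetMoment (n + 1)).toReal))
        + (gaussDetMoment (n + 1) * gaussDetMoment (n + 1)).toReal * (chartMass (n + 1)).toReal) := by
  set Θ := (gaussDetMoment (n + 1) * gaussDetMoment (n + 1)).toReal
  have h1 : ∀ s : Fin (n + 1) → ℝ,
      ENNReal.ofReal (chartWeight s) * pairKernel n d (‖affineLift s‖⁻¹)
        = ENNReal.ofReal (chartWeight s * ((pairKernel n d ‖affineLift s‖⁻¹).toReal - Θ)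
          + Θ * chartWeight s) := fun s => by
    rw [← ENNReal.ofReal_toReal (pairKernel_ne_top n d (‖affineLift s‖⁻¹)),
      ← ENNReal.ofReal_mul (chartWeight_pos s).le,
      ENNReal.toReal_ofReal ENNReal.toReal_nonneg]
    congr 1; ring
  simp_rw [h1]
  have hc := (integrable_chartWeight (n + 1)).const_mul Θ
  rw [toReal_chartMass, ← integral_const_mul, ← integral_add hI hc]
  refine (ofReal_integral_eq_lintegral_ofReal (hI.add hc) (Eventually.of_forall fun s => ?_)).symm
  have e1 : chartWeight s * ((pairKernel n d ‖affineLift s‖⁻¹).toReal - Θ)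
      + Θ * chartWeight s = chartWeight s * (pairKernel n d ‖affineLift s‖⁻¹).toReal := by ring
  have e2 := mul_nonneg (chartWeight_pos s).le
    (ENNReal.toReal_nonneg (a := pairKernel n d ‖affineLift s‖⁻¹))
  exact e2.trans_eq e1.symm

theorem variance_zeroCount (he : IsPowerFeature d e e')
    (hI : Integrable fun s : Fin (n + 1) → ℝ => chartWeight s *
      ((pairKernel n d ‖affineLift s‖⁻¹).toReal
        - (gaussDetMoment (n + 1) * gaussDetMoment (n + 1)).toReal)) :
    MemLp (fun Ξ => (zeroCount e Ξ).toReal) 2 (gaussianSystem (n + 1) H) ∧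
    variance (fun Ξ => (zeroCount e Ξ).toReal) (gaussianSystem (n + 1) H)
      = intensityConst (n + 1) d * (gaussDetMoment (n + 1)).toReal * (chartMass (n + 1)).toReal
        + intensityConst (n + 1) d ^ 2 * (chartMass (n + 1)).toReal *
          ∫ s : Fin (n + 1) → ℝ, chartWeight s * ((pairKernel n d ‖affineLift s‖⁻¹).toReal
            - (gaussDetMoment (n + 1) * gaussDetMoment (n + 1)).toReal) := by
  have h2 := lintegral_zeroCount_sq_radial he
  have hK := lintegral_chartWeight_mul_pairKernel hI
  set Θ := (gaussDetMoment (n + 1) * gaussDetMoment (n + 1)).toReal with hΘ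
  set J := ∫ s : Fin (n + 1) → ℝ, chartWeight s * ((pairKernel n d ‖affineLift s‖⁻¹).toReal - Θ)
  have hmN := measurable_zeroCount he
  have hmN2 : Measurable fun Ξ : Fin (n + 1) → H => zeroCount e Ξ * zeroCount e Ξ := hmN.mul hmN
  have hJ0 : 0 ≤ J + Θ * (chartMass (n + 1)).toReal := by
    have : J + Θ * (chartMass (n + 1)).toReal = ∫ s : Fin (n + 1) → ℝ,
        chartWeight s * (pairKernel n d ‖affineLift s‖⁻¹).toReal := by
      rw [toReal_chartMass, ← integral_const_mul,
        ← integral_add hI ((integrable_chartWeight (n + 1)).const_mul Θ)]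
      congr 1; ext s; ring
    rw [this]
    exact integral_nonneg fun s => mul_nonneg (chartWeight_pos s).le ENNReal.toReal_nonneg
  have hfin : ∫⁻ Ξ, zeroCount e Ξ * zeroCount e Ξ ∂gaussianSystem (n + 1) H ≠ ⊤ := by
    rw [h2, hK]
    exact ENNReal.add_ne_top.2 ⟨lintegral_zeroCount_ne_top he,
      ENNReal.mul_ne_top ENNReal.ofReal_ne_top
        (ENNReal.mul_ne_top chartMass_ne_top ENNReal.ofReal_ne_top)⟩
  have hlt : ∀ᵐ Ξ ∂gaussianSystem (n + 1) H, zeroCount e Ξ * zeroCount e Ξ < ⊤ :=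
    ae_lt_top hmN2 hfin
  have hsq : ∀ Ξ, (zeroCount e Ξ).toReal ^ 2 = (zeroCount e Ξ * zeroCount e Ξ).toReal :=
    fun Ξ => by rw [ENNReal.toReal_mul, sq]
  have hL2 : MemLp (fun Ξ => (zeroCount e Ξ).toReal) 2 (gaussianSystem (n + 1) H) := by
    rw [memLp_two_iff_integrable_sq hmN.ennreal_toReal.aestronglyMeasurable]
    simp_rw [hsq]
    exact integrable_toReal_of_lintegral_ne_top hmN2.aemeasurable hfin
  refine ⟨hL2, ?_⟩
  rw [variance_eq_sub hL2, integral_zeroCount he]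
  have h3 : (gaussianSystem (n + 1) H)[(fun Ξ => (zeroCount e Ξ).toReal) ^ 2]
      = ∫ Ξ, (zeroCount e Ξ * zeroCount e Ξ).toReal ∂gaussianSystem (n + 1) H :=
    integral_congr_ae (Eventually.of_forall hsq)
  rw [h3, integral_toReal hmN2.aemeasurable hlt, h2, hK, lintegral_zeroCount he,
    ENNReal.toReal_add, ENNReal.toReal_mul, ENNReal.toReal_mul, ENNReal.toReal_mul,
    ENNReal.toReal_mul, ENNReal.toReal_ofReal (intensityConst_nonneg _ _),
    ENNReal.toReal_ofReal (by positivity), ENNReal.toReal_ofReal hJ0, hΘ, ENNReal.toReal_mul]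
  · ring
  · rw [← lintegral_zeroCount he]; exact lintegral_zeroCount_ne_top he
  · exact ENNReal.mul_ne_top ENNReal.ofReal_ne_top
        (ENNReal.mul_ne_top chartMass_ne_top ENNReal.ofReal_ne_top)

lemma integral_scaledKernel (n d : ℕ) : ∫ z, scaledKernel n d z
    = √(d + 2) ^ (n + 1) * ∫ s : Fin (n + 1) → ℝ, chartWeight s *
      ((pairKernel n d ‖affineLift s‖⁻¹).toReal
        - (gaussDetMoment (n + 1) * gaussDetMoment (n + 1)).toReal) := by
  have h := Measure.integral_comp_smul (volume : Measure (Fin (n + 1) → ℝ))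
    (fun s : Fin (n + 1) → ℝ => chartWeight s * ((pairKernel n d ‖affineLift s‖⁻¹).toReal
        - (gaussDetMoment (n + 1) * gaussDetMoment (n + 1)).toReal)) (√(d + 2 : ℝ))⁻¹
  refine h.trans ?_
  rw [Module.finrank_fin_fun, smul_eq_mul, inv_pow, inv_inv, abs_of_nonneg (by positivity)]

lemma integrable_centred_kernel {n d : ℕ} (h : Integrable (scaledKernel n d)) :
    Integrable fun s : Fin (n + 1) → ℝ => chartWeight s *
      ((pairKernel n d ‖affineLift s‖⁻¹).toReal
        - (gaussDetMoment (n + 1) * gaussDetMoment (n + 1)).toReal) := by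
  have hD : (√(d + 2 : ℝ))⁻¹ ≠ 0 := by positivity
  exact (integrable_comp_smul_iff (volume : Measure (Fin (n + 1) → ℝ)) _ hD).1 h

theorem exists_tendsto_variance_zeroCount (n : ℕ) : ∃ L, Tendsto (fun d : ℕ =>
    variance (fun Ξ => (zeroCount (powerFeature (n + 1) (d + 2)) Ξ).toReal)
      (gaussianSystem (n + 1) (EuclideanSpace ℝ (multiIndex (n + 1) (d + 2))))
      / √((d : ℝ) + 2) ^ (n + 1)) atTop (nhds L) := by
  obtain ⟨hI, L, hL⟩ := exists_tendsto_integral_scaledKernel n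
  refine ⟨_, Tendsto.congr' ?_ ((hL.const_mul ((chartMass (n + 1)).toReal *
    ((√(2 * π))⁻¹ ^ (n + 1)) ^ 2)).const_add ((√(2 * π))⁻¹ ^ (n + 1) *
      (gaussDetMoment (n + 1)).toReal * (chartMass (n + 1)).toReal))⟩
  filter_upwards [hI] with d hd
  rw [(variance_zeroCount (isPowerFeature_powerFeature (n + 1) d)
    (integrable_centred_kernel hd)).2, integral_scaledKernel, intensityConst]
  have h1 : √((d : ℝ) + 2) ^ (n + 1) ≠ 0 := by positivity
  rw [div_eq_mul_inv (√((d : ℝ) + 2)) (√(2 * π)), mul_pow]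
  field_simp

end Variance

section HomogeneousMoments

lemma lintegral_Ioi_of_hasDerivAt_of_nonneg {g g' : ℝ → ℝ} {a l : ℝ}
    (hderiv : ∀ x ∈ Set.Ici a, HasDerivAt g (g' x) x) (g'pos : ∀ x ∈ Set.Ioi a, 0 ≤ g' x)
    (hg : Tendsto g atTop (nhds l)) :
    ∫⁻ x in Set.Ioi a, ENNReal.ofReal (g' x) = ENNReal.ofReal (l - g a) := by
  rw [← integral_Ioi_of_hasDerivAt_of_nonneg' hderiv g'pos hg]
  exact (ofReal_integral_eq_lintegral_ofReal (integrableOn_Ioi_deriv_of_nonneg' hderiv g'pos hg)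
    ((ae_restrict_iff' measurableSet_Ioi).2 (Eventually.of_forall g'pos))).symm

lemma lintegral_Ioi_mul_exp_neg {a : ℝ} (ha : 0 < a) :
    ∫⁻ r in Set.Ioi (1 : ℝ), ENNReal.ofReal (r * a * Real.exp (-(r ^ 2 * a) / 2))
      = ENNReal.ofReal (Real.exp (-a / 2)) := by
  have hd : ∀ x ∈ Set.Ici (1 : ℝ), HasDerivAt (fun r : ℝ => -Real.exp (-(r ^ 2 * a) / 2))
      (x * a * Real.exp (-(x ^ 2 * a) / 2)) x := fun x _ => by
    have h1 : HasDerivAt (fun r : ℝ => -(r ^ 2 * a) / 2) (-(x * a)) x := by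
      have := ((hasDerivAt_pow 2 x).mul_const a).neg.div_const 2
      refine this.congr_deriv ?_
      simp; ring
    exact h1.exp.neg.congr_deriv (by ring)
  have ht : Tendsto (fun r : ℝ => -Real.exp (-(r ^ 2 * a) / 2)) atTop (nhds (-0)) := by
    refine (Real.tendsto_exp_atBot.comp ?_).neg
    have h2 : Tendsto (fun r : ℝ => r ^ 2 * (a / 2)) atTop atTop :=
      (tendsto_pow_atTop two_ne_zero).atTop_mul_const (by positivity)
    refine (tendsto_neg_atTop_atBot.comp h2).congr fun r => ?_
    simp only [Function.comp]; ring
  rw [lintegral_Ioi_of_hasDerivAt_of_nonneg hd (fun x hx => ?_) ht]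
  · congr 1; simp
  · have : (0 : ℝ) < x := zero_lt_one.trans hx
    positivity

lemma lintegral_Ioi_inv_pow {p : ℕ} (hp : 0 < p) :
    ∫⁻ r in Set.Ioi (1 : ℝ), ENNReal.ofReal ((r ^ (p + 1))⁻¹) = ENNReal.ofReal ((p : ℝ)⁻¹) := by
  have hp' : (p : ℝ) ≠ 0 := by positivity
  have hd : ∀ x ∈ Set.Ici (1 : ℝ), HasDerivAt (fun r : ℝ => -((p : ℝ)⁻¹ * (r ^ p)⁻¹))
      ((x ^ (p + 1))⁻¹) x := fun x hx => by
    have hx0 : x ≠ 0 := (zero_lt_one.trans_le hx).ne'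
    have h := (((hasDerivAt_pow p x).inv (pow_ne_zero _ hx0)).const_mul (p : ℝ)⁻¹).neg
    refine h.congr_deriv ?_
    obtain ⟨q, rfl⟩ : ∃ q, p = q + 1 := ⟨p - 1, by omega⟩
    rw [Nat.add_sub_cancel]
    field_simp
    ring
  have ht : Tendsto (fun r : ℝ => -((p : ℝ)⁻¹ * (r ^ p)⁻¹)) atTop (nhds (-((p : ℝ)⁻¹ * 0))) :=
    ((tendsto_inv_atTop_zero.comp (tendsto_pow_atTop hp.ne')).const_mul _).neg
  rw [lintegral_Ioi_of_hasDerivAt_of_nonneg hd (fun x hx => ?_) ht]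
  · congr 1; simp
  · have : (0 : ℝ) < x := zero_lt_one.trans hx
    positivity

variable {H : Type*} [NormedAddCommGroup H] [InnerProductSpace ℝ H]
  [FiniteDimensional ℝ H] [MeasurableSpace H] [BorelSpace H]

lemma lintegral_volume_comp_smul {h : H → ENNReal} (hh : Measurable h) {r : ℝ} (hr : 0 < r) :
    ∫⁻ x : H, h (r • x) = ENNReal.ofReal ((r ^ Module.finrank ℝ H)⁻¹) * ∫⁻ x : H, h x := by
  have hm : Measurable fun x : H => r • x := measurable_const_smul r
  rw [← lintegral_map hh hm, Measure.map_addHaar_smul _ hr.ne', lintegral_smul_measure,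
    abs_of_pos (by positivity), smul_eq_mul]

omit [FiniteDimensional ℝ H] [MeasurableSpace H] [BorelSpace H] in
lemma stdGaussianDensity_eq_lintegral {x : H} (hx : x ≠ 0) :
    stdGaussianDensity x = ∫⁻ r in Set.Ioi (1 : ℝ),
      ENNReal.ofReal (r * ‖x‖ ^ 2) * stdGaussianDensity (r • x) := by
  have hx0 : 0 < ‖x‖ ^ 2 := by have := norm_pos_iff.2 hx; positivity
  have h1 : ∀ r ∈ Set.Ioi (1 : ℝ), ENNReal.ofReal (r * ‖x‖ ^ 2) * stdGaussianDensity (r • x)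
      = ENNReal.ofReal ((√(2 * π))⁻¹ ^ Module.finrank ℝ H) *
        ENNReal.ofReal (r * ‖x‖ ^ 2 * Real.exp (-(r ^ 2 * ‖x‖ ^ 2) / 2)) := fun r hr => by
    have hr0 : (0 : ℝ) < r := zero_lt_one.trans hr
    rw [stdGaussianDensity, ← ENNReal.ofReal_mul (by positivity),
      ← ENNReal.ofReal_mul (by positivity), norm_smul, Real.norm_of_nonneg hr0.le, mul_pow]
    congr 1; ring
  rw [setLIntegral_congr_fun measurableSet_Ioi h1, lintegral_const_mul' _ _ ENNReal.ofReal_ne_top,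
    lintegral_Ioi_mul_exp_neg hx0, ← ENNReal.ofReal_mul (by positivity)]
  rfl

theorem lintegral_norm_sq_mul_stdGaussian {f : H → ENNReal} (hf : Measurable f) (k : ℕ)
    (hN : 0 < Module.finrank ℝ H)
    (hom : ∀ r : ℝ, 0 < r → ∀ x, f (r • x) = ENNReal.ofReal (r ^ k) * f x) :
    ∫⁻ x, ENNReal.ofReal (‖x‖ ^ 2) * f x ∂stdGaussian H
      = ((Module.finrank ℝ H + k : ℕ) : ENNReal) * ∫⁻ x, f x ∂stdGaussian H := by
  set N := Module.finrank ℝ H with hNdef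
  have hG := measurable_stdGaussianDensity (H := H)
  set J := ∫⁻ x : H, ENNReal.ofReal (‖x‖ ^ 2) * f x * stdGaussianDensity x with hJ
  have hmn : Measurable fun x : H => ENNReal.ofReal (‖x‖ ^ 2) := by fun_prop
  have hmh : Measurable fun x : H => ENNReal.ofReal (‖x‖ ^ 2) * f x * stdGaussianDensity x :=
    (hmn.mul hf).mul hG
  have hmf : Measurable fun x : H => ENNReal.ofReal (‖x‖ ^ 2) * f x := hmn.mul hf
  have e1 : ∫⁻ x, ENNReal.ofReal (‖x‖ ^ 2) * f x ∂stdGaussian H = J := by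
    rw [stdGaussian_eq_withDensity, lintegral_withDensity_eq_lintegral_mul _ hG hmf, hJ]
    exact lintegral_congr fun x => by rw [Pi.mul_apply, mul_comm]
  have hnt : Nontrivial H := Module.finrank_pos_iff.1 hN
  have hne : ∀ᵐ x : H, x ≠ 0 := by
    rw [ae_iff]; simp
  have hmG : Measurable fun p : H × ℝ => stdGaussianDensity (p.2 • p.1) :=
    hG.comp (measurable_snd.smul measurable_fst)
  have e2 : ∫⁻ x, f x ∂stdGaussian H = ENNReal.ofReal (((N + k : ℕ) : ℝ)⁻¹) * J := by
    rw [stdGaussian_eq_withDensity, lintegral_withDensity_eq_lintegral_mul _ hG hf]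
    calc ∫⁻ x : H, ((stdGaussianDensity : H → ENNReal) * f) x
        = ∫⁻ x : H, ∫⁻ r in Set.Ioi (1 : ℝ),
            ENNReal.ofReal (r * ‖x‖ ^ 2) * stdGaussianDensity (r • x) * f x := by
          refine lintegral_congr_ae (hne.mono fun x hx => ?_)
          simp only [Pi.mul_apply]
          rw [stdGaussianDensity_eq_lintegral hx, lintegral_mul_const]
          have : Measurable fun r : ℝ => stdGaussianDensity (r • x) :=
            hG.comp (measurable_id.smul_const x)
          have h2 : Measurable fun r : ℝ => ENNReal.ofReal (r * ‖x‖ ^ 2) := by fun_prop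
          exact h2.mul this
      _ = ∫⁻ r in Set.Ioi (1 : ℝ), ∫⁻ x : H,
            ENNReal.ofReal (r * ‖x‖ ^ 2) * stdGaussianDensity (r • x) * f x := by
          refine lintegral_lintegral_swap ?_
          have h2 : Measurable fun p : H × ℝ => ENNReal.ofReal (p.2 * ‖p.1‖ ^ 2) := by fun_prop
          exact ((h2.mul hmG).mul (hf.comp measurable_fst)).aemeasurable
      _ = ∫⁻ r in Set.Ioi (1 : ℝ), ENNReal.ofReal ((r ^ (N + k + 1))⁻¹) * J := by
          refine setLIntegral_congr_fun measurableSet_Ioi fun r hr => ?_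
          have hr0 : (0 : ℝ) < r := zero_lt_one.trans hr
          have h3 : ∀ x : H, ENNReal.ofReal (r * ‖x‖ ^ 2) * stdGaussianDensity (r • x) * f x
              = ENNReal.ofReal ((r ^ (k + 1))⁻¹) *
                (ENNReal.ofReal (‖r • x‖ ^ 2) * f (r • x) * stdGaussianDensity (r • x)) :=
            fun x => by
              rw [hom r hr0, norm_smul, Real.norm_of_nonneg hr0.le]
              have h4 : ENNReal.ofReal (r * ‖x‖ ^ 2) = ENNReal.ofReal ((r ^ (k + 1))⁻¹) *
                  (ENNReal.ofReal ((r * ‖x‖) ^ 2) * ENNReal.ofReal (r ^ k)) := by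
                rw [← ENNReal.ofReal_mul (by positivity), ← ENNReal.ofReal_mul (by positivity)]
                congr 1
                field_simp
                ring
              rw [h4]; ring
          simp only [h3]
          rw [lintegral_const_mul' _ _ ENNReal.ofReal_ne_top, lintegral_volume_comp_smul hmh hr0,
            ← mul_assoc, ← ENNReal.ofReal_mul (by positivity)]
          congr 2
          rw [← mul_inv, ← pow_add]; congr 2; ring
      _ = _ := by
          rw [lintegral_mul_const, lintegral_Ioi_inv_pow (by omega)]
          fun_prop
  rw [e1, e2, ← mul_assoc, ← ENNReal.ofReal_natCast, ← ENNReal.ofReal_mul (by positivity),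
    mul_inv_cancel₀ (by positivity), ENNReal.ofReal_one, one_mul]

end HomogeneousMoments

section LinearFormMoments

/-- The `k`-th absolute moment of a standard real Gaussian variable. -/
noncomputable def absMoment (k : ℕ) : ENNReal :=
  ∫⁻ ξ, ENNReal.ofReal (|ξ 0| ^ k) ∂stdGaussian (EuclideanSpace ℝ (Fin 1))

lemma absMoment_zero : absMoment 0 = 1 := by simp [absMoment]

lemma absMoment_add_two (k : ℕ) : absMoment (k + 2) = ((k + 1 : ℕ) : ENNReal) * absMoment k := by
  have hf : Measurable fun ξ : EuclideanSpace ℝ (Fin 1) => ENNReal.ofReal (|ξ 0| ^ k) := by fun_prop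
  have h := lintegral_norm_sq_mul_stdGaussian hf k (by simp) (fun r hr x => by
    rw [← ENNReal.ofReal_mul (by positivity), PiLp.smul_apply, smul_eq_mul, abs_mul,
      abs_of_pos hr, mul_pow])
  rw [finrank_euclideanSpace_fin, add_comm 1 k] at h
  rw [absMoment, absMoment, ← h]
  refine lintegral_congr fun x => ?_
  rw [← ENNReal.ofReal_mul (by positivity), EuclideanSpace.norm_sq_eq]
  congr 1
  simp [pow_add, mul_comm]

lemma absMoment_ne_top (k : ℕ) : absMoment k ≠ ⊤ := by
  have h := (integrable_norm_pow_stdGaussian (H := EuclideanSpace ℝ (Fin 1)) k).lintegral_lt_top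
  refine ne_top_of_le_ne_top h.ne (lintegral_mono fun x => ENNReal.ofReal_le_ofReal ?_)
  exact pow_le_pow_left₀ (abs_nonneg _) (PiLp.norm_apply_le x 0) k

variable {H : Type*} [NormedAddCommGroup H] [InnerProductSpace ℝ H]
  [FiniteDimensional ℝ H] [MeasurableSpace H] [BorelSpace H]

lemma lintegral_inner_pair_congr {H' : Type*} [NormedAddCommGroup H'] [InnerProductSpace ℝ H']
    [FiniteDimensional ℝ H'] [MeasurableSpace H'] [BorelSpace H'] {n w : H} {n' w' : H'}
    (h1 : inner ℝ n n = inner ℝ n' n') (h2 : inner ℝ n w = inner ℝ n' w')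
    (h3 : inner ℝ w w = inner ℝ w' w') {G : ℝ → ℝ → ENNReal}
    (hG : Measurable fun p : ℝ × ℝ => G p.1 p.2) :
    ∫⁻ ξ, G (inner ℝ ξ n) (inner ℝ ξ w) ∂stdGaussian H
      = ∫⁻ ξ, G (inner ℝ ξ n') (inner ℝ ξ w') ∂stdGaussian H' := by
  have hg : ∀ k l, inner ℝ (![n, w] k) (![n, w] l) = inner ℝ (![n', w'] k) (![n', w'] l) := by
    intro k l
    fin_cases k <;> fin_cases l
    · exact h1
    · exact h2
    · exact (real_inner_comm _ _).trans (h2.trans (real_inner_comm _ _))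
    · exact h3
  have hm := map_inner_stdGaussian_congr ![n, w] ![n', w'] hg
  have hp : Measurable fun v : Fin 2 → ℝ => (v 0, v 1) := by fun_prop
  have hF : Measurable fun v : Fin 2 → ℝ => G (v 0) (v 1) := hG.comp hp
  have m1 : Measurable fun (ξ : H) (k : Fin 2) => inner ℝ ξ (![n, w] k) := by fun_prop
  have m2 : Measurable fun (ξ : H') (k : Fin 2) => inner ℝ ξ (![n', w'] k) := by fun_prop
  have := lintegral_map (μ := stdGaussian H) hF m1
  rw [hm, lintegral_map hF m2] at this
  exact this.symm

lemma lintegral_abs_inner_pow (n : H) (k : ℕ) :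
    ∫⁻ ξ, ENNReal.ofReal (|inner ℝ ξ n| ^ k) ∂stdGaussian H
      = ENNReal.ofReal (‖n‖ ^ k) * absMoment k := by
  set n' : EuclideanSpace ℝ (Fin 1) := EuclideanSpace.single 0 ‖n‖ with hn'
  have h1 : inner ℝ n n = inner ℝ n' n' := by
    rw [real_inner_self_eq_norm_sq, real_inner_self_eq_norm_sq, hn', PiLp.norm_single,
      norm_norm]
  have hG : Measurable fun p : ℝ × ℝ => ENNReal.ofReal (|p.1| ^ k) := by fun_prop
  rw [lintegral_inner_pair_congr h1 h1 h1 (G := fun a _ => ENNReal.ofReal (|a| ^ k)) hG, absMoment,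
    ← lintegral_const_mul' _ _ ENNReal.ofReal_ne_top]
  refine lintegral_congr fun ξ => ?_
  rw [← ENNReal.ofReal_mul (by positivity), hn', EuclideanSpace.inner_single_right]
  simp [abs_mul, mul_pow]

lemma lintegral_abs_coord_pow_mul_sq (k : ℕ) (b c : ℝ) :
    ∫⁻ ξ, ENNReal.ofReal (|ξ 0| ^ k * (b * ξ 0 + c * ξ 1) ^ 2)
        ∂stdGaussian (EuclideanSpace ℝ (Fin 2))
      = ENNReal.ofReal (b ^ 2 * (k + 1) + c ^ 2) * absMoment k := by
  set γ := stdGaussian (EuclideanSpace ℝ (Fin 2)) with hγ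
  have hf : Measurable fun ξ : EuclideanSpace ℝ (Fin 2) => ENNReal.ofReal (|ξ 0| ^ k) := by fun_prop
  have h0 : ∀ j, ∫⁻ ξ, ENNReal.ofReal (|ξ 0| ^ j) ∂γ = absMoment j := fun j => by
    have := lintegral_abs_inner_pow (EuclideanSpace.single (0 : Fin 2) (1 : ℝ)) j
    simpa [EuclideanSpace.inner_single_right] using this
  have h00 : ∫⁻ ξ, ENNReal.ofReal (|ξ 0| ^ k * ξ 0 ^ 2) ∂γ
      = ((k + 1 : ℕ) : ENNReal) * absMoment k := by
    rw [← absMoment_add_two, ← h0]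
    refine lintegral_congr fun ξ => ?_
    rw [pow_add, sq_abs]
  have h := lintegral_norm_sq_mul_stdGaussian hf k (by simp) (fun r hr x => by
    rw [← ENNReal.ofReal_mul (by positivity), PiLp.smul_apply, smul_eq_mul, abs_mul,
      abs_of_pos hr, mul_pow])
  have hm0 : Measurable fun ξ : EuclideanSpace ℝ (Fin 2) =>
    ENNReal.ofReal (|ξ 0| ^ k * ξ 0 ^ 2) := by fun_prop
  have h01 : ∫⁻ ξ, ENNReal.ofReal (|ξ 0| ^ k * ξ 1 ^ 2) ∂γ = absMoment k := by
    have hs : ∀ ξ : EuclideanSpace ℝ (Fin 2),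
        ENNReal.ofReal (‖ξ‖ ^ 2) * ENNReal.ofReal (|ξ 0| ^ k)
          = ENNReal.ofReal (|ξ 0| ^ k * ξ 0 ^ 2) + ENNReal.ofReal (|ξ 0| ^ k * ξ 1 ^ 2) := by
      intro ξ
      rw [← ENNReal.ofReal_mul (by positivity), ← ENNReal.ofReal_add (by positivity)
        (by positivity), EuclideanSpace.norm_sq_eq]
      congr 1
      simp [Fin.sum_univ_two]; ring
    simp only [hs] at h
    rw [lintegral_add_left hm0, h00, h0, finrank_euclideanSpace_fin,
      show 2 + k = (k + 1) + 1 by ring, Nat.cast_add (k + 1) 1, add_mul, Nat.cast_one,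
      one_mul] at h
    exact (ENNReal.add_right_inj (ENNReal.mul_ne_top (ENNReal.natCast_ne_top _)
      (absMoment_ne_top k))).1 h
  have hflip : ∫⁻ ξ, ENNReal.ofReal (|ξ 0| ^ k * (b * ξ 0 + c * ξ 1) ^ 2) ∂γ
      = ∫⁻ ξ, ENNReal.ofReal (|ξ 0| ^ k * (b * ξ 0 + (-c) * ξ 1) ^ 2) ∂γ := by
    have hG : Measurable fun p : ℝ × ℝ => ENNReal.ofReal (|p.1| ^ k * p.2 ^ 2) := by fun_prop
    have := lintegral_inner_pair_congr (n := EuclideanSpace.single (0 : Fin 2) (1 : ℝ))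
      (w := !₂[b, c]) (n' := EuclideanSpace.single (0 : Fin 2) (1 : ℝ)) (w' := !₂[b, -c]) rfl
      (by simp [EuclideanSpace.inner_single_left])
      (by simp only [PiLp.inner_apply, Fin.sum_univ_two]; simp)
      (G := fun x y => ENNReal.ofReal (|x| ^ k * y ^ 2)) hG
    simpa [EuclideanSpace.inner_single_right, PiLp.inner_apply, Fin.sum_univ_two] using this
  have hm1 : Measurable fun ξ : EuclideanSpace ℝ (Fin 2) =>
    ENNReal.ofReal (|ξ 0| ^ k * (b * ξ 0 + c * ξ 1) ^ 2) := by fun_prop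
  have hm2 : Measurable fun ξ : EuclideanSpace ℝ (Fin 2) =>
    ENNReal.ofReal (2 * b ^ 2) * ENNReal.ofReal (|ξ 0| ^ k * ξ 0 ^ 2) := by fun_prop
  have hsum : ∫⁻ ξ, ENNReal.ofReal (|ξ 0| ^ k * (b * ξ 0 + c * ξ 1) ^ 2) ∂γ
      + ∫⁻ ξ, ENNReal.ofReal (|ξ 0| ^ k * (b * ξ 0 + (-c) * ξ 1) ^ 2) ∂γ
      = ENNReal.ofReal 2 * (ENNReal.ofReal (b ^ 2 * (k + 1) + c ^ 2) * absMoment k) := by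
    rw [← lintegral_add_left hm1]
    calc _ = ∫⁻ ξ, (ENNReal.ofReal (2 * b ^ 2) * ENNReal.ofReal (|ξ 0| ^ k * ξ 0 ^ 2)
          + ENNReal.ofReal (2 * c ^ 2) * ENNReal.ofReal (|ξ 0| ^ k * ξ 1 ^ 2)) ∂γ := by
          refine lintegral_congr fun ξ => ?_
          rw [← ENNReal.ofReal_mul (by positivity), ← ENNReal.ofReal_mul (by positivity),
            ← ENNReal.ofReal_add (by positivity) (by positivity),
            ← ENNReal.ofReal_add (by positivity) (by positivity)]
          congr 1; ring
      _ = _ := by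
          rw [lintegral_add_left hm2, lintegral_const_mul' _ _ ENNReal.ofReal_ne_top,
            lintegral_const_mul' _ _ ENNReal.ofReal_ne_top, h00, h01, ← ENNReal.ofReal_natCast,
            ← mul_assoc, ← mul_assoc, ← ENNReal.ofReal_mul (by positivity), ← add_mul,
            ← ENNReal.ofReal_add (by positivity) (by positivity),
            ← ENNReal.ofReal_mul (by positivity)]
          congr 2
          push_cast; ring
  rw [← hflip, ← two_mul, ENNReal.ofReal_ofNat] at hsum
  exact (ENNReal.mul_right_inj two_ne_zero ENNReal.ofNat_ne_top).1 hsum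

theorem lintegral_abs_inner_pow_mul_inner_sq {n : H} (hn : n ≠ 0) (w : H) (k : ℕ) :
    ∫⁻ ξ, ENNReal.ofReal (|inner ℝ ξ n| ^ k * inner ℝ ξ w ^ 2) ∂stdGaussian H
      = ENNReal.ofReal (‖n‖ ^ k * (‖w‖ ^ 2 + k * (inner ℝ n w / ‖n‖) ^ 2)) * absMoment k := by
  have hn0 : 0 < ‖n‖ := norm_pos_iff.2 hn
  set b := inner ℝ n w / ‖n‖ with hb
  have hcs : b ^ 2 ≤ ‖w‖ ^ 2 := by
    rw [hb, div_pow, div_le_iff₀ (by positivity), ← mul_pow, mul_comm]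
    exact sq_le_sq' (neg_le_of_abs_le (abs_real_inner_le_norm n w)) (real_inner_le_norm n w)
  set c := √(‖w‖ ^ 2 - b ^ 2) with hc
  have hc2 : c ^ 2 = ‖w‖ ^ 2 - b ^ 2 := Real.sq_sqrt (by linarith)
  have hG : Measurable fun p : ℝ × ℝ => ENNReal.ofReal (|p.1| ^ k * p.2 ^ 2) := by fun_prop
  have hnw : inner ℝ n w = ‖n‖ * b := by rw [hb]; field_simp
  rw [lintegral_inner_pair_congr (n' := EuclideanSpace.single (0 : Fin 2) ‖n‖) (w' := !₂[b, c])
      (by rw [real_inner_self_eq_norm_sq, real_inner_self_eq_norm_sq, PiLp.norm_single,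
        norm_norm])
      (by simp [EuclideanSpace.inner_single_left, hnw])
      (by simp only [real_inner_self_eq_norm_sq, EuclideanSpace.norm_sq_eq, Fin.sum_univ_two]
          simp [hc2])
      (G := fun x y => ENNReal.ofReal (|x| ^ k * y ^ 2)) hG]
  have hk := lintegral_abs_coord_pow_mul_sq k b c
  have : ‖n‖ ^ k * (‖w‖ ^ 2 + k * b ^ 2) = ‖n‖ ^ k * (b ^ 2 * (k + 1) + c ^ 2) := by
    rw [hc2]; ring
  rw [this, ENNReal.ofReal_mul (by positivity), mul_assoc, ← hk,
    ← lintegral_const_mul' _ _ ENNReal.ofReal_ne_top]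
  refine lintegral_congr fun ξ => ?_
  rw [← ENNReal.ofReal_mul (by positivity)]
  congr 1
  simp [PiLp.inner_apply, Fin.sum_univ_two, abs_mul, mul_pow]
  ring

end LinearFormMoments

section NormMoments

/-- The `2 D`-th moment of the norm of a standard Gaussian vector in dimension `m + 1`. -/
noncomputable def normMoment (m D : ℕ) : ENNReal :=
  ∫⁻ y, ENNReal.ofReal (‖y‖ ^ (2 * D)) ∂stdGaussian (EuclideanSpace ℝ (Fin (m + 1)))

lemma normMoment_zero (m : ℕ) : normMoment m 0 = 1 := by simp [normMoment]

lemma normMoment_succ (m D : ℕ) :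
    normMoment m (D + 1) = ((m + 1 + 2 * D : ℕ) : ENNReal) * normMoment m D := by
  have hf : Measurable fun ξ : EuclideanSpace ℝ (Fin (m + 1)) =>
    ENNReal.ofReal (‖ξ‖ ^ (2 * D)) := by fun_prop
  have h := lintegral_norm_sq_mul_stdGaussian hf (2 * D) (by simp) (fun r hr x => by
    rw [← ENNReal.ofReal_mul (by positivity), norm_smul, Real.norm_of_nonneg hr.le, mul_pow])
  rw [finrank_euclideanSpace_fin] at h
  rw [normMoment, normMoment, ← h]
  refine lintegral_congr fun x => ?_
  rw [← ENNReal.ofReal_mul (by positivity)]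
  congr 1; ring

lemma normMoment_ne_top (m D : ℕ) : normMoment m D ≠ ⊤ := by
  induction D with
  | zero => simp [normMoment_zero]
  | succ D ih => rw [normMoment_succ]; exact ENNReal.mul_ne_top (ENNReal.natCast_ne_top _) ih

lemma toReal_absMoment_two_mul_succ (D : ℕ) :
    (absMoment (2 * (D + 1))).toReal = (2 * D + 1) * (absMoment (2 * D)).toReal := by
  rw [mul_add, mul_one, absMoment_add_two, ENNReal.toReal_mul, ENNReal.toReal_natCast]
  push_cast; ring

lemma toReal_normMoment_succ (m D : ℕ) :
    (normMoment m (D + 1)).toReal = (m + 1 + 2 * D) * (normMoment m D).toReal := by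
  rw [normMoment_succ, ENNReal.toReal_mul, ENNReal.toReal_natCast]
  push_cast; ring

lemma toReal_absMoment_two_mul_pos (D : ℕ) : 0 < (absMoment (2 * D)).toReal := by
  induction D with
  | zero => simp [absMoment_zero]
  | succ D ih => rw [toReal_absMoment_two_mul_succ]; positivity

lemma toReal_normMoment_le (m D : ℕ) :
    (normMoment m (D + 1)).toReal
      ≤ (m + 1) * √(D + 1 : ℝ) ^ m * (absMoment (2 * (D + 1))).toReal := by
  induction D with
  | zero =>
    rw [toReal_normMoment_succ, toReal_absMoment_two_mul_succ]
    simp [normMoment_zero, absMoment_zero]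
  | succ D ih =>
    have hA := toReal_absMoment_two_mul_pos (D + 1)
    rw [toReal_normMoment_succ, toReal_absMoment_two_mul_succ]
    push_cast
    set i : ℝ := (D : ℝ) + 1 with hi
    have hi0 : 0 < i := by positivity
    have h1 : (1 + 1 / (2 * i + 1)) * √i ≤ √(i + 1) := by
      refine Real.le_sqrt_of_sq_le ?_
      rw [mul_pow, Real.sq_sqrt hi0.le]
      have : 1 + 1 / (2 * i + 1) = (2 * i + 2) / (2 * i + 1) := by field_simp; ring
      rw [this, div_pow, div_mul_eq_mul_div, div_le_iff₀ (by positivity)]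
      nlinarith
    have h2 : 1 + (m : ℝ) * (1 / (2 * i + 1)) ≤ (1 + 1 / (2 * i + 1)) ^ m :=
      one_add_mul_le_pow (by have : 0 < 1 / (2 * i + 1) := by positivity
                             linarith) m
    have h3 : (m + 1 + 2 * i) * √i ^ m ≤ √(i + 1) ^ m * (2 * i + 1) := by
      calc (m + 1 + 2 * i) * √i ^ m = (1 + (m : ℝ) * (1 / (2 * i + 1))) * √i ^ m * (2 * i + 1) := by
            field_simp; ring
        _ ≤ (1 + 1 / (2 * i + 1)) ^ m * √i ^ m * (2 * i + 1) := by gcongr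
        _ = ((1 + 1 / (2 * i + 1)) * √i) ^ m * (2 * i + 1) := by rw [mul_pow]
        _ ≤ _ := by gcongr
    calc (m + 1 + 2 * i) * (normMoment m (D + 1)).toReal
        ≤ (m + 1 + 2 * i) * ((m + 1) * √i ^ m * (absMoment (2 * (D + 1))).toReal) := by gcongr
      _ = (m + 1) * ((m + 1 + 2 * i) * √i ^ m) * (absMoment (2 * (D + 1))).toReal := by ring
      _ ≤ (m + 1) * (√(i + 1) ^ m * (2 * i + 1)) * (absMoment (2 * (D + 1))).toReal := by gcongr
      _ = _ := by ring

end NormMoments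

section RowUpdate

lemma measurePreserving_update_pi {ι X : Type*} [Fintype ι] [DecidableEq ι] [MeasurableSpace X]
    (μ : Measure X) [IsProbabilityMeasure μ] (i : ι) :
    MeasurePreserving (fun p : (ι → X) × X => Function.update p.1 i p.2)
      ((Measure.pi fun _ : ι => μ).prod μ) (Measure.pi fun _ : ι => μ) := by
  have hm : Measurable fun p : (ι → X) × X => Function.update p.1 i p.2 := by
    refine measurable_pi_lambda _ fun j => ?_
    by_cases h : j = i
    · subst h; simpa using measurable_snd
    · simp only [Function.update_of_ne h]
      exact (measurable_pi_apply j).comp measurable_fst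
  refine ⟨hm, (Measure.pi_eq fun s hs => ?_).symm⟩
  rw [Measure.map_apply hm (MeasurableSet.univ_pi hs)]
  have hpre : (fun p : (ι → X) × X => Function.update p.1 i p.2) ⁻¹' (Set.univ.pi s)
      = (Set.univ.pi (Function.update s i Set.univ)) ×ˢ s i := by
    ext ⟨f, x⟩
    simp only [Set.mem_preimage, Set.mem_univ_pi, Set.mem_prod]
    constructor
    · intro h
      refine ⟨fun j => ?_, by simpa using h i⟩
      by_cases hj : j = i
      · subst hj; simp
      · simpa [Function.update_of_ne hj] using h j
    · rintro ⟨h1, h2⟩ j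
      by_cases hj : j = i
      · subst hj; simpa using h2
      · simpa [Function.update_of_ne hj] using h1 j
  rw [hpre, Measure.prod_prod, Measure.pi_pi, ← Finset.mul_prod_erase _ _ (Finset.mem_univ i),
    ← Finset.mul_prod_erase _ (fun j => μ (s j)) (Finset.mem_univ i), Function.update_self,
    measure_univ, one_mul, mul_comm]
  congr 1
  refine Finset.prod_congr rfl fun j hj => ?_
  rw [Function.update_of_ne (Finset.ne_of_mem_erase hj)]

lemma lintegral_pi_update {ι X : Type*} [Fintype ι] [DecidableEq ι] [MeasurableSpace X]
    (μ : Measure X) [IsProbabilityMeasure μ] (i : ι) {G : (ι → X) → ENNReal} (hG : Measurable G) :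
    ∫⁻ Ξ, ∫⁻ ξ, G (Function.update Ξ i ξ) ∂μ ∂(Measure.pi fun _ : ι => μ)
      = ∫⁻ Ξ, G Ξ ∂(Measure.pi fun _ : ι => μ) := by
  have h := measurePreserving_update_pi μ i
  rw [← h.lintegral_comp hG]
  exact (lintegral_prod _ (hG.comp h.measurable).aemeasurable).symm

lemma exists_detSystem_update {m : ℕ} {E H : Type*} [NormedAddCommGroup E] [InnerProductSpace ℝ E]
    [NormedAddCommGroup H] [InnerProductSpace ℝ H] (A : E →L[ℝ] H) (w : Fin m → E)
    (Ξ : Fin m → H) (i : Fin m) :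
    ∃ u : E, ∀ ξ, detSystem (Function.update Ξ i ξ) (fun j => A (w j)) = inner ℝ ξ (A u) := by
  set B : Matrix (Fin m) (Fin m) ℝ := Matrix.of fun ℓ j => (inner ℝ (Ξ ℓ) (A (w j)) : ℝ) with hB
  set L : (Fin m → ℝ) →ₗ[ℝ] ℝ :=
    (Matrix.detRowAlternating (R := ℝ) (n := Fin m)).toMultilinearMap.toLinearMap B i with hL
  refine ⟨∑ j, L (Pi.single j 1) • w j, fun ξ => ?_⟩
  have h1 : (Matrix.of fun ℓ j => (inner ℝ (Function.update Ξ i ξ ℓ) (A (w j)) : ℝ))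
      = Function.update B i (fun j => inner ℝ ξ (A (w j))) := by
    ext ℓ j
    by_cases h : ℓ = i
    · subst h
      rw [Matrix.of_apply, Function.update_self]
      exact (congrFun (Function.update_self ℓ (fun j => (inner ℝ ξ (A (w j)) : ℝ)) B) j).symm
    · rw [Matrix.of_apply, Function.update_of_ne h]
      exact (congrFun (Function.update_of_ne h _ B) j).symm
  have h2 : detSystem (Function.update Ξ i ξ) (fun j => A (w j))
      = L fun j => inner ℝ ξ (A (w j)) := by
    rw [detSystem, h1]; rfl
  rw [h2, LinearMap.pi_apply_eq_sum_univ, map_sum, inner_sum]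
  refine Finset.sum_congr rfl fun j _ => ?_
  rw [_root_.map_smul, real_inner_smul_right, smul_eq_mul, mul_comm]
  congr 2
  ext k
  simp [Pi.single_apply, eq_comm]

end RowUpdate

section QuadraticFunctional

variable {n d : ℕ} {H : Type*} [NormedAddCommGroup H] [InnerProductSpace ℝ H]
  [FiniteDimensional ℝ H] [MeasurableSpace H] [BorelSpace H]
  {e : EuclideanSpace ℝ (Fin (n + 1)) → H}
  {e' : EuclideanSpace ℝ (Fin (n + 1)) → EuclideanSpace ℝ (Fin (n + 1)) →L[ℝ] H}

/-- The Gaussian mean square of the linear form `ξ` over the image of the feature map. -/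
noncomputable def meanSquare (e : EuclideanSpace ℝ (Fin (n + 1)) → H) (ξ : H) : ENNReal :=
  ∫⁻ y, ENNReal.ofReal (inner ℝ ξ (e y) ^ 2) ∂stdGaussian (EuclideanSpace ℝ (Fin (n + 1)))

omit [FiniteDimensional ℝ H] in
lemma measurable_meanSquare (he : IsPowerFeature d e e') : Measurable (meanSquare e) := by
  have hc := he.continuous
  have : Measurable fun p : H × EuclideanSpace ℝ (Fin (n + 1)) =>
      ENNReal.ofReal (inner ℝ p.1 (e p.2) ^ 2) := by
    refine (Continuous.measurable ?_).ennreal_ofReal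
    exact (continuous_fst.inner (hc.comp continuous_snd)).pow 2
  exact this.lintegral_prod_right'

lemma lintegral_inner_sq_mul_inner_sq (a b : H) :
    ∫⁻ ξ, ENNReal.ofReal (inner ℝ ξ a ^ 2 * inner ℝ ξ b ^ 2) ∂stdGaussian H
      = ENNReal.ofReal (‖a‖ ^ 2 * ‖b‖ ^ 2 + 2 * inner ℝ a b ^ 2) := by
  by_cases ha : a = 0
  · simp [ha]
  have h := lintegral_abs_inner_pow_mul_inner_sq ha b 2
  have h2 : absMoment 2 = 1 := by rw [absMoment_add_two 0, absMoment_zero]; simp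
  simp only [sq_abs] at h
  rw [h, h2, mul_one]
  congr 1
  have := norm_ne_zero_iff.2 ha
  push_cast
  field_simp

lemma lintegral_meanSquare (he : IsPowerFeature d e e') :
    ∫⁻ ξ, meanSquare e ξ ∂stdGaussian H = normMoment n (d + 2) := by
  have hc := he.continuous
  have hm : Measurable fun p : H × EuclideanSpace ℝ (Fin (n + 1)) =>
      ENNReal.ofReal (inner ℝ p.1 (e p.2) ^ 2) := by
    refine (Continuous.measurable ?_).ennreal_ofReal
    exact (continuous_fst.inner (hc.comp continuous_snd)).pow 2
  simp only [meanSquare]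
  rw [lintegral_lintegral_swap hm.aemeasurable, normMoment]
  refine lintegral_congr fun y => ?_
  have h := lintegral_abs_inner_pow (e y) 2
  have h2 : absMoment 2 = 1 := by rw [absMoment_add_two 0, absMoment_zero]; simp
  simp only [sq_abs] at h
  rw [h, h2, mul_one, he.norm_eq, ← pow_mul, mul_comm]

lemma lintegral_inner_pow_even (x : H) (k : ℕ) :
    ∫⁻ y, ENNReal.ofReal (inner ℝ y x ^ (2 * k)) ∂stdGaussian H
      = ENNReal.ofReal (‖x‖ ^ (2 * k)) * absMoment (2 * k) := by
  rw [← lintegral_abs_inner_pow]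
  refine lintegral_congr fun y => ?_
  rw [(even_two_mul k).pow_abs]

lemma lintegral_meanSquare_sq (he : IsPowerFeature d e e') :
    ∫⁻ ξ, meanSquare e ξ * meanSquare e ξ ∂stdGaussian H
      = normMoment n (d + 2) * (normMoment n (d + 2) + 2 * absMoment (2 * (d + 2))) := by
  have hc := he.continuous
  set γ := stdGaussian (EuclideanSpace ℝ (Fin (n + 1))) with hγ
  have hm3 : Measurable fun p : H × EuclideanSpace ℝ (Fin (n + 1)) =>
      ENNReal.ofReal (inner ℝ p.1 (e p.2) ^ 2) := by
    refine (Continuous.measurable ?_).ennreal_ofReal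
    exact (continuous_fst.inner (hc.comp continuous_snd)).pow 2
  have hms : ∀ ξ : H, Measurable fun y => ENNReal.ofReal (inner ℝ ξ (e y) ^ 2) := fun ξ =>
    hm3.comp measurable_prodMk_left
  have hsq : ∀ ξ, meanSquare e ξ * meanSquare e ξ
      = ∫⁻ y, ∫⁻ y', ENNReal.ofReal (inner ℝ ξ (e y) ^ 2 * inner ℝ ξ (e y') ^ 2) ∂γ ∂γ := by
    intro ξ
    have hd : meanSquare e ξ * meanSquare e ξ
        = (∫⁻ y, ENNReal.ofReal (inner ℝ ξ (e y) ^ 2) ∂γ) * meanSquare e ξ := rfl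
    rw [hd, ← lintegral_mul_const _ (hms ξ)]
    refine lintegral_congr fun y => ?_
    rw [meanSquare, ← lintegral_const_mul _ (hms ξ)]
    refine lintegral_congr fun y' => ?_
    rw [← ENNReal.ofReal_mul (by positivity)]
  have hm4 : Measurable fun p : (H × EuclideanSpace ℝ (Fin (n + 1))) ×
      EuclideanSpace ℝ (Fin (n + 1)) =>
      ENNReal.ofReal (inner ℝ p.1.1 (e p.1.2) ^ 2 * inner ℝ p.1.1 (e p.2) ^ 2) := by
    refine (Continuous.measurable ?_).ennreal_ofReal
    exact (((continuous_fst.comp continuous_fst).inner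
      (hc.comp (continuous_snd.comp continuous_fst))).pow 2).mul
      (((continuous_fst.comp continuous_fst).inner (hc.comp continuous_snd)).pow 2)
  have hm5 : ∀ y, Measurable fun p : H × EuclideanSpace ℝ (Fin (n + 1)) =>
      ENNReal.ofReal (inner ℝ p.1 (e y) ^ 2 * inner ℝ p.1 (e p.2) ^ 2) := fun y => by
    refine (Continuous.measurable ?_).ennreal_ofReal
    exact ((continuous_fst.inner continuous_const).pow 2).mul
      ((continuous_fst.inner (hc.comp continuous_snd)).pow 2)
  simp only [hsq]
  rw [lintegral_lintegral_swap hm4.lintegral_prod_right'.aemeasurable]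
  have hy : ∀ y, ∫⁻ ξ, ∫⁻ y', ENNReal.ofReal (inner ℝ ξ (e y) ^ 2 * inner ℝ ξ (e y') ^ 2) ∂γ
        ∂stdGaussian H
      = ENNReal.ofReal (‖y‖ ^ (2 * (d + 2))) *
        (normMoment n (d + 2) + 2 * absMoment (2 * (d + 2))) := by
    intro y
    rw [lintegral_lintegral_swap (hm5 y).aemeasurable]
    have h1 : ∀ y', ∫⁻ ξ, ENNReal.ofReal (inner ℝ ξ (e y) ^ 2 * inner ℝ ξ (e y') ^ 2)
        ∂stdGaussian H = ENNReal.ofReal (‖y‖ ^ (2 * (d + 2))) *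
          ENNReal.ofReal (‖y'‖ ^ (2 * (d + 2))) +
          ENNReal.ofReal 2 * ENNReal.ofReal (inner ℝ y' y ^ (2 * (d + 2))) := fun y' => by
      have h0 : 0 ≤ (inner ℝ y' y : ℝ) ^ (2 * (d + 2)) := (even_two_mul _).pow_nonneg _
      rw [lintegral_inner_sq_mul_inner_sq, ← ENNReal.ofReal_mul (by positivity),
        ← ENNReal.ofReal_mul (by positivity), ← ENNReal.ofReal_add (by positivity) (by positivity), he.norm_eq, he.norm_eq,
        he.inner_eq, real_inner_comm y' y]
      congr 1; ring
    simp only [h1]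
    have m1 : Measurable fun y' : EuclideanSpace ℝ (Fin (n + 1)) =>
      ENNReal.ofReal (‖y‖ ^ (2 * (d + 2))) * ENNReal.ofReal (‖y'‖ ^ (2 * (d + 2))) := by fun_prop
    rw [lintegral_add_left m1, lintegral_const_mul' _ _ ENNReal.ofReal_ne_top,
      lintegral_const_mul' _ _ ENNReal.ofReal_ne_top, lintegral_inner_pow_even, ENNReal.ofReal_ofNat]
    simp only [normMoment, hγ]; ring
  simp only [hy]
  have m2 : Measurable fun y : EuclideanSpace ℝ (Fin (n + 1)) =>
    ENNReal.ofReal (‖y‖ ^ (2 * (d + 2))) := by fun_prop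
  rw [lintegral_mul_const _ m2]
  rfl

omit [FiniteDimensional ℝ H] [MeasurableSpace H] [BorelSpace H] in
lemma lintegral_norm_projVec_sq_add (he : IsPowerFeature d e e')
    {x : EuclideanSpace ℝ (Fin (n + 1))} (hx : x ≠ 0) :
    ∫⁻ y, ENNReal.ofReal (‖projVec (e x) (e y)‖ ^ 2)
        ∂stdGaussian (EuclideanSpace ℝ (Fin (n + 1))) + absMoment (2 * (d + 2))
      = normMoment n (d + 2) := by
  have hx0 : 0 < ‖x‖ := norm_pos_iff.2 hx
  have hmu : absMoment (2 * (d + 2)) = ∫⁻ y, ENNReal.ofReal ((‖x‖ ^ (2 * (d + 2)))⁻¹) *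
      ENNReal.ofReal (inner ℝ y x ^ (2 * (d + 2)))
        ∂stdGaussian (EuclideanSpace ℝ (Fin (n + 1))) := by
    rw [lintegral_const_mul' _ _ ENNReal.ofReal_ne_top, lintegral_inner_pow_even, ← mul_assoc,
      ← ENNReal.ofReal_mul (by positivity), inv_mul_cancel₀ (by positivity), ENNReal.ofReal_one,
      one_mul]
  have hm : Measurable fun y => ENNReal.ofReal (‖projVec (e x) (e y)‖ ^ 2) :=
    (((projVec (e x)).continuous.comp he.continuous).norm.pow 2).measurable.ennreal_ofReal
  rw [hmu, ← lintegral_add_left hm, normMoment]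
  refine lintegral_congr fun y => ?_
  have h0 : 0 ≤ (inner ℝ y x : ℝ) ^ (2 * (d + 2)) := (even_two_mul _).pow_nonneg _
  rw [← ENNReal.ofReal_mul (by positivity), ← ENNReal.ofReal_add (by positivity) (by positivity),
    ← real_inner_self_eq_norm_sq, inner_projVec_projVec, he.inner_eq, he.inner_eq, he.norm_eq,
    real_inner_self_eq_norm_sq]
  congr 1
  have := hx0.ne'
  field_simp
  ring

omit [FiniteDimensional ℝ H] [MeasurableSpace H] [BorelSpace H] in
lemma lintegral_inner_projVec_sq (he : IsPowerFeature d e e')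
    {x u : EuclideanSpace ℝ (Fin (n + 1))} (hx : x ≠ 0) (hu : projVec (e x) (e' x u) ≠ 0) :
    ∫⁻ y, ENNReal.ofReal ((inner ℝ (projVec (e x) (e' x u)) (projVec (e x) (e y)) /
        ‖projVec (e x) (e' x u)‖) ^ 2) ∂stdGaussian (EuclideanSpace ℝ (Fin (n + 1)))
      = ENNReal.ofReal (d + 2) * absMoment (2 * (d + 1)) := by
  have hx0 : 0 < ‖x‖ := norm_pos_iff.2 hx
  set v := projVec x u with hv
  have hvx : inner ℝ v x = 0 := inner_projVec_self x u
  have h1 : projVec (e x) (e' x u) = e' x v := by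
    have h2 : projVec (e x) (e' x u) = projVec (e x) (e' x v) := by
      rw [hv, projVec_apply x u, map_sub, map_sub, _root_.map_smul, _root_.map_smul,
        he.projVec_fderiv_self, smul_zero, sub_zero]
    rw [h2, projVec_apply, he.inner_fderiv_left, hvx, mul_zero, zero_div, zero_smul, sub_zero]
  have hnv : ‖e' x v‖ ^ 2 = (d + 2) * ‖x‖ ^ (2 * (d + 1)) * ‖v‖ ^ 2 := by
    rw [← real_inner_self_eq_norm_sq, he.inner_fderiv_fderiv, hvx, real_inner_self_eq_norm_sq,
      real_inner_self_eq_norm_sq]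
    ring
  have hv0 : 0 < ‖v‖ := by
    refine norm_pos_iff.2 fun h => hu ?_
    rw [h1, h, map_zero]
  have hin : ∀ y, (inner ℝ (projVec (e x) (e' x u)) (projVec (e x) (e y)) /
        ‖projVec (e x) (e' x u)‖) ^ 2
      = (d + 2) / (‖x‖ ^ (2 * (d + 1)) * ‖v‖ ^ 2) *
        (|inner ℝ y x| ^ (2 * (d + 1)) * inner ℝ y v ^ 2) := fun y => by
    rw [div_pow, ← inner_projVec_symm, h1, projVec_apply, he.inner_fderiv_left, hvx, mul_zero,
      zero_div, zero_smul, sub_zero, he.inner_fderiv_left, hnv, (even_two_mul _).pow_abs,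
      real_inner_comm x y, real_inner_comm v y]
    field_simp
    ring
  simp only [hin]
  have hc : ∀ y : EuclideanSpace ℝ (Fin (n + 1)),
      ENNReal.ofReal ((d + 2) / (‖x‖ ^ (2 * (d + 1)) * ‖v‖ ^ 2) *
        (|inner ℝ y x| ^ (2 * (d + 1)) * inner ℝ y v ^ 2))
      = ENNReal.ofReal ((d + 2) / (‖x‖ ^ (2 * (d + 1)) * ‖v‖ ^ 2)) *
        ENNReal.ofReal (|inner ℝ y x| ^ (2 * (d + 1)) * inner ℝ y v ^ 2) := fun y =>
    ENNReal.ofReal_mul (by positivity)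
  simp only [hc]
  rw [lintegral_const_mul' _ _ ENNReal.ofReal_ne_top, lintegral_abs_inner_pow_mul_inner_sq hx,
    real_inner_comm, hvx, ← mul_assoc, ← ENNReal.ofReal_mul (by positivity)]
  congr 2
  have := hx0.ne'
  have := hv0.ne'
  field_simp
  simp

/-- The mean of `meanSquare` of a linear form conditioned to vanish at a point and weighted by the
modulus of one of its tangential derivatives there. -/
noncomputable def tiltedMeanSquare (e : EuclideanSpace ℝ (Fin (n + 1)) → H) (d : ℕ)
    (x : EuclideanSpace ℝ (Fin (n + 1))) : ENNReal :=
  ∫⁻ y, ENNReal.ofReal (‖projVec (e x) (e y)‖ ^ 2)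
    ∂stdGaussian (EuclideanSpace ℝ (Fin (n + 1))) + ENNReal.ofReal (d + 2) * absMoment (2 * (d + 1))

lemma lintegral_abs_inner_mul_meanSquare (he : IsPowerFeature d e e')
    {x : EuclideanSpace ℝ (Fin (n + 1))} (hx : x ≠ 0) (u : EuclideanSpace ℝ (Fin (n + 1))) :
    ∫⁻ ξ, ENNReal.ofReal |inner ℝ ξ (projVec (e x) (e' x u))| * meanSquare e (projVec (e x) ξ)
        ∂stdGaussian H
      = tiltedMeanSquare e d x *
        ∫⁻ ξ, ENNReal.ofReal |inner ℝ ξ (projVec (e x) (e' x u))| ∂stdGaussian H := by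
  by_cases hu : projVec (e x) (e' x u) = 0
  · simp [hu]
  rw [tiltedMeanSquare, ← lintegral_inner_projVec_sq he hx hu]
  set w := projVec (e x) (e' x u) with hw
  have hcp : Continuous fun y => projVec (e x) (e y) :=
    (projVec (e x)).continuous.comp he.continuous
  have hm : Measurable fun p : H × EuclideanSpace ℝ (Fin (n + 1)) =>
      ENNReal.ofReal (|inner ℝ p.1 w| ^ 1 * inner ℝ p.1 (projVec (e x) (e p.2)) ^ 2) := by
    refine (Continuous.measurable ?_).ennreal_ofReal
    exact ((continuous_fst.inner continuous_const).abs.pow 1).mul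
      ((continuous_fst.inner (hcp.comp continuous_snd)).pow 2)
  have h1 : ∀ ξ, ENNReal.ofReal |inner ℝ ξ w| * meanSquare e (projVec (e x) ξ)
      = ∫⁻ y, ENNReal.ofReal (|inner ℝ ξ w| ^ 1 * inner ℝ ξ (projVec (e x) (e y)) ^ 2)
        ∂stdGaussian (EuclideanSpace ℝ (Fin (n + 1))) := fun ξ => by
    rw [meanSquare, ← lintegral_const_mul' _ _ ENNReal.ofReal_ne_top]
    refine lintegral_congr fun y => ?_
    rw [← ENNReal.ofReal_mul (abs_nonneg _), inner_projVec_symm, pow_one]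
  simp only [h1]
  rw [lintegral_lintegral_swap hm.aemeasurable]
  have hm2 : Measurable fun y => ENNReal.ofReal (‖projVec (e x) (e y)‖ ^ 2) :=
    (hcp.norm.pow 2).measurable.ennreal_ofReal
  have hm3 : Measurable fun y => ENNReal.ofReal (‖projVec (e x) (e y)‖ ^ 2)
      + ENNReal.ofReal ((inner ℝ w (projVec (e x) (e y)) / ‖w‖) ^ 2) :=
    hm2.add (((continuous_const.inner hcp).div_const _).pow 2).measurable.ennreal_ofReal
  have h3 := lintegral_abs_inner_pow w 1
  simp only [pow_one] at h3
  rw [h3, ← lintegral_add_left hm2, ← lintegral_mul_const _ hm3]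
  refine lintegral_congr fun y => ?_
  rw [lintegral_abs_inner_pow_mul_inner_sq hu, ← ENNReal.ofReal_add (by positivity) (by positivity),
    ← mul_assoc, ← ENNReal.ofReal_mul (by positivity)]
  congr 2
  push_cast; ring

end QuadraticFunctional

section TiltedMeanSquare

variable {n d : ℕ} {H : Type*} [NormedAddCommGroup H] [InnerProductSpace ℝ H]
  {e : EuclideanSpace ℝ (Fin (n + 1)) → H}
  {e' : EuclideanSpace ℝ (Fin (n + 1)) → EuclideanSpace ℝ (Fin (n + 1)) →L[ℝ] H}

lemma tiltedMeanSquare_eq [FiniteDimensional ℝ H] [MeasurableSpace H] [BorelSpace H]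
    (he : IsPowerFeature d e e') {x : EuclideanSpace ℝ (Fin (n + 1))} (hx : x ≠ 0) :
    tiltedMeanSquare e d x = ENNReal.ofReal ((normMoment n (d + 2)).toReal
      - (d + 1) * (absMoment (2 * (d + 1))).toReal) := by
  have h := lintegral_norm_projVec_sq_add he hx
  have hA := absMoment_ne_top (2 * (d + 1))
  have hT : tiltedMeanSquare e d x ≠ ⊤ := by
    refine ENNReal.add_ne_top.2 ⟨ne_top_of_le_ne_top (normMoment_ne_top n (d + 2)) ?_,
      ENNReal.mul_ne_top ENNReal.ofReal_ne_top hA⟩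
    rw [← h]; exact le_self_add
  have h1 : tiltedMeanSquare e d x + absMoment (2 * (d + 2))
      = normMoment n (d + 2) + ENNReal.ofReal (d + 2) * absMoment (2 * (d + 1)) := by
    rw [← h, tiltedMeanSquare]; ring
  have h2 := congrArg ENNReal.toReal h1
  rw [ENNReal.toReal_add hT (absMoment_ne_top _), ENNReal.toReal_add (normMoment_ne_top _ _)
    (ENNReal.mul_ne_top ENNReal.ofReal_ne_top hA), ENNReal.toReal_mul,
    ENNReal.toReal_ofReal (by positivity), toReal_absMoment_two_mul_succ (d + 1)] at h2
  rw [← ENNReal.ofReal_toReal hT]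
  congr 1
  push_cast at h2
  linarith

end TiltedMeanSquare

section Correlation

variable {n d : ℕ} {H : Type*} [NormedAddCommGroup H] [InnerProductSpace ℝ H]
  [FiniteDimensional ℝ H] [MeasurableSpace H] [BorelSpace H]
  {e : EuclideanSpace ℝ (Fin (n + 2)) → H}
  {e' : EuclideanSpace ℝ (Fin (n + 2)) → EuclideanSpace ℝ (Fin (n + 2)) →L[ℝ] H}

lemma lintegral_detSystem_mul_meanSquare (he : IsPowerFeature d e e')
    {x : EuclideanSpace ℝ (Fin (n + 2))} (hx : x ≠ 0)
    (w : Fin (n + 1) → EuclideanSpace ℝ (Fin (n + 2))) :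
    ∫⁻ Ξ, ENNReal.ofReal |detSystem (projSystem (e x) Ξ) fun j => e' x (w j)| *
        meanSquare e (projSystem (e x) Ξ 0) ∂gaussianSystem (n + 1) H
      = tiltedMeanSquare e d x *
        ∫⁻ Ξ, ENNReal.ofReal |detSystem (projSystem (e x) Ξ) fun j => e' x (w j)|
          ∂gaussianSystem (n + 1) H := by
  simp only [detSystem_projSystem, projSystem_apply]
  have hm1 : Measurable fun Ξ : Fin (n + 1) → H =>
      ENNReal.ofReal |detSystem Ξ fun j => projVec (e x) (e' x (w j))| :=
    (measurable_detSystem measurable_id measurable_const).abs.ennreal_ofReal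
  have hm2 : Measurable fun Ξ : Fin (n + 1) → H => meanSquare e (projVec (e x) (Ξ 0)) :=
    (measurable_meanSquare he).comp ((projVec (e x)).measurable.comp (measurable_pi_apply 0))
  have hm3 : Measurable fun Ξ : Fin (n + 1) → H =>
      ENNReal.ofReal |detSystem Ξ fun j => projVec (e x) (e' x (w j))| *
        meanSquare e (projVec (e x) (Ξ 0)) := hm1.mul hm2
  rw [← lintegral_pi_update _ 0 hm1, ← lintegral_pi_update _ 0 hm3, ← lintegral_const_mul']
  · refine lintegral_congr fun Ξ => ?_
    obtain ⟨u, hu⟩ := exists_detSystem_update ((projVec (e x)).comp (e' x)) w Ξ 0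
    simp only [ContinuousLinearMap.comp_apply] at hu
    simp only [hu, Function.update_self]
    exact lintegral_abs_inner_mul_meanSquare he hx u
  · rw [tiltedMeanSquare_eq he hx]; exact ENNReal.ofReal_ne_top

lemma lintegral_zeroCount_mul_meanSquare (he : IsPowerFeature d e e') :
    ∫⁻ Ξ, zeroCount e Ξ * meanSquare e (Ξ 0) ∂gaussianSystem (n + 1) H
      = ENNReal.ofReal ((normMoment (n + 1) (d + 2)).toReal
        - (d + 1) * (absMoment (2 * (d + 1))).toReal) *
        ∫⁻ Ξ, zeroCount e Ξ ∂gaussianSystem (n + 1) H := by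
  have h1 := kacRice_feature he (F := fun _ => 1) measurable_const
  simp only [mul_one] at h1
  have h2 := kacRice_feature he (F := fun Ξ => meanSquare e (Ξ 0))
    ((measurable_meanSquare he).comp (measurable_pi_apply 0))
  rw [h1, h2, ← lintegral_const_mul' _ _ ENNReal.ofReal_ne_top]
  refine lintegral_congr fun t => ?_
  rw [lintegral_detSystem_mul_meanSquare he (affineLift_ne_zero t),
    tiltedMeanSquare_eq he (affineLift_ne_zero t)]
  ring

lemma lintegral_gaussianSystem_eval {m : ℕ} {F : H → ENNReal} (hF : Measurable F) (i : Fin m) :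
    ∫⁻ Ξ, F (Ξ i) ∂gaussianSystem m H = ∫⁻ ξ, F ξ ∂stdGaussian H :=
  (measurePreserving_eval (fun _ : Fin m => stdGaussian H) i).lintegral_comp hF

lemma covariance_sq_le_variance_mul_variance {Ω : Type*} [MeasurableSpace Ω] {μ : Measure Ω}
    [IsProbabilityMeasure μ] {X Y : Ω → ℝ} (hX : MemLp X 2 μ) (hY : MemLp Y 2 μ) :
    covariance X Y μ ^ 2 ≤ variance X μ * variance Y μ := by
  have h : ∀ t : ℝ, 0 ≤ variance Y μ * (t * t) + 2 * covariance X Y μ * t + variance X μ := by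
    intro t
    have h1 := variance_nonneg (X + fun ω => t * Y ω) μ
    rw [variance_add hX (hY.const_mul t), variance_const_mul, covariance_const_mul_right] at h1
    linarith
  have := discrim_le_zero h
  rw [discrim] at this
  linarith

/-- Cauchy--Schwarz lower bound of the variance through the covariance with `meanSquare`. -/
theorem sq_integral_zeroCount_le (he : IsPowerFeature d e e')
    (hN : MemLp (fun Ξ => (zeroCount e Ξ).toReal) 2 (gaussianSystem (n + 1) H)) :
    ((∫ Ξ, (zeroCount e Ξ).toReal ∂gaussianSystem (n + 1) H) *
        ((d + 1) * (absMoment (2 * (d + 1))).toReal)) ^ 2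
      ≤ variance (fun Ξ => (zeroCount e Ξ).toReal) (gaussianSystem (n + 1) H) *
        (2 * (normMoment (n + 1) (d + 2)).toReal * (absMoment (2 * (d + 2))).toReal) := by
  set μ := gaussianSystem (n + 1) H with hμ
  set M := (normMoment (n + 1) (d + 2)).toReal with hM
  set A := (absMoment (2 * (d + 1))).toReal with hA
  set A' := (absMoment (2 * (d + 2))).toReal with hA'
  have hmQ := measurable_meanSquare he
  have hmQ2 : Measurable fun ξ => meanSquare e ξ * meanSquare e ξ := hmQ.mul hmQ
  have hmX : Measurable fun Ξ : Fin (n + 1) → H => meanSquare e (Ξ 0) :=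
    hmQ.comp (measurable_pi_apply 0)
  have hmX2 : Measurable fun Ξ : Fin (n + 1) → H => meanSquare e (Ξ 0) * meanSquare e (Ξ 0) :=
    hmX.mul hmX
  have hmN := measurable_zeroCount he
  have hmNX : Measurable fun Ξ : Fin (n + 1) → H => zeroCount e Ξ * meanSquare e (Ξ 0) :=
    hmN.mul hmX
  have hMt := normMoment_ne_top (n + 1) (d + 2)
  have hAt' := absMoment_ne_top (2 * (d + 2))
  have hX1 : ∫⁻ Ξ, meanSquare e (Ξ 0) ∂μ = normMoment (n + 1) (d + 2) := by
    rw [lintegral_gaussianSystem_eval hmQ, lintegral_meanSquare he]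
  have hX2 : ∫⁻ Ξ, meanSquare e (Ξ 0) * meanSquare e (Ξ 0) ∂μ
      = normMoment (n + 1) (d + 2) * (normMoment (n + 1) (d + 2) + 2 * absMoment (2 * (d + 2))) := by
    rw [lintegral_gaussianSystem_eval hmQ2, lintegral_meanSquare_sq he]
  have hX2t : ∫⁻ Ξ, meanSquare e (Ξ 0) * meanSquare e (Ξ 0) ∂μ ≠ ⊤ := by
    rw [hX2]
    exact ENNReal.mul_ne_top hMt (ENNReal.add_ne_top.2 ⟨hMt,
      ENNReal.mul_ne_top ENNReal.ofNat_ne_top hAt'⟩)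
  have hNX := lintegral_zeroCount_mul_meanSquare he
  have hNXt : ∫⁻ Ξ, zeroCount e Ξ * meanSquare e (Ξ 0) ∂μ ≠ ⊤ := by
    rw [hNX]; exact ENNReal.mul_ne_top ENNReal.ofReal_ne_top (lintegral_zeroCount_ne_top he)
  have iX : ∫ Ξ, (meanSquare e (Ξ 0)).toReal ∂μ = M := by
    rw [integral_toReal hmX.aemeasurable (ae_lt_top hmX (by rw [hX1]; exact hMt)), hX1]
  have iX2 : ∫ Ξ, (meanSquare e (Ξ 0) * meanSquare e (Ξ 0)).toReal ∂μ = M * (M + 2 * A') := by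
    rw [integral_toReal hmX2.aemeasurable (ae_lt_top hmX2 hX2t), hX2, ENNReal.toReal_mul,
      ENNReal.toReal_add hMt (ENNReal.mul_ne_top ENNReal.ofNat_ne_top hAt'), ENNReal.toReal_mul,
      ENNReal.toReal_ofNat]
  have hLX : MemLp (fun Ξ : Fin (n + 1) → H => (meanSquare e (Ξ 0)).toReal) 2 μ := by
    rw [memLp_two_iff_integrable_sq hmX.ennreal_toReal.aestronglyMeasurable]
    have := integrable_toReal_of_lintegral_ne_top hmX2.aemeasurable hX2t
    refine this.congr (Eventually.of_forall fun Ξ => ?_)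
    simp only [ENNReal.toReal_mul, sq]
  have hVX : variance (fun Ξ : Fin (n + 1) → H => (meanSquare e (Ξ 0)).toReal) μ
      = 2 * M * A' := by
    have h3 : μ[(fun Ξ : Fin (n + 1) → H => (meanSquare e (Ξ 0)).toReal) ^ 2]
        = ∫ Ξ, (meanSquare e (Ξ 0) * meanSquare e (Ξ 0)).toReal ∂μ := by
      refine integral_congr_ae (Eventually.of_forall fun Ξ => ?_)
      simp only [ENNReal.toReal_mul, sq, Pi.mul_apply]
    rw [variance_eq_sub hLX, h3, iX2, iX]
    ring
  have hC : 0 ≤ M - (d + 1) * A := by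
    have h := lintegral_norm_projVec_sq_add he
      (x := EuclideanSpace.single 0 (1 : ℝ)) (by simp)
    have h1 : absMoment (2 * (d + 2)) ≤ normMoment (n + 1) (d + 2) := by
      rw [← h]; exact le_add_self
    have h2 : A' ≤ M := ENNReal.toReal_mono hMt h1
    have h3 : A' = (2 * (d + 1 : ℕ) + 1) * A := toReal_absMoment_two_mul_succ (d + 1)
    have h4 : 0 ≤ A := ENNReal.toReal_nonneg
    push_cast at h3
    nlinarith [mul_nonneg (Nat.cast_nonneg (α := ℝ) d) h4]
  have hcov : covariance (fun Ξ => (zeroCount e Ξ).toReal)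
      (fun Ξ : Fin (n + 1) → H => (meanSquare e (Ξ 0)).toReal) μ
      = - ((∫ Ξ, (zeroCount e Ξ).toReal ∂μ) * ((d + 1) * A)) := by
    rw [covariance_eq_sub hN hLX, iX]
    have h3 : μ[(fun Ξ => (zeroCount e Ξ).toReal) *
        (fun Ξ : Fin (n + 1) → H => (meanSquare e (Ξ 0)).toReal)]
        = ∫ Ξ, (zeroCount e Ξ * meanSquare e (Ξ 0)).toReal ∂μ := by
      refine integral_congr_ae (Eventually.of_forall fun Ξ => ?_)
      simp only [ENNReal.toReal_mul, Pi.mul_apply]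
    rw [h3, integral_toReal hmNX.aemeasurable (ae_lt_top hmNX hNXt), hNX, ENNReal.toReal_mul,
      ENNReal.toReal_ofReal hC, ← integral_toReal hmN.aemeasurable (ae_zeroCount_lt_top he)]
    ring
  have h := covariance_sq_le_variance_mul_variance hN hLX
  rw [hcov, hVX, neg_sq] at h
  exact h

end Correlation

section Positivity

lemma chartMass_toReal_pos (m : ℕ) : 0 < (chartMass m).toReal :=
  ENNReal.toReal_pos chartMass_ne_zero chartMass_ne_top

lemma gaussDetMoment_toReal_pos (m : ℕ) : 0 < (gaussDetMoment m).toReal :=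
  ENNReal.toReal_pos gaussDetMoment_ne_zero gaussDetMoment_ne_top

variable {n d : ℕ} {H : Type*} [NormedAddCommGroup H] [InnerProductSpace ℝ H]
  [FiniteDimensional ℝ H] [MeasurableSpace H] [BorelSpace H]
  {e : EuclideanSpace ℝ (Fin (n + 2)) → H}
  {e' : EuclideanSpace ℝ (Fin (n + 2)) → EuclideanSpace ℝ (Fin (n + 2)) →L[ℝ] H}

theorem variance_zeroCount_lower_bound (he : IsPowerFeature d e e')
    (hN : MemLp (fun Ξ => (zeroCount e Ξ).toReal) 2 (gaussianSystem (n + 1) H)) :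
    ((√(2 * π))⁻¹ ^ (n + 1) * (gaussDetMoment (n + 1)).toReal * (chartMass (n + 1)).toReal) ^ 2 /
        (18 * (n + 2))
      ≤ variance (fun Ξ => (zeroCount e Ξ).toReal) (gaussianSystem (n + 1) H)
        / √((d : ℝ) + 2) ^ (n + 1) := by
  have h := sq_integral_zeroCount_le he hN
  set V := variance (fun Ξ => (zeroCount e Ξ).toReal) (gaussianSystem (n + 1) H) with hV
  set K := (√(2 * π))⁻¹ ^ (n + 1) * (gaussDetMoment (n + 1)).toReal *
    (chartMass (n + 1)).toReal with hK
  have hV0 : 0 ≤ V := variance_nonneg _ _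
  have hM := toReal_normMoment_le (n + 1) (d + 1)
  have hA := toReal_absMoment_two_mul_pos (d + 1)
  have hA' := toReal_absMoment_two_mul_succ (d + 1)
  have hEN : ∫ Ξ, (zeroCount e Ξ).toReal ∂gaussianSystem (n + 1) H
      = √((d : ℝ) + 2) ^ (n + 1) * K := by
    rw [integral_zeroCount he, intensityConst, div_eq_mul_inv, mul_pow, hK]
    ring
  set s := √((d : ℝ) + 2) ^ (n + 1) with hs
  have hs0 : 0 < s := by positivity
  have hcast : ((d + 1 : ℕ) : ℝ) + 1 = (d : ℝ) + 2 := by push_cast; ring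
  rw [hcast, ← hs] at hM
  set A := (absMoment (2 * (d + 1))).toReal with hAdef
  rw [show d + 1 + 1 = d + 2 by ring] at hM hA'
  set A' := (absMoment (2 * (d + 2))).toReal with hAdef'
  set M := (normMoment (n + 1) (d + 2)).toReal
  rw [hEN] at h
  push_cast at hA' hM
  have hA'0 : 0 < A' := by rw [hA']; positivity
  have h1 : (s * K * ((d + 1) * A)) ^ 2 ≤ V * (2 * (((n : ℝ) + 1 + 1) * s * A') * A') := by
    refine h.trans ?_
    gcongr
  have h2 : A' ≤ 3 * ((d + 1) * A) := by
    rw [hA']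
    nlinarith [mul_nonneg (Nat.cast_nonneg (α := ℝ) d) hA.le]
  have h3 : V * (2 * (((n : ℝ) + 1 + 1) * s * A') * A')
      ≤ V * (2 * (((n : ℝ) + 1 + 1) * s * (3 * ((d + 1) * A))) * (3 * ((d + 1) * A))) := by
    gcongr
  have h4 : s * ((d + 1) * A) ^ 2 * (s * K ^ 2) ≤ s * ((d + 1) * A) ^ 2 * (V * (18 * (n + 2))) := by
    refine le_of_eq_of_le ?_ ((h1.trans h3).trans_eq ?_) <;> ring
  have h5 := le_of_mul_le_mul_left h4 (by positivity)
  rw [div_le_div_iff₀ (by positivity) hs0]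
  linarith

theorem exists_pos_tendsto_variance_zeroCount (n : ℕ) : ∃ L : ℝ, 0 < L ∧ Tendsto (fun d : ℕ =>
    variance (fun Ξ => (zeroCount (powerFeature (n + 1) (d + 2)) Ξ).toReal)
      (gaussianSystem (n + 1) (EuclideanSpace ℝ (multiIndex (n + 1) (d + 2))))
      / √((d : ℝ) + 2) ^ (n + 1)) atTop (nhds L) := by
  obtain ⟨L, hL⟩ := exists_tendsto_variance_zeroCount n
  have hpos : 0 < ((√(2 * π))⁻¹ ^ (n + 1) * (gaussDetMoment (n + 1)).toReal *
      (chartMass (n + 1)).toReal) ^ 2 / (18 * ((n : ℝ) + 2)) := by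
    have := chartMass_toReal_pos (n + 1)
    have := gaussDetMoment_toReal_pos (n + 1)
    have := Real.pi_pos
    positivity
  refine ⟨L, hpos.trans_le (ge_of_tendsto hL ?_), hL⟩
  filter_upwards [(exists_tendsto_integral_scaledKernel n).1] with d hd
  exact variance_zeroCount_lower_bound (isPowerFeature_powerFeature (n + 1) d)
    (variance_zeroCount (isPowerFeature_powerFeature (n + 1) d) (integrable_centred_kernel hd)).1

end Positivity

lemma measurePreserving_uncurry_mul_gaussianReal {ι κ : Type*} [Fintype ι] [Fintype κ]
    (v : ι × κ → NNReal) :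
    MeasurePreserving (fun (M : ι → κ → ℝ) (i : ι × κ) => √(v i) * M i.1 i.2)
      (Measure.pi fun _ => Measure.pi fun _ => gaussianReal 0 1)
      (Measure.pi fun i => gaussianReal 0 (v i)) := by
  have hm : Measurable (fun (M : ι → κ → ℝ) (i : ι × κ) => √(v i) * M i.1 i.2) := by fun_prop
  refine ⟨hm, ?_⟩
  symm
  refine Measure.pi_eq fun s hs => ?_
  have hpre : (fun (M : ι → κ → ℝ) (i : ι × κ) => √(v i) * M i.1 i.2) ⁻¹' Set.univ.pi s
      = Set.univ.pi fun a => Set.univ.pi fun b => (fun x : ℝ => √(v (a, b)) * x) ⁻¹' s (a, b) := by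
    ext M
    simp [Set.mem_pi]
  rw [Measure.map_apply hm (MeasurableSet.univ_pi hs), hpre, Measure.pi_pi,
    Fintype.prod_prod_type]
  refine Finset.prod_congr rfl fun a _ => ?_
  rw [Measure.pi_pi]
  refine Finset.prod_congr rfl fun b _ => ?_
  rw [← Measure.map_apply (by fun_prop) (hs _), gaussianReal_map_const_mul]
  congr 2
  · simp
  · ext
    simp [Real.sq_sqrt]

lemma multiWeight_pos {m D : ℕ} (j : multiIndex m D) : 0 < multiWeight j := by
  rw [multiWeight]; positivity

lemma coe_kssVar {m D : ℕ} (i : kssIndex m D) : (kssVar m D i : ℝ) = multiWeight i.2 := by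
  simp [kssVar, multiWeight]

lemma kssPoly_eq_inner {m D : ℕ} (Ξ : Fin m → EuclideanSpace ℝ (multiIndex m D)) (ℓ : Fin m)
    (t : Fin m → ℝ) :
    kssPoly m D (fun i => √(multiWeight i.2) * Ξ i.1 i.2) ℓ t
      = inner ℝ (Ξ ℓ) (powerFeature m D (affineLift t)) := by
  rw [kssPoly, PiLp.inner_apply]
  refine Finset.sum_congr rfl fun j _ => ?_
  simp [powerFeature, multiMonomial]
  ring

lemma kssCount_eq_zeroCount {m D : ℕ} (Ξ : Fin m → EuclideanSpace ℝ (multiIndex m D)) :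
    (kssCount m D (fun i => √(multiWeight i.2) * Ξ i.1 i.2) : ℝ)
      = (zeroCount (powerFeature m D) Ξ).toReal := by
  have hset : {t : Fin m → ℝ | ∀ ℓ, kssPoly m D (fun i => √(multiWeight i.2) * Ξ i.1 i.2) ℓ t = 0}
      = {t : Fin m → ℝ | evalSystem Ξ (powerFeature m D (affineLift t)) = 0} := by
    ext t
    simp only [Set.mem_ofPred_eq, kssPoly_eq_inner, funext_iff, evalSystem, Pi.zero_apply]
  rw [kssCount, hset, zeroCount, setCount_eq_encard, Set.ncard]
  cases h : Set.encard {t : Fin m → ℝ | evalSystem Ξ (powerFeature m D (affineLift t)) = 0} <;> simp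

lemma measurable_kssCount (m d : ℕ) : Measurable fun ω => (kssCount m (d + 2) ω : ℝ) := by
  have h : (fun ω => (kssCount m (d + 2) ω : ℝ)) = fun ω =>
      (zeroCount (powerFeature m (d + 2)) fun ℓ => WithLp.toLp 2 fun j =>
        (√(multiWeight j))⁻¹ * ω (ℓ, j)).toReal := by
    funext ω
    rw [← kssCount_eq_zeroCount]
    congr 2
    funext i
    have := (Real.sqrt_pos.2 (multiWeight_pos i.2)).ne'
    simp [mul_inv_cancel_left₀ this]
  rw [h]
  refine ((measurable_zeroCount (isPowerFeature_powerFeature m d)).comp ?_).ennreal_toReal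
  refine measurable_pi_lambda _ fun ℓ => ?_
  refine (PiLp.continuous_toLp 2 _).measurable.comp ?_
  fun_prop

lemma variance_kssCount (m d : ℕ) :
    variance (fun ω => (kssCount m (d + 2) ω : ℝ)) (kssMeasure m (d + 2))
      = variance (fun Ξ => (zeroCount (powerFeature m (d + 2)) Ξ).toReal)
          (gaussianSystem m (EuclideanSpace ℝ (multiIndex m (d + 2)))) := by
  have h1 := measurePreserving_uncurry_mul_gaussianReal (kssVar m (d + 2))
  have h2 := measurePreserving_toLp_pi (m := m) (ι := multiIndex m (d + 2))
  rw [← h2.map_eq, variance_map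
    (measurable_zeroCount (isPowerFeature_powerFeature m d)).ennreal_toReal.aemeasurable
    h2.measurable.aemeasurable, kssMeasure, ← h1.map_eq, variance_map
    (measurable_kssCount m d).aemeasurable h1.measurable.aemeasurable]
  congr 1
  funext M
  rw [Function.comp_apply, Function.comp_apply, ← kssCount_eq_zeroCount]
  simp only [coe_kssVar]

/-- The asymptotic variance: there is a finite positive constant `V_∞` such that
`Var(N_{P_d}) / d^{m/2} → V_∞` as `d → ∞`. -/
theorem kss_asymptotic_variance (m : ℕ) (hm : 1 ≤ m) :
    ∃ V : ℝ, 0 < V ∧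
      Filter.Tendsto
        (fun d : ℕ =>
          variance (fun ω => (kssCount m d ω : ℝ)) (kssMeasure m d) / (d : ℝ) ^ ((m : ℝ) / 2))
        Filter.atTop (nhds V) := by
  obtain ⟨n, rfl⟩ : ∃ n, m = n + 1 := ⟨m - 1, by omega⟩
  obtain ⟨L, hL, hlim⟩ := exists_pos_tendsto_variance_zeroCount n
  refine ⟨L, hL, (tendsto_add_atTop_iff_nat 2).1 (hlim.congr fun d => ?_)⟩
  rw [variance_kssCount, Real.sqrt_eq_rpow, ← Real.rpow_natCast, ← Real.rpow_mul (by positivity)]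
  congr 2
  · push_cast; ring
  · ring
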